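/- Let D ≥ 3 be an odd integer. There is a constant C(D) such that for every nonzero binary form F(X, Y) ∈ ℤ[X, Y] of degree D with no repeated factor and all real U, V ≥ 1, the number μ₀(U, V) of pairs of integers (x, y) with |x| ≤ U, |y| ≤ V for which F(x, y) is a nonzero perfect square satisfies μ₀(U, V) ≤ C(D) · ( (UV)^{2/3} (log(2‖F‖))² + U + V ), where ‖F‖ is the maximum of the absolute values of the coefficients of F. -/

import Mathlib

open MvPolynomial

/-- The maximum of the absolute values of the coefficients of an integral polynomial. -/
def polyNorm (F : MvPolynomial (Fin 2) ℤ) : ℕ :=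
  F.support.sup fun d => (F.coeff d).natAbs

namespace SqSieve
open scoped Polynomial

/-! Part A: Stepanov method -/

section Stepanov

variable {p : ℕ} [Fact p.Prime]

/-- First-order differential operator. -/
noncomputable def stepT (g : (ZMod p)[X]) (e : ℕ) : (ZMod p)[X] →ₗ[ZMod p] (ZMod p)[X] :=
  LinearMap.mulLeft (ZMod p) ((e : (ZMod p)[X]) * Polynomial.derivative g) +
    (LinearMap.mulLeft (ZMod p) g).comp Polynomial.derivative

/-- iterated operator. -/
noncomputable def stepIt (g : (ZMod p)[X]) (e : ℕ) : ℕ → ((ZMod p)[X] →ₗ[ZMod p] (ZMod p)[X])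
  | 0 => LinearMap.id
  | k + 1 => (stepT g (e - k)).comp (stepIt g e k)

lemma stepT_apply (g w : (ZMod p)[X]) (e : ℕ) :
    stepT g e w = (e : (ZMod p)[X]) * Polynomial.derivative g * w + g * Polynomial.derivative w := by
  simp [stepT, mul_assoc]

lemma iterate_derivative_stepIt (g w : (ZMod p)[X]) (e k : ℕ) (hk : k ≤ e) :
    (Polynomial.derivative)^[k] (g ^ e * w) = g ^ (e - k) * stepIt g e k w := by
  induction k with
  | zero => simp [stepIt]
  | succ k ih =>
    rw [Function.iterate_succ_apply', ih (by omega)]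
    obtain ⟨d, hd⟩ : ∃ d, e - k = d + 1 := ⟨e - k - 1, by omega⟩
    have h2 : e - (k + 1) = d := by omega
    rw [stepIt, LinearMap.comp_apply, stepT_apply, h2, hd, Polynomial.derivative_mul,
      Polynomial.derivative_pow]
    simp only [Nat.add_sub_cancel, map_natCast]
    ring

lemma iterate_derivative_mul_Xp (w : (ZMod p)[X]) (j k : ℕ) :
    (Polynomial.derivative)^[k] (w * Polynomial.X ^ (j * p)) =
      (Polynomial.derivative)^[k] w * Polynomial.X ^ (j * p) := by
  induction k with
  | zero => simp
  | succ k ih =>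
    rw [Function.iterate_succ_apply', ih, Function.iterate_succ_apply', Polynomial.derivative_mul]
    have : Polynomial.derivative ((Polynomial.X : (ZMod p)[X]) ^ (j * p)) = 0 := by
      rw [Polynomial.derivative_X_pow]; simp
    rw [this]; simp

lemma natDegree_stepIt (g w : (ZMod p)[X]) (e k m b : ℕ) (hg : g.natDegree ≤ m)
    (hw : w.natDegree ≤ b) : (stepIt g e k w).natDegree ≤ b + k * m := by
  induction k with
  | zero => simpa [stepIt] using hw
  | succ k ih =>
    rw [stepIt, LinearMap.comp_apply, stepT_apply]
    refine Polynomial.natDegree_add_le_of_degree_le ?_ ?_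
    · refine Polynomial.natDegree_mul_le.trans ?_
      refine (Nat.add_le_add (Polynomial.natDegree_mul_le) ih).trans ?_
      have := Polynomial.natDegree_derivative_le g
      have h3 : ((e - k : ℕ) : (ZMod p)[X]).natDegree = 0 := Polynomial.natDegree_natCast _
      rw [h3]
      have : (k+1) * m = k * m + m := by ring
      omega
    · refine Polynomial.natDegree_mul_le.trans ?_
      have := Polynomial.natDegree_derivative_le (stepIt g e k w)
      have : (k+1) * m = k * m + m := by ring
      omega

/-- the non-degeneracy condition on `g`. -/
def NonSq (g : (ZMod p)[X]) : Prop :=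
  ∀ (r s : (ZMod p)[X]) (c : ZMod p), c ≠ 0 → r ^ 2 * g = Polynomial.C c * s ^ 2 → r = 0

lemma X_pow_dvd_sub (g : (ZMod p)[X]) :
    (Polynomial.X : (ZMod p)[X]) ^ p ∣ g ^ p - Polynomial.C (g.eval 0) := by
  rw [← ZMod.expand_card g]
  have h : (Polynomial.X : (ZMod p)[X]) ∣ g - Polynomial.C (g.eval 0) := by
    rw [Polynomial.X_dvd_iff]; simp [Polynomial.coeff_zero_eq_eval_zero]
  obtain ⟨q, hq⟩ := h
  have := congrArg (Polynomial.expand (ZMod p) p) hq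
  rw [map_sub, map_mul, Polynomial.expand_C, Polynomial.expand_X] at this
  exact ⟨_, this⟩

lemma stepanov_nonvanish (hp2 : p ≠ 2) (g : (ZMod p)[X]) (hns : NonSq g) (h0 : g.eval 0 ≠ 0)
    (b : ℕ) (hb : 2 * b + g.natDegree < p) (J : ℕ) :
    ∀ r s : ℕ → (ZMod p)[X], (∀ j, (r j).natDegree ≤ b) → (∀ j, (s j).natDegree ≤ b) →
    ∑ j ∈ Finset.range J, (r j + s j * g ^ (p / 2)) * Polynomial.X ^ (j * p) = 0 →
    ∀ j < J, r j = 0 ∧ s j = 0 := by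
  have hpp : p.Prime := Fact.out
  have hodd : 2 * (p / 2) + 1 = p := by
    have := hpp.eq_two_or_odd; omega
  induction J with
  | zero => intro r s _ _ _ j hj; omega
  | succ J ih =>
    intro r s hr hs hsum
    rw [Finset.sum_range_succ'] at hsum
    set M := ∑ j ∈ Finset.range J, (r (j+1) + s (j+1) * g ^ (p / 2)) * Polynomial.X ^ (j * p) with hM
    have e1 : ∑ j ∈ Finset.range J, (r (j+1) + s (j+1) * g ^ (p / 2)) *
        (Polynomial.X : (ZMod p)[X]) ^ ((j+1) * p) = Polynomial.X ^ p * M := by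
      rw [hM, Finset.mul_sum]
      refine Finset.sum_congr rfl fun j _ => ?_
      rw [add_mul j 1 p, one_mul, pow_add]; ring
    rw [e1] at hsum
    simp only [zero_mul, pow_zero, mul_one] at hsum
    have hr0 : r 0 = -(s 0 * g ^ (p/2)) - Polynomial.X ^ p * M := by linear_combination hsum
    have hgp : g ^ p = g ^ (p/2) * g ^ (p/2) * g := by
      have : g ^ (2 * (p/2) + 1) = g ^ (p/2) * g ^ (p/2) * g := by ring
      simpa only [hodd] using this
    have hdvd : (Polynomial.X : (ZMod p)[X]) ^ p ∣
        r 0 ^ 2 * g - Polynomial.C (g.eval 0) * s 0 ^ 2 := by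
      obtain ⟨q, hq⟩ := X_pow_dvd_sub g
      refine ⟨s 0 ^ 2 * q + (2 * s 0 * g ^ (p/2) * M + Polynomial.X ^ p * M ^ 2) * g, ?_⟩
      have : Polynomial.C (g.eval 0) = g ^ p - Polynomial.X ^ p * q := by rw [← hq]; ring
      rw [this, hgp, hr0]; ring
    have hz : r 0 ^ 2 * g - Polynomial.C (g.eval 0) * s 0 ^ 2 = 0 := by
      by_contra hne
      have h1 := Polynomial.natDegree_le_of_dvd hdvd hne
      rw [Polynomial.natDegree_X_pow] at h1
      have h2 : (r 0 ^ 2 * g - Polynomial.C (g.eval 0) * s 0 ^ 2).natDegree ≤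
          2 * b + g.natDegree := by
        refine (Polynomial.natDegree_sub_le _ _).trans (max_le ?_ ?_)
        · refine Polynomial.natDegree_mul_le.trans ?_
          have := Polynomial.natDegree_pow_le (p := r 0) (n := 2)
          have := hr 0
          omega
        · refine (Polynomial.natDegree_C_mul_le _ _).trans ?_
          have := Polynomial.natDegree_pow_le (p := s 0) (n := 2)
          have := hs 0
          omega
      omega
    have hr00 : r 0 = 0 := hns (r 0) (s 0) _ h0 (sub_eq_zero.mp hz)
    have hs00 : s 0 = 0 := by
      rw [hr00] at hz
      have : Polynomial.C (g.eval 0) * s 0 ^ 2 = 0 := by linear_combination -hz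
      rcases mul_eq_zero.mp this with h | h
      · exact absurd (Polynomial.C_eq_zero.mp h) h0
      · exact pow_eq_zero_iff (two_ne_zero) |>.mp h
    have hM0 : M = 0 := by
      rw [hr00, hs00] at hsum
      have : (Polynomial.X : (ZMod p)[X]) ^ p * M = 0 := by linear_combination hsum
      rcases mul_eq_zero.mp this with h | h
      · exact absurd h (pow_ne_zero _ Polynomial.X_ne_zero)
      · exact h
    intro j hj
    rcases j with _ | j
    · exact ⟨hr00, hs00⟩
    · exact ih (fun j => r (j+1)) (fun j => s (j+1)) (fun j => hr _) (fun j => hs _) hM0 j (by omega)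

/-- the sum of the auxiliary polynomials for the `k`-th derivative -/
noncomputable def stepCond (g : (ZMod p)[X]) (a : ZMod p) (ℓ J b k : ℕ) :
    ((Fin J → Polynomial.degreeLT (ZMod p) b) × (Fin J → Polynomial.degreeLT (ZMod p) b)) →ₗ[ZMod p]
      (ZMod p)[X] where
  toFun v := ∑ j : Fin J, (stepIt g ℓ k (v.1 j : (ZMod p)[X]) +
    Polynomial.C a * stepIt g (ℓ + p / 2) k (v.2 j : (ZMod p)[X])) * Polynomial.X ^ (j : ℕ)
  map_add' v w := by
    rw [← Finset.sum_add_distrib]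
    refine Finset.sum_congr rfl fun j _ => ?_
    simp; ring
  map_smul' c v := by
    rw [Finset.smul_sum]
    refine Finset.sum_congr rfl fun j _ => ?_
    simp only [Prod.smul_fst, Prod.smul_snd, Pi.smul_apply, Submodule.coe_smul, map_smul,
      RingHom.id_apply]
    simp only [Polynomial.smul_eq_C_mul]; ring

lemma finrank_degreeLT (b : ℕ) : Module.finrank (ZMod p) (Polynomial.degreeLT (ZMod p) b) = b := by
  rw [(Polynomial.degreeLTEquiv (ZMod p) b).finrank_eq]; simp

lemma degreeLT_natDegree {b : ℕ} (w : Polynomial.degreeLT (ZMod p) (b+1)) :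
    (w : (ZMod p)[X]).natDegree ≤ b := by
  have := Polynomial.mem_degreeLT.mp w.2
  rw [Polynomial.natDegree_le_iff_degree_le]
  by_contra hc
  push Not at hc
  have h2 : (b : WithBot ℕ) + 1 ≤ (w : (ZMod p)[X]).degree := by
    rw [Polynomial.degree_eq_natDegree (by rintro h; simp [h] at hc)] at hc ⊢
    exact_mod_cast hc
  exact absurd this (not_lt.mpr (by simpa using h2))

lemma stepCond_natDegree (g : (ZMod p)[X]) (a : ZMod p) (ℓ J b k : ℕ) (hk : k < ℓ)
    (v : (Fin J → Polynomial.degreeLT (ZMod p) (b+1)) ×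
      (Fin J → Polynomial.degreeLT (ZMod p) (b+1))) :
    (stepCond g a ℓ J (b+1) k v).natDegree ≤ b + ℓ * g.natDegree + J := by
  rw [stepCond, LinearMap.coe_mk, AddHom.coe_mk]
  refine Polynomial.natDegree_sum_le_of_forall_le _ _ fun j _ => ?_
  refine Polynomial.natDegree_mul_le.trans ?_
  rw [Polynomial.natDegree_X_pow]
  have hk' : k * g.natDegree ≤ ℓ * g.natDegree := Nat.mul_le_mul_right _ hk.le
  have hj := j.2
  refine Nat.add_le_add ?_ hj.le
  refine Polynomial.natDegree_add_le_of_degree_le ?_ ?_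
  · exact (natDegree_stepIt g _ ℓ k _ b le_rfl (degreeLT_natDegree _)).trans (by omega)
  · refine (Polynomial.natDegree_C_mul_le _ _).trans ?_
    exact (natDegree_stepIt g _ _ k _ b le_rfl (degreeLT_natDegree _)).trans (by omega)

lemma stepanov_exists (g : (ZMod p)[X]) (a : ZMod p) (ℓ J b : ℕ)
    (hcount : ℓ * (b + ℓ * g.natDegree + J + 1) < 2 * (J * (b + 1))) :
    ∃ v, v ≠ 0 ∧ ∀ k < ℓ, stepCond g a ℓ J (b+1) k v = 0 := by
  let φ : ((Fin J → Polynomial.degreeLT (ZMod p) (b+1)) ×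
      (Fin J → Polynomial.degreeLT (ZMod p) (b+1))) →ₗ[ZMod p]
      (Fin ℓ → Fin (b + ℓ * g.natDegree + J + 1) → ZMod p) :=
    LinearMap.pi fun k => LinearMap.pi fun i =>
      (Polynomial.lcoeff (ZMod p) (i : ℕ)).comp (stepCond g a ℓ J (b+1) k)
  have : Module.Finite (ZMod p) (Polynomial.degreeLT (ZMod p) (b+1)) :=
    Module.Finite.equiv (Polynomial.degreeLTEquiv (ZMod p) (b+1)).symm
  have hker : φ.ker ≠ ⊥ := by
    apply LinearMap.ker_ne_bot_of_finrank_lt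
    rw [Module.finrank_prod]
    simp only [Module.finrank_pi_fintype, finrank_degreeLT, Module.finrank_self, Finset.sum_const,
      Finset.card_univ, Fintype.card_fin, smul_eq_mul, mul_one]
    omega
  obtain ⟨v, hv, hv0⟩ := Submodule.exists_mem_ne_zero_of_ne_bot hker
  refine ⟨v, hv0, fun k hk => ?_⟩
  ext i
  by_cases hi : i < b + ℓ * g.natDegree + J + 1
  · have := congrFun (congrFun (LinearMap.mem_ker.mp hv) ⟨k, hk⟩) ⟨i, hi⟩
    simpa [φ] using this
  · rw [Polynomial.coeff_eq_zero_of_natDegree_lt]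
    · simp
    · exact lt_of_le_of_lt (stepCond_natDegree g a ℓ J b k hk v) (by omega)

lemma iterate_derivative_finset_sum {ι : Type*} (s : Finset ι) (f : ι → (ZMod p)[X]) (k : ℕ) :
    (Polynomial.derivative)^[k] (∑ i ∈ s, f i) = ∑ i ∈ s, (Polynomial.derivative)^[k] (f i) := by
  induction k with
  | zero => simp
  | succ k ih => simp only [Function.iterate_succ_apply', ih, map_sum]

lemma stepanov_core (hp2 : p ≠ 2) (g : (ZMod p)[X]) (hns : NonSq g) (h0 : g.eval 0 ≠ 0)
    (a : ZMod p) (ℓ J b : ℕ) (hl0 : 0 < ℓ) (hb : 2 * b + g.natDegree < p) (hl : ℓ ≤ p)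
    (hcount : ℓ * (b + ℓ * g.natDegree + J + 1) < 2 * (J * (b + 1))) :
    ℓ * (Finset.univ.filter fun x : ZMod p => g.eval x ^ (p / 2) = a).card ≤
      ℓ * g.natDegree + b + (p / 2) * g.natDegree + J * p := by
  classical
  have hpp : p.Prime := Fact.out
  obtain ⟨v, hv0, hv⟩ := stepanov_exists g a ℓ J b hcount
  let r : ℕ → (ZMod p)[X] := fun j => if h : j < J then (v.1 ⟨j, h⟩ : (ZMod p)[X]) else 0
  let s : ℕ → (ZMod p)[X] := fun j => if h : j < J then (v.2 ⟨j, h⟩ : (ZMod p)[X]) else 0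
  have hr : ∀ j, (r j).natDegree ≤ b := by
    intro j; simp only [r]; split_ifs
    · exact degreeLT_natDegree _
    · simp
  have hs : ∀ j, (s j).natDegree ≤ b := by
    intro j; simp only [s]; split_ifs
    · exact degreeLT_natDegree _
    · simp
  set G := ∑ j ∈ Finset.range J, (r j + s j * g ^ (p / 2)) * (Polynomial.X : (ZMod p)[X]) ^ (j * p)
    with hG
  have hgne : g ≠ 0 := by rintro rfl; simp at h0
  have hGne : G ≠ 0 := by
    intro hz
    apply hv0
    have := stepanov_nonvanish hp2 g hns h0 b hb J r s hr hs hz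
    ext j : 2
    · ext1
      have := (this j j.2).1
      simpa [r] using this
    · ext1
      have := (this j j.2).2
      simpa [s] using this
  set h := g ^ ℓ * G with hh
  have hne : h ≠ 0 := mul_ne_zero (pow_ne_zero _ hgne) hGne
  have hsum : h = ∑ j ∈ Finset.range J, (g ^ ℓ * r j + g ^ (ℓ + p/2) * s j) *
      (Polynomial.X : (ZMod p)[X]) ^ (j * p) := by
    rw [hh, hG, Finset.mul_sum]
    refine Finset.sum_congr rfl fun j _ => ?_
    ring
  have hcond : ∀ k < ℓ, ∑ j ∈ Finset.range J, (stepIt g ℓ k (r j) +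
    Polynomial.C a * stepIt g (ℓ + p / 2) k (s j)) * Polynomial.X ^ j = 0 := by
    intro k hk
    have := hv k hk
    have e : stepCond g a ℓ J (b+1) k v = ∑ j : Fin J, (stepIt g ℓ k (v.1 j : (ZMod p)[X]) +
      Polynomial.C a * stepIt g (ℓ + p / 2) k (v.2 j : (ZMod p)[X])) * Polynomial.X ^ (j : ℕ) := rfl
    rw [← this, e, Finset.sum_range]
    refine Finset.sum_congr rfl fun j _ => ?_
    simp [r, s]
  have hmult : ∀ x : ZMod p, g.eval x ^ (p / 2) = a → ℓ ≤ Polynomial.rootMultiplicity x h := by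
    intro x hx
    have := Polynomial.lt_rootMultiplicity_of_isRoot_iterate_derivative_of_mem_nonZeroDivisors
      (p := h) (t := x) (n := ℓ - 1) hne ?_ ?_
    · omega
    · intro k hk
      have hk' : k < ℓ := by omega
      rw [Polynomial.IsRoot, hsum, iterate_derivative_finset_sum]
      have h1 : ∀ j ∈ Finset.range J, (Polynomial.derivative)^[k] ((g ^ ℓ * r j +
          g ^ (ℓ + p/2) * s j) * (Polynomial.X : (ZMod p)[X]) ^ (j * p)) =
          (g ^ (ℓ - k) * stepIt g ℓ k (r j) + g ^ (ℓ - k + p/2) * stepIt g (ℓ+p/2) k (s j)) *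
            (Polynomial.X : (ZMod p)[X]) ^ (j * p) := by
        intro j _
        rw [iterate_derivative_mul_Xp, iterate_map_add,
          iterate_derivative_stepIt _ _ _ _ hk'.le, iterate_derivative_stepIt _ _ _ _ (by omega)]
        congr 4
        omega
      rw [Finset.sum_congr rfl h1, Polynomial.eval_finsetSum]
      have h2 := congrArg (Polynomial.eval x) (hcond k hk')
      rw [Polynomial.eval_finsetSum] at h2
      simp only [Polynomial.eval_mul, Polynomial.eval_add, Polynomial.eval_pow, Polynomial.eval_X,
        Polynomial.eval_C, Polynomial.eval_zero] at h2 ⊢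
      have h3 : ∀ j ∈ Finset.range J, (g.eval x ^ (ℓ - k) * (stepIt g ℓ k (r j)).eval x +
          g.eval x ^ (ℓ - k + p/2) * (stepIt g (ℓ+p/2) k (s j)).eval x) * x ^ (j * p) =
          g.eval x ^ (ℓ - k) * (((stepIt g ℓ k (r j)).eval x + a *
            (stepIt g (ℓ+p/2) k (s j)).eval x) * x ^ j) := by
        intro j _
        rw [pow_add, hx, mul_comm j p, pow_mul, ZMod.pow_card]
        ring
      rw [Finset.sum_congr rfl h3, ← Finset.mul_sum, h2, mul_zero]
    · rw [mem_nonZeroDivisors_iff_ne_zero]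
      intro hz
      rw [ZMod.natCast_eq_zero_iff, hpp.dvd_factorial] at hz
      omega
  have hdeg : h.natDegree ≤ ℓ * g.natDegree + b + (p / 2) * g.natDegree + J * p := by
    rw [hh]
    refine Polynomial.natDegree_mul_le.trans ?_
    have h1 : (g ^ ℓ).natDegree ≤ ℓ * g.natDegree := Polynomial.natDegree_pow_le
    have h2 : G.natDegree ≤ b + (p / 2) * g.natDegree + J * p := by
      refine Polynomial.natDegree_sum_le_of_forall_le _ _ fun j hj => ?_
      refine Polynomial.natDegree_mul_le.trans ?_
      rw [Polynomial.natDegree_X_pow]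
      refine Nat.add_le_add ?_ (Nat.mul_le_mul_right _ (Finset.mem_range.mp hj).le)
      refine Polynomial.natDegree_add_le_of_degree_le ((hr j).trans (by omega)) ?_
      refine Polynomial.natDegree_mul_le.trans ?_
      exact Nat.add_le_add (hs j) Polynomial.natDegree_pow_le
    omega
  have hroots := (Polynomial.card_roots' h).trans hdeg
  refine le_trans ?_ hroots
  rw [← Multiset.toFinset_sum_count_eq, mul_comm, ← smul_eq_mul, ← Finset.sum_const]
  refine (Finset.sum_le_sum (g := fun x => Multiset.count x h.roots) ?_).trans
    (Finset.sum_le_sum_of_subset ?_)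
  · intro x hx
    rw [Polynomial.count_roots]
    exact hmult x (Finset.mem_filter.mp hx).2
  · intro x hx
    rw [Multiset.mem_toFinset, ← Multiset.count_pos, Polynomial.count_roots]
    exact lt_of_lt_of_le hl0 (hmult x (Finset.mem_filter.mp hx).2)

lemma stepanov_bound (hp2 : p ≠ 2) (g : (ZMod p)[X]) (hns : NonSq g) (h0 : g.eval 0 ≠ 0)
    (a : ZMod p) (hp : (g.natDegree + 3) ^ 2 ≤ p) :
    2 * (Finset.univ.filter fun x : ZMod p => g.eval x ^ (p / 2) = a).card ≤
      p + 2 * g.natDegree + (3 * g.natDegree + 7) * (Nat.sqrt p + 2) := by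
  set m := g.natDegree with hm
  set l := Nat.sqrt p with hl
  have hl1 : l * l ≤ p := Nat.sqrt_le p
  have hl2 : p < (l + 1) * (l + 1) := Nat.lt_succ_sqrt p
  have hl3 : m + 3 ≤ l := by rw [hl, Nat.le_sqrt]; nlinarith
  obtain ⟨b, hb⟩ : ∃ b, (p - m) / 2 = b + 1 := ⟨(p-m)/2 - 1, by
    have : m + 3 ≤ p := by nlinarith
    omega⟩
  have hmp : m ≤ p := by nlinarith
  have hB1 : 2 * (b + 1) ≤ p - m := by omega
  have hB2 : p ≤ 2 * (b+1) + m + 1 := by omega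
  obtain ⟨J, hJ⟩ : ∃ J, J = l / 2 + m + 3 := ⟨_, rfl⟩
  have hJ1 : l + 2 * m + 5 ≤ 2 * J := by omega
  have hJ2 : 2 * J ≤ l + 2 * m + 6 := by omega
  have key := stepanov_core hp2 g hns h0 a l J b (by omega) (by omega) (by nlinarith) (by
    rw [← hm]
    nlinarith)
  rw [← hm] at key
  set N := (Finset.univ.filter fun x : ZMod p => g.eval x ^ (p / 2) = a).card
  have h1 : 2 * (p / 2) ≤ p := by omega
  have h2 : 2 * (l * N) ≤ 2 * (l * m) + p + p * m + (l + 2 * m + 6) * p := by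
    have i1 : 2 * (p / 2) * m ≤ p * m := Nat.mul_le_mul_right _ h1
    have i2 : 2 * J * p ≤ (l + 2 * m + 6) * p := Nat.mul_le_mul_right _ hJ2
    have i3 : 2 * b ≤ p := by omega
    nlinarith
  have h3 : p ≤ l * (l + 2) := by nlinarith
  have hl0 : 0 < l := by omega
  refine le_of_mul_le_mul_left (a := l) ?_ hl0
  nlinarith [Nat.mul_le_mul_left (3 * m + 7) h3]

lemma NonSq.translate {g : (ZMod p)[X]} (hns : NonSq g) (t : ZMod p) :
    NonSq (g.comp (Polynomial.X + Polynomial.C t)) := by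
  intro r s c hc h
  have h1 := congrArg (fun w : (ZMod p)[X] => w.comp (Polynomial.X - Polynomial.C t)) h
  simp only [Polynomial.mul_comp, Polynomial.pow_comp, Polynomial.comp_assoc, Polynomial.C_comp,
    Polynomial.add_comp, Polynomial.X_comp, sub_add_cancel, Polynomial.comp_X] at h1
  have h2 := hns _ _ c hc h1
  have h3 := congrArg (fun w : (ZMod p)[X] => w.comp (Polynomial.X + Polynomial.C t)) h2
  simpa [Polynomial.comp_assoc] using h3

/-- Weil bound for quadratic character sums (with a weak constant). -/
theorem weil_bound (hp2 : p ≠ 2) (g : (ZMod p)[X]) (hns : NonSq g) (m : ℕ)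
    (hm : g.natDegree ≤ m) :
    |((∑ x : ZMod p, quadraticChar (ZMod p) (g.eval x) : ℤ) : ℝ)| ≤ (24 * m + 40) * Real.sqrt p := by
  classical
  have hpp : p.Prime := Fact.out
  have htriv : |((∑ x : ZMod p, quadraticChar (ZMod p) (g.eval x) : ℤ) : ℝ)| ≤ p := by
    have : |(∑ x : ZMod p, quadraticChar (ZMod p) (g.eval x) : ℤ)| ≤ p := by
      refine (Finset.abs_sum_le_sum_abs _ _).trans ?_
      refine (Finset.sum_le_sum (g := fun _ => (1 : ℤ)) fun x _ => ?_).trans ?_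
      · rcases quadraticChar_isQuadratic (ZMod p) (g.eval x) with h | h | h <;> simp [h]
      · simp [ZMod.card]
    exact_mod_cast this
  have hs1 : (1 : ℝ) ≤ Real.sqrt p := by
    rw [Real.one_le_sqrt]; exact_mod_cast hpp.one_lt.le
  have hsq : Real.sqrt p * Real.sqrt p = p := Real.mul_self_sqrt (by positivity)
  by_cases hp : (g.natDegree + 3) ^ 2 ≤ p
  swap
  · refine htriv.trans ?_
    push Not at hp
    have : Real.sqrt p ≤ m + 3 := by
      rw [Real.sqrt_le_left (by positivity)]
      have : p ≤ (m + 3) ^ 2 := hp.le.trans (Nat.pow_le_pow_left (by omega) 2)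
      exact_mod_cast this
    nlinarith
  have hg0 : g ≠ 0 := by
    rintro rfl
    have := hns 1 0 1 one_ne_zero (by simp)
    exact one_ne_zero this
  obtain ⟨t, ht⟩ : ∃ t : ZMod p, g.eval t ≠ 0 := by
    by_contra hc
    push Not at hc
    apply hg0
    apply Polynomial.eq_zero_of_natDegree_lt_card_of_eval_eq_zero g Function.injective_id
    · intro x; exact hc x
    · rw [ZMod.card]; nlinarith
  set G := g.comp (Polynomial.X + Polynomial.C t) with hG
  have hGdeg : G.natDegree = g.natDegree := by
    rw [hG, Polynomial.natDegree_comp]; simp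
  have hG0 : G.eval 0 ≠ 0 := by simpa [hG] using ht
  have hsum : ∑ x : ZMod p, quadraticChar (ZMod p) (g.eval x) =
      ∑ x : ZMod p, quadraticChar (ZMod p) (G.eval x) := by
    rw [← Equiv.sum_comp (Equiv.addRight t)]
    refine Finset.sum_congr rfl fun x _ => ?_
    simp [hG]
  have b1 := stepanov_bound hp2 G (hns.translate t) hG0 1 (by rw [hGdeg]; exact hp)
  have b2 := stepanov_bound hp2 G (hns.translate t) hG0 (-1) (by rw [hGdeg]; exact hp)
  have b0 : (Finset.univ.filter fun x : ZMod p => G.eval x = 0).card ≤ G.natDegree := by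
    have hGne : G ≠ 0 := by rintro h; simp [h] at hG0
    refine le_trans (Finset.card_le_card (t := G.roots.toFinset) fun x hx => ?_)
      ((Multiset.toFinset_card_le _).trans (Polynomial.card_roots' G))
    simpa [hGne] using hx
  have hchar : ringChar (ZMod p) ≠ 2 := by rwa [ZMod.ringChar_zmod_n]
  have hpt : ∀ x : ZMod p, quadraticChar (ZMod p) (G.eval x) =
      (if G.eval x ^ (p/2) = 1 then 1 else 0) - (if G.eval x ^ (p/2) = -1 then 1 else 0) ∧
      (1 : ℤ) = (if G.eval x ^ (p/2) = 1 then 1 else 0) + (if G.eval x ^ (p/2) = -1 then 1 else 0) +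
        (if G.eval x = 0 then 1 else 0) := by
    intro x
    have h1 := quadraticChar_eq_pow_of_char_ne_two' hchar (G.eval x)
    rw [ZMod.card] at h1
    have hne : (1 : ZMod p) ≠ -1 := fun h => (Ring.neg_one_ne_one_of_char_ne_two hchar) h.symm
    have hp20 : p / 2 ≠ 0 := by
      have := hpp.two_le
      omega
    rcases quadraticChar_isQuadratic (ZMod p) (G.eval x) with h | h | h
    · have h0 : G.eval x = 0 := quadraticChar_eq_zero_iff.mp h
      rw [h, h0]; simp [zero_pow hp20]
    · have h0 : G.eval x ≠ 0 := fun h' => by rw [h'] at h; simp at h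
      rw [h] at h1
      rw [h, ← h1]; simp [h0, hne]
    · have h0 : G.eval x ≠ 0 := fun h' => by rw [h'] at h; simp at h
      rw [h] at h1
      rw [h, ← h1]; simp [h0, hne.symm]
  have hS := Finset.sum_congr rfl fun x (_ : x ∈ (Finset.univ : Finset (ZMod p))) => (hpt x).1
  have hT := Finset.sum_congr rfl fun x (_ : x ∈ (Finset.univ : Finset (ZMod p))) => (hpt x).2
  rw [Finset.sum_sub_distrib] at hS
  rw [Finset.sum_add_distrib, Finset.sum_add_distrib] at hT
  simp only [Finset.sum_boole, Finset.sum_const, Finset.card_univ, ZMod.card, smul_eq_mul,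
    mul_one, nsmul_eq_mul] at hS hT
  rw [hsum, hS]
  set N1 := (Finset.univ.filter fun x : ZMod p => G.eval x ^ (p / 2) = 1).card
  set N2 := (Finset.univ.filter fun x : ZMod p => G.eval x ^ (p / 2) = -1).card
  set N0 := (Finset.univ.filter fun x : ZMod p => G.eval x = 0).card
  rw [hGdeg] at b0 b1 b2
  set l := Nat.sqrt p
  have hl : (l : ℝ) ≤ Real.sqrt p := Real.nat_sqrt_le_real_sqrt
  have hmm : (g.natDegree : ℝ) ≤ m := by exact_mod_cast hm
  have hm0 : (0:ℝ) ≤ g.natDegree := by positivity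
  have c1 : (2 : ℝ) * N1 ≤ p + 2 * g.natDegree + (3 * g.natDegree + 7) * (l + 2) := by exact_mod_cast b1
  have c2 : (2 : ℝ) * N2 ≤ p + 2 * g.natDegree + (3 * g.natDegree + 7) * (l + 2) := by exact_mod_cast b2
  have c0 : (N0 : ℝ) ≤ g.natDegree := by exact_mod_cast b0
  have cT : (p : ℝ) = N1 + N2 + N0 := by exact_mod_cast hT
  have e1 : ((3:ℝ) * g.natDegree + 7) * (l + 2) ≤ (3 * m + 7) * (3 * Real.sqrt p) := by
    apply mul_le_mul (by linarith) (by linarith) (by positivity) (by positivity)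
  have e2 : (m : ℝ) ≤ m * Real.sqrt p := by nlinarith [(Nat.cast_nonneg m : (0:ℝ) ≤ m)]
  push_cast
  rw [abs_le]
  constructor <;> nlinarith

end Stepanov
end SqSieve

namespace SqSieve
open scoped Polynomial

/-! Part C: local analysis -/

section Local

variable {q : ℕ} [Fact q.Prime]

lemma exists_prime_factor (g l : (ZMod q)[X]) (hg : Squarefree g) (hl : l ≠ 0)
    (hdeg : l.natDegree < g.natDegree) : ∃ P : (ZMod q)[X], Prime P ∧ P ∣ g ∧ ¬ P ∣ l := by
  classical
  by_contra hc
  push Not at hc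
  have h1 : UniqueFactorizationMonoid.radical g ∣ l := by
    rw [UniqueFactorizationMonoid.radical_dvd_iff_primeFactors_subset hl]
    intro P hP
    rw [UniqueFactorizationMonoid.mem_primeFactors] at hP ⊢
    have hPp := UniqueFactorizationMonoid.prime_of_normalized_factor P hP
    have h2 := hc P hPp (UniqueFactorizationMonoid.dvd_of_mem_normalizedFactors hP)
    exact (UniqueFactorizationMonoid.mem_normalizedFactors_iff' hl).mpr
      ⟨hPp.irreducible, UniqueFactorizationMonoid.normalize_normalized_factor P hP, h2⟩
  have h2 : g ∣ l := (hg.isRadical.dvd_radical hg.ne_zero).trans h1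
  have := Polynomial.natDegree_le_of_dvd h2 hl
  omega

lemma nonSq_mul (g l : (ZMod q)[X]) (hg : Squarefree g) (hl : l ≠ 0)
    (hdeg : l.natDegree < g.natDegree) : NonSq (g * l) := by
  intro r s c hc h
  by_contra hr
  obtain ⟨P, hP, hPg, hPl⟩ := exists_prime_factor g l hg hl hdeg
  have hs : s ≠ 0 := by
    rintro rfl
    have : r ^ 2 * (g * l) ≠ 0 := mul_ne_zero (pow_ne_zero _ hr) (mul_ne_zero hg.ne_zero hl)
    apply this; rw [h]; simp
  have h1 : emultiplicity P (g * l) = 1 := by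
    rw [emultiplicity_mul hP, emultiplicity_eq_zero.mpr hPl, add_zero]
    have a1 := (squarefree_iff_emultiplicity_le_one g).mp hg P
    have a2 : 1 ≤ emultiplicity P g := by
      have := le_emultiplicity_of_pow_dvd (k := 1) (by simpa using hPg)
      simpa using this
    rcases a1 with a1 | a1
    · exact le_antisymm a1 a2
    · exact absurd a1 hP.not_isUnit
  have h2 := congrArg (emultiplicity P) h
  have hcu : IsUnit (Polynomial.C c : (ZMod q)[X]) := by
    rw [Polynomial.isUnit_C]; exact hc.isUnit
  have hPc : ¬ P ∣ Polynomial.C c := fun hd => hP.not_isUnit (isUnit_of_dvd_unit hd hcu)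
  rw [emultiplicity_mul hP, h1, emultiplicity_mul hP, emultiplicity_eq_zero.mpr hPc, zero_add,
    emultiplicity_pow hP, emultiplicity_pow hP] at h2
  have fr : FiniteMultiplicity P r := FiniteMultiplicity.of_prime_left hP hr
  have fs : FiniteMultiplicity P s := FiniteMultiplicity.of_prime_left hP hs
  rw [fr.emultiplicity_eq_multiplicity, fs.emultiplicity_eq_multiplicity] at h2
  have h3 : 2 * multiplicity P r + 1 = 2 * multiplicity P s := by exact_mod_cast h2
  omega

/-- homogeneous evaluation of a univariate polynomial. -/
def hev {R : Type*} [CommRing R] (f : R[X]) (D : ℕ) (x y : R) : R :=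
  ∑ i ∈ Finset.range (D + 1), f.coeff i * x ^ i * y ^ (D - i)

lemma hev_map {R S : Type*} [CommRing R] [CommRing S] (φ : R →+* S) (f : R[X]) (D : ℕ) (x y : R) :
    hev (f.map φ) D (φ x) (φ y) = φ (hev f D x y) := by
  simp [hev]

lemma hev_scale {R : Type*} [CommRing R] (f : R[X]) (D : ℕ) (x y t : R) :
    hev f D (t * x) (t * y) = t ^ D * hev f D x y := by
  unfold hev
  rw [Finset.mul_sum]
  refine Finset.sum_congr rfl fun i hi => ?_
  have hi' : i ≤ D := by simpa [Nat.lt_succ_iff] using hi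
  have : t ^ D = t ^ i * t ^ (D - i) := by rw [← pow_add]; congr 1; omega
  rw [this]; ring

lemma hev_one {R : Type*} [CommRing R] (f : R[X]) (D : ℕ) (hf : f.natDegree ≤ D) (x : R) :
    hev f D x 1 = f.eval x := by
  rw [Polynomial.eval_eq_sum_range' (Nat.lt_succ_of_le hf)]
  simp [hev]

lemma hev_zero {R : Type*} [CommRing R] (f : R[X]) (D : ℕ) (x : R) :
    hev f D x 0 = f.coeff D * x ^ D := by
  unfold hev
  rw [Finset.sum_range_succ, Finset.sum_eq_zero]
  · simp
  · intro i hi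
    have : D - i ≠ 0 := by have := Finset.mem_range.mp hi; omega
    simp [this]

/-- good reduction. -/
structure GoodRed (g : (ZMod q)[X]) (D : ℕ) : Prop where
  sep : g.Separable
  le : g.natDegree ≤ D
  ge : D ≤ g.natDegree + 1

/-- the quadratic character as complex number. -/
noncomputable def qc (q : ℕ) [Fact q.Prime] : MulChar (ZMod q) ℂ :=
  (quadraticChar (ZMod q)).ringHomComp (Int.castRingHom ℂ)

lemma qc_apply (x : ZMod q) : qc q x = ((quadraticChar (ZMod q) x : ℤ) : ℂ) := rfl

lemma qc_zero : qc q 0 = 0 := by rw [qc_apply]; simp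

lemma qc_quad : (qc q).IsQuadratic := (quadraticChar_isQuadratic (ZMod q)).comp _

lemma qc_pow_odd (D : ℕ) (hD : Odd D) (x : ZMod q) : qc q (x ^ D) = qc q x := by
  rw [map_pow, qc_apply]
  obtain ⟨k, rfl⟩ := hD
  rcases quadraticChar_isQuadratic (ZMod q) x with h | h | h <;> simp [h, pow_succ, pow_mul]

lemma qc_cases (x : ZMod q) : (qc q x = 0 ∧ x = 0) ∨ (qc q x = 1 ∧ x ≠ 0) ∨
    (qc q x = -1 ∧ x ≠ 0) := by
  by_cases hx : x = 0
  · left; simp [hx, qc_zero]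
  · right
    rw [qc_apply]
    rcases quadraticChar_dichotomy hx with h | h
    · left; simp [h, hx]
    · right; simp [h, hx]

lemma norm_qc_le (x : ZMod q) : ‖qc q x‖ ≤ 1 := by
  rcases qc_cases x with h | h | h <;> simp [h.1]

lemma norm_qc_of_ne {x : ZMod q} (hx : x ≠ 0) : ‖qc q x‖ = 1 := by
  rcases qc_cases x with h | h | h
  · exact absurd h.2 hx
  · simp [h.1]
  · simp [h.1]

lemma ringChar_ne (hq : q ≠ 2) : ringChar (ZMod q) ≠ 2 := by rwa [ZMod.ringChar_zmod_n]

lemma qc_ne_one (hq : q ≠ 2) : qc q ≠ 1 := by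
  intro h
  obtain ⟨a, ha⟩ := quadraticChar_exists_neg_one (ringChar_ne hq)
  have h1 : qc q a = -1 := by rw [qc_apply, ha]; simp
  have ha0 : a ≠ 0 := by rintro rfl; simp at ha
  rw [h, MulChar.one_apply ha0.isUnit] at h1
  norm_num at h1

lemma norm_gaussSum (hq : q ≠ 2) : ‖gaussSum (qc q) (ZMod.stdAddChar (N := q))‖ = Real.sqrt q := by
  have h : gaussSum (qc q) (ZMod.stdAddChar (N := q)) ^ 2 = qc q (-1) * (Fintype.card (ZMod q) : ℂ) :=
    gaussSum_sq (qc_ne_one hq) qc_quad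
    (ZMod.isPrimitive_stdAddChar q)
  have h2 := congrArg norm h
  rw [norm_pow, norm_mul] at h2
  have h3 : ‖qc q (-1)‖ = 1 := norm_qc_of_ne (by simp)
  have h4 : ‖gaussSum (qc q) (ZMod.stdAddChar (N := q))‖ ^ 2 = q := by
    rw [h2]
    rw [h3]; simp [ZMod.card]
  rw [← h4, Real.sqrt_sq (norm_nonneg _)]

lemma sum_qc_mul (hq : q ≠ 2) (a : ZMod q) :
    ∑ x, qc q x * ZMod.stdAddChar (a * x) = qc q a * gaussSum (qc q) (ZMod.stdAddChar (N := q)) := by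
  by_cases ha : a = 0
  · subst ha
    have := MulChar.sum_eq_zero_of_ne_one (qc_ne_one hq)
    simp [this, qc_zero]
  · have h := gaussSum_mulShift (qc q) (ZMod.stdAddChar (N := q)) (Units.mk0 a ha)
    have h1 : gaussSum (qc q) (AddChar.mulShift ZMod.stdAddChar (Units.mk0 a ha : ZMod q)) =
        ∑ x, qc q x * ZMod.stdAddChar (a * x) := by
      simp [gaussSum, AddChar.mulShift_apply]
    rw [h1] at h
    rw [← h, ← mul_assoc, Units.val_mk0]
    rcases qc_cases a with h2 | h2 | h2
    · exact absurd h2.2 ha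
    · simp [h2.1]
    · simp [h2.1]

lemma norm_sum_qc_mul_le (hq : q ≠ 2) (a : ZMod q) :
    ‖∑ x, qc q x * ZMod.stdAddChar (a * x)‖ ≤ Real.sqrt q := by
  rw [sum_qc_mul hq, norm_mul, norm_gaussSum hq]
  have := norm_qc_le a
  nlinarith [Real.sqrt_nonneg (q : ℝ)]

lemma norm_sum_qc (hq : q ≠ 2) (g l : (ZMod q)[X]) (hg : Squarefree g) (hl : l ≠ 0)
    (hdeg : l.natDegree < g.natDegree) (m : ℕ) (hm : (g * l).natDegree ≤ m) :
    ‖∑ t, qc q (g.eval t * l.eval t)‖ ≤ (24 * m + 40) * Real.sqrt q := by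
  have h := weil_bound hq (g * l) (nonSq_mul g l hg hl hdeg) m hm
  have h2 : ∑ t, qc q (g.eval t * l.eval t) =
      (((∑ x : ZMod q, quadraticChar (ZMod q) ((g * l).eval x) : ℤ) : ℝ) : ℂ) := by
    push_cast
    refine Finset.sum_congr rfl fun t _ => ?_
    rw [qc_apply, Polynomial.eval_mul]
  rw [h2, Complex.norm_real]
  exact h

/-- the character of the form -/
noncomputable def chiF (g : (ZMod q)[X]) (D : ℕ) (x y : ZMod q) : ℂ := qc q (hev g D x y)

lemma chiF_scale (g : (ZMod q)[X]) {D : ℕ} (hD : Odd D) (x y t : ZMod q) :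
    chiF g D (t * x) (t * y) = qc q t * chiF g D x y := by
  rw [chiF, hev_scale, map_mul, qc_pow_odd D hD, chiF]

lemma chiF_yt (g : (ZMod q)[X]) {D : ℕ} (hD : Odd D) (hg : g.natDegree ≤ D) (y t : ZMod q) :
    chiF g D (y * t) y = qc q y * qc q (g.eval t) := by
  have := chiF_scale g hD t 1 y
  rw [mul_one] at this
  rw [this, chiF, hev_one g D hg]

lemma chiF_x0 (g : (ZMod q)[X]) {D : ℕ} (hD : Odd D) (x : ZMod q) :
    chiF g D x 0 = qc q (g.coeff D) * qc q x := by
  rw [chiF, hev_zero, map_mul, qc_pow_odd D hD]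

lemma sum_sub_y {y : ZMod q} (hy : y ≠ 0) (φ : ZMod q → ℂ) : ∑ x, φ x = ∑ t, φ (y * t) :=
  (Equiv.sum_comp (Equiv.mulLeft₀ y hy) φ).symm

lemma norm_chiF_sum_x (hq : q ≠ 2) {g : (ZMod q)[X]} {D : ℕ} (hD : Odd D) (hD3 : 3 ≤ D)
    (hg : GoodRed g D) (y : ZMod q) :
    ‖∑ x, chiF g D x y‖ ≤ (24 * D + 100) * Real.sqrt q := by
  by_cases hy : y = 0
  · subst hy
    simp only [chiF_x0 g hD, ← Finset.mul_sum, MulChar.sum_eq_zero_of_ne_one (qc_ne_one hq)]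
    simp; positivity
  · rw [sum_sub_y hy]
    simp only [chiF_yt g hD hg.le, ← Finset.mul_sum]
    rw [norm_mul, norm_qc_of_ne hy, one_mul]
    have h := norm_sum_qc hq g 1 hg.sep.squarefree one_ne_zero
      (by have := hg.ge; simp; omega) D (by simpa using hg.le)
    simp only [Polynomial.eval_one, mul_one] at h
    refine h.trans ?_
    have := Real.sqrt_nonneg (q : ℝ)
    nlinarith

/-- unnormalised Fourier coefficients. -/
noncomputable def ft (φ : ZMod q → ZMod q → ℂ) (a b : ZMod q) : ℂ :=
  ∑ x, ∑ y, φ x y * ZMod.stdAddChar (-(a * x + b * y))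

lemma norm_ft_chiF (hq : q ≠ 2) {g : (ZMod q)[X]} {D : ℕ} (hD : Odd D) (hD3 : 3 ≤ D)
    (hg : GoodRed g D) (a b : ZMod q) (ha : a ≠ 0) :
    ‖ft (chiF g D) a b‖ ≤ (24 * D + 100) * q := by
  have hs : Real.sqrt q * Real.sqrt q = q := Real.mul_self_sqrt (by positivity)
  have hq1 : (1 : ℝ) ≤ q := by exact_mod_cast (Fact.out : q.Prime).one_lt.le
  have hs1 : 1 ≤ Real.sqrt q := by rw [Real.one_le_sqrt]; exact hq1
  set e := ZMod.stdAddChar (N := q) with he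
  have h1 : ∀ y, ∑ x, chiF g D x y * e (-(a * x + b * y)) =
      (if y = 0 then ∑ x, chiF g D x 0 * e (-(a * x)) else 0) +
      ∑ t, qc q (g.eval t) * (qc q y * e (-(a * t + b) * y)) := by
    intro y
    by_cases hy : y = 0
    · subst hy
      simp [qc_zero]
    · rw [if_neg hy, zero_add, sum_sub_y hy]
      refine Finset.sum_congr rfl fun t _ => ?_
      rw [chiF_yt g hD hg.le]
      have : -(a * (y * t) + b * y) = -(a * t + b) * y := by ring
      rw [this]; ring
  have h2 : ft (chiF g D) a b = qc q (g.coeff D) * (∑ x, qc q x * e ((-a) * x)) +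
      (∑ t, qc q (g.eval t * (Polynomial.C (-a) * Polynomial.X + Polynomial.C (-b)).eval t)) *
        gaussSum (qc q) e := by
    unfold ft
    rw [Finset.sum_comm]
    rw [Finset.sum_congr rfl fun y _ => h1 y, Finset.sum_add_distrib]
    congr 1
    · rw [Finset.sum_ite_eq' Finset.univ (0 : ZMod q)]
      simp only [Finset.mem_univ, if_true, Finset.mul_sum]
      refine Finset.sum_congr rfl fun x _ => ?_
      rw [chiF_x0 g hD, neg_mul]; ring
    · rw [Finset.sum_comm, Finset.sum_mul]
      refine Finset.sum_congr rfl fun t _ => ?_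
      rw [← Finset.mul_sum, sum_qc_mul hq, map_mul]
      have : (Polynomial.C (-a) * Polynomial.X + Polynomial.C (-b)).eval t = -(a * t + b) := by
        simp; ring
      rw [this]; ring
  rw [h2]
  have ha' : -a ≠ 0 := neg_ne_zero.mpr ha
  have hl : (Polynomial.C (-a) * Polynomial.X + Polynomial.C (-b)).natDegree = 1 :=
    Polynomial.natDegree_linear ha'
  have hl0 : (Polynomial.C (-a) * Polynomial.X + Polynomial.C (-b) : (ZMod q)[X]) ≠ 0 := by
    intro h; rw [h] at hl; simp at hl
  have hw := norm_sum_qc hq g _ hg.sep.squarefree hl0 (by rw [hl]; have := hg.ge; omega) (D + 1)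
    (Polynomial.natDegree_mul_le.trans (by rw [hl]; have := hg.le; omega))
  have hgs := norm_gaussSum (q := q) hq
  have h3 := norm_sum_qc_mul_le hq (-a)
  have h4 := norm_qc_le (g.coeff D)
  refine (norm_add_le _ _).trans ?_
  rw [norm_mul, norm_mul, hgs]
  push_cast at hw
  have h5 : ‖qc q (g.coeff D)‖ * ‖∑ x, qc q x * e ((-a) * x)‖ ≤ 1 * Real.sqrt q :=
    mul_le_mul h4 h3 (norm_nonneg _) zero_le_one
  have h6 := mul_le_mul_of_nonneg_right hw (Real.sqrt_nonneg (q : ℝ))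
  nlinarith

/-! Parseval and inversion -/

lemma sum_std (b : ZMod q) : ∑ a : ZMod q, ZMod.stdAddChar (a * b) = if b = 0 then (q : ℂ) else 0 := by
  rw [AddChar.sum_mulShift b (ZMod.isPrimitive_stdAddChar q), ZMod.card]
  split_ifs <;> simp

lemma ft_inversion (φ : ZMod q → ZMod q → ℂ) (x y : ZMod q) :
    ∑ a, ∑ b, ft φ a b * ZMod.stdAddChar (a * x + b * y) = (q : ℂ) ^ 2 * φ x y := by
  have h1 : ∀ a b, ft φ a b * ZMod.stdAddChar (a * x + b * y) =
      ∑ x', ∑ y', φ x' y' * (ZMod.stdAddChar (a * (x - x')) * ZMod.stdAddChar (b * (y - y'))) := by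
    intro a b
    rw [ft, Finset.sum_mul]
    refine Finset.sum_congr rfl fun x' _ => ?_
    rw [Finset.sum_mul]
    refine Finset.sum_congr rfl fun y' _ => ?_
    rw [mul_assoc, ← AddChar.map_add_eq_mul, ← AddChar.map_add_eq_mul]
    congr 2; ring
  simp only [h1]
  calc _ = ∑ x', ∑ y', φ x' y' * ((∑ a : ZMod q, ZMod.stdAddChar (a * (x - x'))) *
        ∑ b : ZMod q, ZMod.stdAddChar (b * (y - y'))) := by
        simp only [Finset.sum_mul_sum]
        simp only [Finset.mul_sum]
        rw [Finset.sum_congr rfl fun a _ => Finset.sum_comm, Finset.sum_comm]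
        refine Finset.sum_congr rfl fun x' _ => ?_
        rw [Finset.sum_congr rfl fun a _ => Finset.sum_comm, Finset.sum_comm]
    _ = _ := by
        simp only [sum_std, sub_eq_zero]
        rw [Finset.sum_eq_single x, Finset.sum_eq_single y]
        · simp; ring
        · intro y' _ hy'; simp [Ne.symm hy']
        · simp
        · intro x' _ hx'; simp [Ne.symm hx']
        · simp

lemma parseval_one (φ : ZMod q → ℂ) :
    ∑ a, ‖∑ x, φ x * ZMod.stdAddChar (-(a * x))‖ ^ 2 = q * ∑ x, ‖φ x‖ ^ 2 := by
  have h : ((∑ a, ‖∑ x, φ x * ZMod.stdAddChar (-(a * x))‖ ^ 2 : ℝ) : ℂ) =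
      ((q * ∑ x, ‖φ x‖ ^ 2 : ℝ) : ℂ) := by
    push_cast
    simp only [← Complex.mul_conj', map_sum, map_mul, ← AddChar.map_neg_eq_conj, neg_neg]
    have h1 : ∀ a : ZMod q, (∑ x, φ x * ZMod.stdAddChar (-(a * x))) *
        (∑ x', (starRingEnd ℂ) (φ x') * ZMod.stdAddChar (a * x')) =
        ∑ x, ∑ x', φ x * (starRingEnd ℂ) (φ x') * ZMod.stdAddChar (a * (x' - x)) := by
      intro a
      rw [Finset.sum_mul_sum]
      refine Finset.sum_congr rfl fun x _ => Finset.sum_congr rfl fun x' _ => ?_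
      have : a * (x' - x) = -(a * x) + a * x' := by ring
      rw [this, AddChar.map_add_eq_mul]; ring
    simp only [h1]
    rw [Finset.sum_comm, Finset.mul_sum]
    refine Finset.sum_congr rfl fun x _ => ?_
    rw [Finset.sum_comm]
    simp only [← Finset.mul_sum, sum_std, sub_eq_zero]
    rw [Finset.sum_eq_single x]
    · simp; ring
    · intro x' _ hx'; simp [hx']
    · simp
  exact_mod_cast h

lemma parseval_two (φ : ZMod q → ZMod q → ℂ) :
    ∑ a, ∑ b, ‖ft φ a b‖ ^ 2 = q ^ 2 * ∑ x, ∑ y, ‖φ x y‖ ^ 2 := by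
  have h1 : ∀ a b, ft φ a b = ∑ x, (∑ y, φ x y * ZMod.stdAddChar (-(b * y))) *
      ZMod.stdAddChar (-(a * x)) := by
    intro a b
    rw [ft]
    refine Finset.sum_congr rfl fun x _ => ?_
    rw [Finset.sum_mul]
    refine Finset.sum_congr rfl fun y _ => ?_
    have : -(a * x + b * y) = -(b * y) + -(a * x) := by ring
    rw [this, AddChar.map_add_eq_mul]; ring
  rw [Finset.sum_comm]
  simp only [h1, parseval_one]
  rw [← Finset.mul_sum, Finset.sum_comm]
  simp only [parseval_one]
  rw [← Finset.mul_sum]; ring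

lemma sum_norm_sq_homog (φ : ZMod q → ZMod q → ℂ)
    (hφ : ∀ t : ZMod q, t ≠ 0 → ∃ ε : ℂ, ‖ε‖ = 1 ∧ ∀ x y, φ (t * x) (t * y) = ε * φ x y)
    (a : ZMod q) (ha : a ≠ 0) :
    (q - 1 : ℝ) * ∑ b, ‖ft φ a b‖ ^ 2 ≤ q ^ 2 * ∑ x, ∑ y, ‖φ x y‖ ^ 2 := by
  have hinv : ∀ t : ZMod q, t ≠ 0 → ∀ a b, ‖ft φ (t * a) (t * b)‖ = ‖ft φ a b‖ := by
    intro t ht a b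
    obtain ⟨ε, hε, h⟩ := hφ t ht
    have : ft φ a b = ε * ft φ (t * a) (t * b) := by
      rw [ft, sum_sub_y ht, ft, Finset.mul_sum]
      refine Finset.sum_congr rfl fun x _ => ?_
      rw [sum_sub_y ht, Finset.mul_sum]
      refine Finset.sum_congr rfl fun y _ => ?_
      rw [h, mul_assoc]
      congr 4; ring
    rw [this, norm_mul, hε, one_mul]
  have hS : ∀ a' : ZMod q, a' ≠ 0 → ∑ b, ‖ft φ a' b‖ ^ 2 = ∑ b, ‖ft φ a b‖ ^ 2 := by
    intro a' ha'
    have ht : a' / a ≠ 0 := div_ne_zero ha' ha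
    rw [← Equiv.sum_comp (Equiv.mulLeft₀ _ ht)]
    refine Finset.sum_congr rfl fun b _ => ?_
    have := hinv _ ht a b
    rw [div_mul_cancel₀ _ ha] at this
    simp [this]
  rw [← parseval_two]
  have h1 : ∑ a' ∈ Finset.univ.erase (0 : ZMod q), ∑ b, ‖ft φ a' b‖ ^ 2 =
      (q - 1 : ℝ) * ∑ b, ‖ft φ a b‖ ^ 2 := by
    rw [Finset.sum_congr rfl fun a' ha' => hS a' (Finset.ne_of_mem_erase ha'), Finset.sum_const,
      Finset.card_erase_of_mem (Finset.mem_univ _), Finset.card_univ, ZMod.card, nsmul_eq_mul,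
      Nat.cast_sub (Fact.out : q.Prime).one_lt.le]
    simp
  rw [← h1]
  exact Finset.sum_le_sum_of_subset_of_nonneg (Finset.erase_subset _ _) fun a' _ _ =>
    Finset.sum_nonneg fun b _ => by positivity

/-- indicator of the zeros of the form -/
noncomputable def zF (g : (ZMod q)[X]) (D : ℕ) (x y : ZMod q) : ℂ :=
  if hev g D x y = 0 then 1 else 0

/-- the modified `±1`-valued function -/
noncomputable def fF (g : (ZMod q)[X]) (D : ℕ) (x y : ZMod q) : ℂ := chiF g D x y + zF g D x y

lemma ft_add (φ ψ : ZMod q → ZMod q → ℂ) (a b : ZMod q) :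
    ft (fun x y => φ x y + ψ x y) a b = ft φ a b + ft ψ a b := by
  simp only [ft, add_mul, Finset.sum_add_distrib]

lemma zF_count {g : (ZMod q)[X]} {D : ℕ} (hg : GoodRed g D) :
    ∑ x, ∑ y, ‖zF g D x y‖ ^ 2 ≤ (D + 1) * q := by
  rw [Finset.sum_comm]
  have hg0 : g ≠ 0 := hg.sep.ne_zero
  have h1 : ∀ y : ZMod q, ∑ x, ‖zF g D x y‖ ^ 2 ≤ D + (if y = 0 then (q : ℝ) else 0) := by
    intro y
    by_cases hy : y = 0
    · rw [if_pos hy]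
      have : ∑ x, ‖zF g D x y‖ ^ 2 ≤ ∑ _x : ZMod q, (1 : ℝ) := by
        refine Finset.sum_le_sum fun x _ => ?_
        unfold zF; split_ifs <;> simp
      refine this.trans ?_
      simp [ZMod.card]
    · rw [if_neg hy, add_zero]
      rw [← Equiv.sum_comp (Equiv.mulLeft₀ y hy)]
      have h2 : ∀ t : ZMod q, ‖zF g D (Equiv.mulLeft₀ y hy t) y‖ ^ 2 =
          if g.eval t = 0 then (1 : ℝ) else 0 := by
        intro t
        have h3 : hev g D (y * t) y = y ^ D * g.eval t := by
          have := hev_scale g D t 1 y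
          rw [mul_one] at this
          rw [this, hev_one g D hg.le]
        rw [show (Equiv.mulLeft₀ y hy) t = y * t from rfl]
        simp only [zF, h3, mul_eq_zero, pow_eq_zero_iff', hy, false_and, false_or]
        split_ifs <;> simp
      simp only [h2, Finset.sum_boole]
      have h3 : (Finset.univ.filter fun t : ZMod q => g.eval t = 0).card ≤ D := by
        refine le_trans (Finset.card_le_card (t := g.roots.toFinset) fun x hx => ?_)
          ((Multiset.toFinset_card_le _).trans ((Polynomial.card_roots' g).trans hg.le))
        simpa [hg0] using hx
      exact_mod_cast h3
  refine (Finset.sum_le_sum fun y _ => h1 y).trans ?_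
  rw [Finset.sum_add_distrib]
  simp [ZMod.card]
  ring_nf; rfl

lemma chiF_count (g : (ZMod q)[X]) (D : ℕ) : ∑ x, ∑ y, ‖chiF g D x y‖ ^ 2 ≤ (q : ℝ) ^ 2 := by
  have : ∑ x, ∑ y, ‖chiF g D x y‖ ^ 2 ≤ ∑ _x : ZMod q, ∑ _y : ZMod q, (1 : ℝ) := by
    refine Finset.sum_le_sum fun x _ => Finset.sum_le_sum fun y _ => ?_
    have := norm_qc_le (hev g D x y)
    have h0 := norm_nonneg (qc q (hev g D x y))
    unfold chiF; nlinarith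
  refine this.trans ?_
  simp [ZMod.card]
  ring_nf; rfl

lemma sum_norm_le_sqrt (φ : ZMod q → ℂ) (S : ℝ) (h : ∑ b, ‖φ b‖ ^ 2 ≤ S) :
    ∑ b, ‖φ b‖ ≤ Real.sqrt (q * S) := by
  apply Real.le_sqrt_of_sq_le
  refine (sq_sum_le_card_mul_sum_sq).trans ?_
  rw [Finset.card_univ, ZMod.card]
  gcongr

lemma chiF_homog (g : (ZMod q)[X]) {D : ℕ} (hD : Odd D) (t : ZMod q) (ht : t ≠ 0) :
    ∃ ε : ℂ, ‖ε‖ = 1 ∧ ∀ x y, chiF g D (t * x) (t * y) = ε * chiF g D x y :=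
  ⟨qc q t, norm_qc_of_ne ht, fun x y => chiF_scale g hD x y t⟩

lemma zF_homog (g : (ZMod q)[X]) (D : ℕ) (t : ZMod q) (ht : t ≠ 0) :
    ∃ ε : ℂ, ‖ε‖ = 1 ∧ ∀ x y, zF g D (t * x) (t * y) = ε * zF g D x y := by
  refine ⟨1, by simp, fun x y => ?_⟩
  simp only [zF, hev_scale, mul_eq_zero, pow_eq_zero_iff', ht, false_and, false_or, one_mul]

/-- the constant in the local bounds -/
noncomputable def locC (D : ℕ) : ℝ := 24 * D + 200

lemma sum_ft_fF_ne (hq : q ≠ 2) {g : (ZMod q)[X]} {D : ℕ} (hD : Odd D)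
    (hg : GoodRed g D) (a : ZMod q) (ha : a ≠ 0) :
    ∑ b, ‖ft (fF g D) a b‖ ≤ q ^ 2 * (1 + locC D / Real.sqrt q) := by
  have hq3 : 3 ≤ q := by have := (Fact.out : q.Prime).two_le; omega
  have hq3' : (3 : ℝ) ≤ q := by exact_mod_cast hq3
  have hs : Real.sqrt q * Real.sqrt q = q := Real.mul_self_sqrt (by positivity)
  have hs0 : 0 < Real.sqrt q := Real.sqrt_pos.mpr (by linarith)
  have h1 : ∑ b, ‖ft (chiF g D) a b‖ ^ 2 ≤ (q : ℝ) ^ 4 / (q - 1) := by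
    rw [le_div_iff₀ (by linarith), mul_comm]
    refine (sum_norm_sq_homog _ (chiF_homog g hD) a ha).trans ?_
    have := chiF_count g D
    have h2 : (0 : ℝ) ≤ (q:ℝ)^2 := by positivity
    nlinarith
  have h2 : ∑ b, ‖ft (zF g D) a b‖ ^ 2 ≤ (q : ℝ) ^ 3 * (D + 1) / (q - 1) := by
    rw [le_div_iff₀ (by linarith), mul_comm]
    refine (sum_norm_sq_homog _ (zF_homog g D) a ha).trans ?_
    have := zF_count hg
    have h2 : (0 : ℝ) ≤ (q:ℝ)^2 := by positivity
    nlinarith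
  have h3 := sum_norm_le_sqrt _ _ h1
  have h4 := sum_norm_le_sqrt _ _ h2
  have h5 : Real.sqrt (q * ((q : ℝ) ^ 4 / (q - 1))) ≤ q ^ 2 * (1 + 1 / Real.sqrt q) := by
    rw [Real.sqrt_le_left (by positivity), mul_div_assoc', div_le_iff₀ (by linarith)]
    have h6 : (q : ℝ) ≤ (1 + 1 / Real.sqrt q) ^ 2 * (q - 1) := by
      have : (1 + 1 / Real.sqrt q) ^ 2 * (q - 1) = (Real.sqrt q + 1)^2 * (q - 1) / q := by
        field_simp
        rw [Real.sq_sqrt (by positivity)]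
      rw [this, le_div_iff₀ (by linarith)]
      have hs15 : (1:ℝ) ≤ Real.sqrt q := by rw [Real.one_le_sqrt]; linarith
      nlinarith
    calc (q : ℝ) * q ^ 4 = q ^ 4 * q := by ring
      _ ≤ q ^ 4 * ((1 + 1 / Real.sqrt q) ^ 2 * (q - 1)) := by gcongr
      _ = _ := by ring
  have h7 : Real.sqrt (q * ((q : ℝ) ^ 3 * (D + 1) / (q - 1))) ≤ q ^ 2 * ((D + 2) * 2 / Real.sqrt q) := by
    rw [Real.sqrt_le_left (by positivity), mul_div_assoc', div_le_iff₀ (by linarith)]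
    have h6 : (D + 1 : ℝ) ≤ ((D + 2) * 2 / Real.sqrt q) ^ 2 * (q - 1) := by
      have : ((D + 2) * 2 / Real.sqrt q) ^ 2 * (q - 1) = ((D + 2 : ℝ) * 2)^2 * (q - 1) / q := by
        rw [div_pow, Real.sq_sqrt (by positivity)]; ring
      rw [this, le_div_iff₀ (by linarith)]
      have hD0 : (0 : ℝ) ≤ D := by positivity
      nlinarith [mul_nonneg hD0 hD0, mul_nonneg hD0 (sub_nonneg.mpr hq3'),
        mul_nonneg (mul_nonneg hD0 hD0) (sub_nonneg.mpr hq3')]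
    calc (q : ℝ) * (q ^ 3 * (D + 1)) = q ^ 4 * (D + 1) := by ring
      _ ≤ q ^ 4 * (((D + 2) * 2 / Real.sqrt q) ^ 2 * (q - 1)) := by gcongr
      _ = _ := by ring
  have h8 : ∑ b, ‖ft (fF g D) a b‖ ≤ ∑ b, ‖ft (chiF g D) a b‖ + ∑ b, ‖ft (zF g D) a b‖ := by
    rw [← Finset.sum_add_distrib]
    refine Finset.sum_le_sum fun b _ => ?_
    have : ft (fF g D) a b = ft (chiF g D) a b + ft (zF g D) a b := ft_add _ _ a b
    rw [this]; exact norm_add_le _ _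
  have h9 : (q:ℝ) ^ 2 * (1 + 1 / Real.sqrt q) + q ^ 2 * ((D + 2) * 2 / Real.sqrt q) ≤
      q ^ 2 * (1 + locC D / Real.sqrt q) := by
    rw [← mul_add]
    refine mul_le_mul_of_nonneg_left ?_ (by positivity)
    have : 1 + 1 / Real.sqrt q + (D + 2) * 2 / Real.sqrt q = 1 + (1 + (D+2)*2) / Real.sqrt q := by
      ring
    rw [this]
    gcongr
    unfold locC
    have hD0 : (0 : ℝ) ≤ D := by positivity
    linarith
  linarith

lemma sum_ft_fF_zero (hq : q ≠ 2) {g : (ZMod q)[X]} {D : ℕ} (hD : Odd D) (hD3 : 3 ≤ D)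
    (hg : GoodRed g D) :
    ∑ b, ‖ft (fF g D) 0 b‖ ≤ q ^ 2 * (2 * locC D) := by
  have hs : Real.sqrt q * Real.sqrt q = q := Real.mul_self_sqrt (by positivity)
  have hq0 : (0 : ℝ) < q := by exact_mod_cast (Fact.out : q.Prime).pos
  have hD0 : (0 : ℝ) ≤ D := by positivity
  have h1 : ∑ b, ‖ft (chiF g D) 0 b‖ ^ 2 ≤ (q : ℝ) ^ 3 * (24 * D + 100) ^ 2 := by
    have h2 : ∀ b, ft (chiF g D) 0 b = ∑ y, (∑ x, chiF g D x y) * ZMod.stdAddChar (-(b * y)) := by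
      intro b
      rw [ft, Finset.sum_comm]
      refine Finset.sum_congr rfl fun y _ => ?_
      rw [Finset.sum_mul]
      simp
    simp only [h2, parseval_one]
    have : ∑ y, ‖∑ x, chiF g D x y‖ ^ 2 ≤ ∑ _y : ZMod q, ((24 * D + 100) * Real.sqrt q) ^ 2 := by
      refine Finset.sum_le_sum fun y _ => ?_
      exact pow_le_pow_left₀ (norm_nonneg _) (norm_chiF_sum_x hq hD hD3 hg y) 2
    rw [Finset.sum_const, Finset.card_univ, ZMod.card, nsmul_eq_mul, mul_pow,
      Real.sq_sqrt hq0.le] at this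
    calc _ ≤ (q : ℝ) * (q * ((24 * D + 100) ^ 2 * q)) := by gcongr
      _ = _ := by ring
  have h2 : ∑ b, ‖ft (zF g D) 0 b‖ ^ 2 ≤ (q : ℝ) ^ 3 * (D + 1) := by
    have h3 : ∑ b, ‖ft (zF g D) 0 b‖ ^ 2 ≤ ∑ a, ∑ b, ‖ft (zF g D) a b‖ ^ 2 :=
      Finset.single_le_sum (f := fun a => ∑ b, ‖ft (zF g D) a b‖ ^ 2)
        (fun a _ => Finset.sum_nonneg fun b _ => by positivity) (Finset.mem_univ 0)
    rw [parseval_two] at h3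
    refine h3.trans ?_
    have := zF_count hg
    have h2 : (0 : ℝ) ≤ (q:ℝ)^2 := by positivity
    nlinarith
  have h3 := sum_norm_le_sqrt _ _ h1
  have h4 := sum_norm_le_sqrt _ _ h2
  have h5 : Real.sqrt (q * ((q : ℝ) ^ 3 * (24 * D + 100) ^ 2)) ≤ q ^ 2 * locC D := by
    rw [Real.sqrt_le_left (by unfold locC; positivity)]
    have : (24 * D + 100 : ℝ) ^ 2 ≤ locC D ^ 2 := by
      unfold locC; gcongr; norm_num
    calc _ = (q : ℝ) ^ 4 * (24 * D + 100) ^ 2 := by ring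
      _ ≤ q ^ 4 * locC D ^ 2 := by gcongr
      _ = _ := by ring
  have h6 : Real.sqrt (q * ((q : ℝ) ^ 3 * (D + 1))) ≤ q ^ 2 * locC D := by
    rw [Real.sqrt_le_left (by unfold locC; positivity)]
    have : (D + 1 : ℝ) ≤ locC D ^ 2 := by
      unfold locC; nlinarith
    calc _ = (q : ℝ) ^ 4 * (D + 1) := by ring
      _ ≤ q ^ 4 * locC D ^ 2 := by gcongr
      _ = _ := by ring
  have h8 : ∑ b, ‖ft (fF g D) 0 b‖ ≤ ∑ b, ‖ft (chiF g D) 0 b‖ + ∑ b, ‖ft (zF g D) 0 b‖ := by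
    rw [← Finset.sum_add_distrib]
    refine Finset.sum_le_sum fun b _ => ?_
    have : ft (fF g D) 0 b = ft (chiF g D) 0 b + ft (zF g D) 0 b := ft_add _ _ 0 b
    rw [this]; exact norm_add_le _ _
  linarith

lemma norm_ft_fF_zero_zero (hq : q ≠ 2) {g : (ZMod q)[X]} {D : ℕ} (hD : Odd D)
    (hg : GoodRed g D) : ‖ft (fF g D) 0 0‖ ≤ (D + 1) * q := by
  have h1 : ft (chiF g D) 0 0 = 0 := by
    obtain ⟨t, ht⟩ := quadraticChar_exists_neg_one (ringChar_ne hq)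
    have ht0 : t ≠ 0 := by rintro rfl; simp at ht
    have hc : qc q t = -1 := by rw [qc_apply, ht]; simp
    have h2 : ft (chiF g D) 0 0 = - ft (chiF g D) 0 0 := by
      conv_lhs => rw [ft, sum_sub_y ht0]
      rw [ft, ← Finset.sum_neg_distrib]
      refine Finset.sum_congr rfl fun x _ => ?_
      rw [sum_sub_y ht0, ← Finset.sum_neg_distrib]
      refine Finset.sum_congr rfl fun y _ => ?_
      rw [chiF_scale g hD, hc]; simp
    exact self_eq_neg.mp h2
  have h2 : ft (fF g D) 0 0 = ft (chiF g D) 0 0 + ft (zF g D) 0 0 := ft_add _ _ 0 0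
  rw [h2, h1, zero_add]
  refine le_trans ?_ (zF_count hg)
  rw [ft]
  refine (norm_sum_le _ _).trans (Finset.sum_le_sum fun x _ => ?_)
  refine (norm_sum_le _ _).trans (Finset.sum_le_sum fun y _ => ?_)
  unfold zF; split_ifs <;> simp

lemma fF_cases (g : (ZMod q)[X]) (D : ℕ) (x y : ZMod q) : fF g D x y = 1 ∨ fF g D x y = -1 := by
  unfold fF chiF zF
  rcases qc_cases (hev g D x y) with h | h | h <;> simp [h.1, h.2, qc_zero]

end Local
end SqSieve

namespace SqSieve
open scoped Polynomial

/-! Part D: global Fourier analysis with Fejer weights -/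

set_option linter.unusedSectionVars false

section Global

variable {ι : Type*} [Fintype ι] [DecidableEq ι] (q : ι → ℕ) [∀ t, Fact (q t).Prime]

/-- product additive character -/
noncomputable def ech (a : ∀ t, ZMod (q t)) (n : ℤ) : ℂ :=
  ∏ t, ZMod.stdAddChar (a t * (n : ZMod (q t)))

lemma ech_add (a : ∀ t, ZMod (q t)) (m n : ℤ) : ech q a (m + n) = ech q a m * ech q a n := by
  unfold ech
  rw [← Finset.prod_mul_distrib]
  refine Finset.prod_congr rfl fun t _ => ?_
  rw [← AddChar.map_add_eq_mul]
  congr 1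
  push_cast
  ring

lemma ech_zero (a : ∀ t, ZMod (q t)) : ech q a 0 = 1 := by simp [ech]

lemma ech_neg (a : ∀ t, ZMod (q t)) (n : ℤ) : ech q a (-n) = (starRingEnd ℂ) (ech q a n) := by
  unfold ech
  rw [map_prod]
  refine Finset.prod_congr rfl fun t _ => ?_
  rw [← AddChar.map_neg_eq_conj]
  congr 1
  push_cast
  ring

lemma norm_ech (a : ∀ t, ZMod (q t)) (n : ℤ) : ‖ech q a n‖ = 1 := by
  unfold ech
  rw [norm_prod]
  exact Finset.prod_eq_one fun t _ => AddChar.norm_apply _ _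

/-- Fejer kernel -/
noncomputable def fej (L : ℕ) (a : ∀ t, ZMod (q t)) : ℝ :=
  ‖∑ i ∈ Finset.range L, ech q a (i : ℤ)‖ ^ 2

lemma fej_nonneg (L : ℕ) (a : ∀ t, ZMod (q t)) : 0 ≤ fej q L a := by unfold fej; positivity

lemma fej_le (L : ℕ) (a : ∀ t, ZMod (q t)) : fej q L a ≤ (L : ℝ) ^ 2 := by
  unfold fej
  gcongr
  refine (norm_sum_le _ _).trans ?_
  simp [norm_ech]

lemma fej_eq (L : ℕ) (a : ∀ t, ZMod (q t)) :
    (fej q L a : ℂ) = ∑ i ∈ Finset.range L, ∑ j ∈ Finset.range L, ech q a ((i : ℤ) - j) := by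
  unfold fej
  rw [Complex.ofReal_pow, ← Complex.mul_conj', map_sum, Finset.sum_mul_sum]
  refine Finset.sum_congr rfl fun i _ => Finset.sum_congr rfl fun j _ => ?_
  rw [← ech_neg, ← ech_add, sub_eq_add_neg]

/-- trigonometric polynomial attached to local coefficients -/
noncomputable def tf (c : ∀ t, ZMod (q t) → ZMod (q t) → ℂ) (t : ι) (x y : ℤ) : ℂ :=
  ∑ a, ∑ b, c t a b * ZMod.stdAddChar (a * (x : ZMod (q t)) + b * (y : ZMod (q t)))

/-- weighted sum over differences -/
noncomputable def WW (L₁ L₂ : ℕ) (g : ℤ → ℤ → ℂ) : ℂ :=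
  ∑ i ∈ Finset.range L₁, ∑ j ∈ Finset.range L₁, ∑ i' ∈ Finset.range L₂, ∑ j' ∈ Finset.range L₂,
    g ((i : ℤ) - j) ((i' : ℤ) - j')

lemma prod_tf (c : ∀ t, ZMod (q t) → ZMod (q t) → ℂ) (x y : ℤ) :
    ∏ t, tf q c t x y = ∑ a : (∀ t, ZMod (q t)), ∑ b : (∀ t, ZMod (q t)),
      (∏ t, c t (a t) (b t)) * ech q a x * ech q b y := by
  unfold tf
  rw [Finset.prod_univ_sum, Fintype.piFinset_univ]
  refine Finset.sum_congr rfl fun a _ => ?_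
  rw [Finset.prod_univ_sum, Fintype.piFinset_univ]
  refine Finset.sum_congr rfl fun b _ => ?_
  unfold ech
  rw [← Finset.prod_mul_distrib, ← Finset.prod_mul_distrib]
  refine Finset.prod_congr rfl fun t _ => ?_
  rw [AddChar.map_add_eq_mul, mul_assoc]

lemma WW_prod (L₁ L₂ : ℕ) (c : ∀ t, ZMod (q t) → ZMod (q t) → ℂ) :
    WW L₁ L₂ (fun x y => ∏ t, tf q c t x y) =
      ∑ a : (∀ t, ZMod (q t)), ∑ b : (∀ t, ZMod (q t)),
      (∏ t, c t (a t) (b t)) * fej q L₁ a * fej q L₂ b := by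
  unfold WW
  simp only [prod_tf, fej_eq]
  have h : ∀ (s1 s2 : Finset ℕ) (G : ℕ → ℕ → ℕ → ℕ → (∀ t, ZMod (q t)) → (∀ t, ZMod (q t)) → ℂ),
      ∑ i ∈ s1, ∑ j ∈ s1, ∑ i' ∈ s2, ∑ j' ∈ s2, ∑ a, ∑ b, G i j i' j' a b =
      ∑ a, ∑ b, ∑ i ∈ s1, ∑ j ∈ s1, ∑ i' ∈ s2, ∑ j' ∈ s2, G i j i' j' a b := by
    intro s1 s2 G
    simp_rw [Finset.sum_comm (s := s2) (t := (Finset.univ : Finset (∀ t, ZMod (q t)))),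
      Finset.sum_comm (s := s1) (t := (Finset.univ : Finset (∀ t, ZMod (q t))))]
  rw [h]
  refine Finset.sum_congr rfl fun a _ => Finset.sum_congr rfl fun b _ => ?_
  simp only [← Finset.mul_sum, ← Finset.sum_mul]

lemma norm_WW_prod_le (L₁ L₂ : ℕ) (c : ∀ t, ZMod (q t) → ZMod (q t) → ℂ) :
    ‖WW L₁ L₂ (fun x y => ∏ t, tf q c t x y)‖ ≤
      ∑ a : (∀ t, ZMod (q t)), ∑ b : (∀ t, ZMod (q t)),
      (∏ t, ‖c t (a t) (b t)‖) * fej q L₁ a * fej q L₂ b := by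
  rw [WW_prod]
  refine (norm_sum_le _ _).trans (Finset.sum_le_sum fun a _ =>
    (norm_sum_le _ _).trans (Finset.sum_le_sum fun b _ => ?_))
  rw [norm_mul, norm_mul, norm_prod, Complex.norm_real, Complex.norm_real,
    Real.norm_of_nonneg (fej_nonneg q _ _), Real.norm_of_nonneg (fej_nonneg q _ _)]

lemma fej_sum (L : ℕ) (w : ∀ t, ZMod (q t) → ℝ) :
    ((∑ a : (∀ t, ZMod (q t)), (∏ t, w t (a t)) * fej q L a : ℝ) : ℂ) =
      ∑ i ∈ Finset.range L, ∑ j ∈ Finset.range L,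
        ∏ t, ∑ α : ZMod (q t), (w t α : ℂ) * ZMod.stdAddChar (α * (((i : ℤ) - j : ℤ) : ZMod (q t))) := by
  push_cast
  simp only [fej_eq, Finset.mul_sum]
  rw [Finset.sum_comm]
  refine Finset.sum_congr rfl fun i _ => ?_
  rw [Finset.sum_comm]
  refine Finset.sum_congr rfl fun j _ => ?_
  rw [Finset.prod_univ_sum, Fintype.piFinset_univ]
  refine Finset.sum_congr rfl fun a _ => ?_
  unfold ech
  rw [← Finset.prod_mul_distrib]
  push_cast
  rfl

/-- number of pairs with difference divisible by M -/
def zc (L M : ℕ) : ℕ :=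
  ((Finset.range L ×ˢ Finset.range L).filter fun ij => (M : ℤ) ∣ ((ij.1 : ℤ) - ij.2)).card

lemma zc_eq (L M : ℕ) : (zc L M : ℝ) = ∑ i ∈ Finset.range L, ∑ j ∈ Finset.range L,
    if (M : ℤ) ∣ ((i : ℤ) - j) then (1 : ℝ) else 0 := by
  unfold zc
  rw [Finset.card_filter, Finset.sum_product]
  push_cast
  rfl

lemma zc_bounds (L M : ℕ) (hM : 0 < M) :
    (L : ℝ) * (L - M) ≤ M * zc L M ∧ (M : ℝ) * zc L M ≤ L * (L + M) := by
  have key : ∀ i : ℕ, |(M : ℝ) * (∑ j ∈ Finset.range L, if (M : ℤ) ∣ ((i : ℤ) - j) then (1 : ℝ) else 0) - L| ≤ M := by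
    intro i
    have h1 : (∑ j ∈ Finset.range L, if (M : ℤ) ∣ ((i : ℤ) - j) then (1 : ℝ) else 0)
        = Nat.count (fun j => j ≡ i [MOD M]) L := by
      rw [Nat.count_eq_card_filter_range, Finset.card_filter]
      push_cast
      refine Finset.sum_congr rfl fun j _ => ?_
      congr 1
      rw [← Int.natCast_modEq_iff, Int.modEq_iff_dvd]
    rw [h1, Nat.count_modEq_card (v := i) L hM]
    have h2 : (M : ℝ) * (L / M : ℕ) + (L % M : ℕ) = L := by exact_mod_cast Nat.div_add_mod L M
    have h3 : ((L % M : ℕ) : ℝ) < M := by exact_mod_cast Nat.mod_lt L hM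
    have h4 : (0 : ℝ) ≤ (L % M : ℕ) := by positivity
    push_cast
    rw [abs_le]
    split_ifs <;> constructor <;> nlinarith
  have h0 : (M : ℝ) * zc L M = ∑ i ∈ Finset.range L, (M : ℝ) * (∑ j ∈ Finset.range L, if (M : ℤ) ∣ ((i : ℤ) - j) then (1 : ℝ) else 0) := by
    rw [zc_eq, Finset.mul_sum]
  rw [h0]
  constructor
  · have := Finset.sum_le_sum (s := Finset.range L) fun i _ => (neg_le_of_abs_le (key i))
    rw [Finset.sum_sub_distrib] at this
    simp at this ⊢
    nlinarith
  · have := Finset.sum_le_sum (s := Finset.range L) fun i _ => (le_of_abs_le (key i))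
    rw [Finset.sum_sub_distrib] at this
    simp at this ⊢
    nlinarith

lemma prod_ind (hinj : Function.Injective q) (s : Finset ι) (n : ℤ) :
    ∏ t ∈ s, (if (n : ZMod (q t)) = 0 then (1 : ℝ) else 0) =
      if ((∏ t ∈ s, q t : ℕ) : ℤ) ∣ n then 1 else 0 := by
  have h1 : (((∏ t ∈ s, q t : ℕ) : ℤ) ∣ n) ↔ ∀ t ∈ s, (n : ZMod (q t)) = 0 := by
    constructor
    · intro h t ht
      rw [ZMod.intCast_zmod_eq_zero_iff_dvd]
      exact dvd_trans (by exact_mod_cast Finset.dvd_prod_of_mem _ ht) h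
    · intro h
      push_cast
      apply Finset.prod_dvd_of_coprime
      · intro t _ t' _ htt
        rw [Function.onFun, Nat.isCoprime_iff_coprime]
        exact (Nat.coprime_primes Fact.out Fact.out).2 fun h => htt (hinj h)
      · intro t ht
        exact (ZMod.intCast_zmod_eq_zero_iff_dvd _ _).1 (h t ht)
  by_cases h : ∀ t ∈ s, (n : ZMod (q t)) = 0
  · rw [if_pos (h1.2 h)]
    exact Finset.prod_eq_one fun t ht => if_pos (h t ht)
  · rw [if_neg (fun h' => h (h1.1 h'))]
    push Not at h
    obtain ⟨t, ht, hn⟩ := h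
    exact Finset.prod_eq_zero ht (if_neg hn)

lemma prod_split (T : Finset ι) (f g : ι → ℝ) :
    ∏ t, (if t ∈ T then f t else g t) = (∏ t ∈ T, f t) * ∏ t ∈ Tᶜ, g t := by
  rw [Finset.prod_ite]
  congr 1
  · congr 1; ext; simp
  · congr 1; ext; simp

lemma prod_split' (T : Finset ι) (f g : ι → ℂ) :
    ∏ t, (if t ∈ T then f t else g t) = (∏ t ∈ T, f t) * ∏ t ∈ Tᶜ, g t := by
  rw [Finset.prod_ite]
  congr 1
  · congr 1; ext; simp
  · congr 1; ext; simp

lemma E2_step1 (hinj : Function.Injective q) (L : ℕ) (T : Finset ι) (d : ∀ t, ZMod (q t) → ℝ)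
    (hd0 : ∀ t b, 0 ≤ d t b) (κ U : ι → ℝ) (hκ : ∀ t, 0 ≤ κ t)
    (hT : ∀ t ∈ T, ∀ b, d t b ≤ κ t) (hN : ∀ t ∉ T, ∑ b, d t b ≤ U t) :
    ∑ b : (∀ t, ZMod (q t)), (∏ t, d t (b t)) * fej q L b ≤
      (∏ t ∈ T, κ t) * (∏ t ∈ Tᶜ, U t) * (L * (L + (∏ t ∈ T, q t : ℕ))) := by
  set P : ℕ := ∏ t ∈ T, q t with hP
  have hPpos : 0 < P := Finset.prod_pos fun t _ => (Fact.out : (q t).Prime).pos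
  set w : ∀ t, ZMod (q t) → ℝ := fun t b => if t ∈ T then 1 else d t b with hw
  have hU0 : ∀ t ∈ Tᶜ, 0 ≤ U t := fun t ht =>
    (Finset.sum_nonneg fun b _ => hd0 t b).trans (hN t (by simpa using ht))
  have h1 : ∀ b : (∀ t, ZMod (q t)), ∏ t, d t (b t) ≤ (∏ t ∈ T, κ t) * ∏ t, w t (b t) := by
    intro b
    have : ∏ t, d t (b t) ≤ ∏ t, (if t ∈ T then κ t else d t (b t)) := by
      refine Finset.prod_le_prod (fun t _ => hd0 t _) fun t _ => ?_
      split_ifs with h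
      · exact hT t h _
      · exact le_rfl
    refine this.trans (le_of_eq ?_)
    simp only [hw]
    rw [prod_split, prod_split, Finset.prod_const_one, one_mul]
  have h2 : ∑ b : (∀ t, ZMod (q t)), (∏ t, w t (b t)) * fej q L b ≤ P * zc L P * ∏ t ∈ Tᶜ, U t := by
    have h3 : ∑ b : (∀ t, ZMod (q t)), (∏ t, w t (b t)) * fej q L b ≤
        ‖((∑ b : (∀ t, ZMod (q t)), (∏ t, w t (b t)) * fej q L b : ℝ) : ℂ)‖ := by
      rw [Complex.norm_real]; exact le_abs_self _
    refine h3.trans ?_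
    rw [fej_sum, zc_eq, Finset.mul_sum, Finset.sum_mul]
    refine (norm_sum_le _ _).trans (Finset.sum_le_sum fun i _ => ?_)
    rw [Finset.mul_sum, Finset.sum_mul]
    refine (norm_sum_le _ _).trans (Finset.sum_le_sum fun j _ => ?_)
    rw [norm_prod]
    have h4 : ∏ t, ‖∑ α : ZMod (q t), (w t α : ℂ) * ZMod.stdAddChar (α * (((i : ℤ) - j : ℤ) : ZMod (q t)))‖
        ≤ ∏ t, (if t ∈ T then (q t : ℝ) * (if (((i : ℤ) - j : ℤ) : ZMod (q t)) = 0 then 1 else 0) else U t) := by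
      refine Finset.prod_le_prod (fun t _ => norm_nonneg _) fun t _ => ?_
      by_cases h : t ∈ T
      · simp only [hw, if_pos h, Complex.ofReal_one, one_mul, sum_std]
        split_ifs <;> simp
      · simp only [hw, if_neg h]
        refine (norm_sum_le _ _).trans (le_trans (le_of_eq ?_) (hN t h))
        refine Finset.sum_congr rfl fun b _ => ?_
        rw [norm_mul, AddChar.norm_apply, mul_one, Complex.norm_real, Real.norm_of_nonneg (hd0 t b)]
    refine h4.trans (le_of_eq ?_)
    rw [prod_split, Finset.prod_mul_distrib, prod_ind q hinj, hP]
    push_cast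
    rfl
  calc ∑ b : (∀ t, ZMod (q t)), (∏ t, d t (b t)) * fej q L b
      ≤ ∑ b : (∀ t, ZMod (q t)), (∏ t ∈ T, κ t) * ((∏ t, w t (b t)) * fej q L b) := by
        refine Finset.sum_le_sum fun b _ => ?_
        rw [← mul_assoc]
        exact mul_le_mul_of_nonneg_right (h1 b) (fej_nonneg q _ _)
    _ = (∏ t ∈ T, κ t) * ∑ b : (∀ t, ZMod (q t)), (∏ t, w t (b t)) * fej q L b := by
        rw [Finset.mul_sum]
    _ ≤ (∏ t ∈ T, κ t) * (P * zc L P * ∏ t ∈ Tᶜ, U t) :=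
        mul_le_mul_of_nonneg_left h2 (Finset.prod_nonneg fun t _ => hκ t)
    _ ≤ (∏ t ∈ T, κ t) * ((L * (L + P)) * ∏ t ∈ Tᶜ, U t) := by
        refine mul_le_mul_of_nonneg_left ?_ (Finset.prod_nonneg fun t _ => hκ t)
        exact mul_le_mul_of_nonneg_right (zc_bounds L P hPpos).2 (Finset.prod_nonneg hU0)
    _ = _ := by ring

lemma E2_step2 (hinj : Function.Injective q) (L : ℕ) (T : Finset ι) (hTne : T.Nonempty)
    (u v : ι → ℝ) (hu : ∀ t, 0 ≤ u t) (hv : ∀ t, 0 ≤ v t) :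
    ∑ a : (∀ t, ZMod (q t)), (∏ t, (if t ∈ T then (if a t = 0 then 0 else 1)
      else u t + v t * (if a t = 0 then 1 else 0))) * fej q L a ≤
      L * ((∏ t ∈ T, q t : ℕ) + 1) * ∏ t ∈ Tᶜ, (u t * q t + v t) := by
  set P : ℕ := ∏ t ∈ T, q t with hP
  have hPpos : 0 < P := Finset.prod_pos fun t _ => (Fact.out : (q t).Prime).pos
  set w1 : ∀ t, ZMod (q t) → ℝ := fun t b => if t ∈ T then 1 else u t + v t * (if b = 0 then 1 else 0)
    with hw1
  set w2 : ∀ t, ZMod (q t) → ℝ := fun t b => if t ∈ T then (if b = 0 then 1 else 0)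
    else u t + v t * (if b = 0 then 1 else 0) with hw2
  have h1 : ∀ a : (∀ t, ZMod (q t)), ∏ t, (if t ∈ T then (if a t = 0 then (0 : ℝ) else 1)
      else u t + v t * (if a t = 0 then 1 else 0)) ≤ ∏ t, w1 t (a t) - ∏ t, w2 t (a t) := by
    intro a
    simp only [hw1, hw2]
    rw [prod_split, prod_split, prod_split, ← sub_mul, Finset.prod_const_one]
    refine mul_le_mul_of_nonneg_right ?_ (Finset.prod_nonneg fun t _ => ?_)
    · obtain ⟨t, ht⟩ := hTne
      have hA : ∏ i ∈ T, (if a i = 0 then (0:ℝ) else 1) ≤ if a t = 0 then 0 else 1 := by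
        rw [← Finset.mul_prod_erase _ _ ht]
        refine mul_le_of_le_one_right (by split_ifs <;> norm_num) ?_
        exact Finset.prod_le_one (fun i _ => by split_ifs <;> norm_num) fun i _ => by
          split_ifs <;> norm_num
      have hB : ∏ i ∈ T, (if a i = 0 then (1:ℝ) else 0) ≤ if a t = 0 then 1 else 0 := by
        rw [← Finset.mul_prod_erase _ _ ht]
        refine mul_le_of_le_one_right (by split_ifs <;> norm_num) ?_
        exact Finset.prod_le_one (fun i _ => by split_ifs <;> norm_num) fun i _ => by
          split_ifs <;> norm_num
      split_ifs at hA hB <;> linarith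
    · have := hu t
      have := hv t
      positivity
  have loc : ∀ t (n : ZMod (q t)), ∑ α : ZMod (q t), ((u t + v t * (if α = 0 then 1 else 0) : ℝ) : ℂ)
      * ZMod.stdAddChar (α * n) = ((u t * q t * (if n = 0 then 1 else 0) + v t : ℝ) : ℂ) := by
    intro t n
    have : ∀ α : ZMod (q t), ((u t + v t * (if α = 0 then 1 else 0) : ℝ) : ℂ)
        * ZMod.stdAddChar (α * n) = u t * ZMod.stdAddChar (α * n) +
          v t * ((if α = 0 then 1 else 0) * ZMod.stdAddChar (α * n)) := by
      intro α
      split_ifs <;> push_cast <;> ring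
    rw [Finset.sum_congr rfl fun α _ => this α]
    rw [Finset.sum_add_distrib, ← Finset.mul_sum, ← Finset.mul_sum, sum_std]
    push_cast
    congr 1
    · split_ifs <;> simp
    · simp
  have e1 : ∑ a : (∀ t, ZMod (q t)), (∏ t, w1 t (a t)) * fej q L a =
      ∑ i ∈ Finset.range L, ∑ j ∈ Finset.range L,
        (P * (if ((P : ℕ) : ℤ) ∣ ((i : ℤ) - j) then 1 else 0)) *
        ∏ t ∈ Tᶜ, (u t * q t * (if (((i : ℤ) - j : ℤ) : ZMod (q t)) = 0 then 1 else 0) + v t) := by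
    apply Complex.ofReal_injective
    rw [fej_sum]
    rw [Complex.ofReal_sum]
    refine Finset.sum_congr rfl fun i _ => ?_
    rw [Complex.ofReal_sum]
    refine Finset.sum_congr rfl fun j _ => ?_
    have : ∀ t, ∑ α : ZMod (q t), (w1 t α : ℂ) * ZMod.stdAddChar (α * (((i : ℤ) - j : ℤ) : ZMod (q t)))
        = ((if t ∈ T then (q t * (if (((i : ℤ) - j : ℤ) : ZMod (q t)) = 0 then 1 else 0)) else
          (u t * q t * (if (((i : ℤ) - j : ℤ) : ZMod (q t)) = 0 then 1 else 0) + v t) : ℝ) : ℂ) := by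
      intro t
      by_cases h : t ∈ T
      · simp only [hw1, if_pos h, Complex.ofReal_one, one_mul, sum_std]
        split_ifs <;> simp
      · simp only [hw1, if_neg h]
        exact loc t _
    simp only [this]
    rw [← Complex.ofReal_prod, prod_split, Finset.prod_mul_distrib, prod_ind q hinj, hP]
    push_cast
    rfl
  have e2 : ∑ a : (∀ t, ZMod (q t)), (∏ t, w2 t (a t)) * fej q L a =
      ∑ i ∈ Finset.range L, ∑ j ∈ Finset.range L,
        ∏ t ∈ Tᶜ, (u t * q t * (if (((i : ℤ) - j : ℤ) : ZMod (q t)) = 0 then 1 else 0) + v t) := by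
    apply Complex.ofReal_injective
    rw [fej_sum]
    rw [Complex.ofReal_sum]
    refine Finset.sum_congr rfl fun i _ => ?_
    rw [Complex.ofReal_sum]
    refine Finset.sum_congr rfl fun j _ => ?_
    have : ∀ t, ∑ α : ZMod (q t), (w2 t α : ℂ) * ZMod.stdAddChar (α * (((i : ℤ) - j : ℤ) : ZMod (q t)))
        = ((if t ∈ T then 1 else
          (u t * q t * (if (((i : ℤ) - j : ℤ) : ZMod (q t)) = 0 then 1 else 0) + v t) : ℝ) : ℂ) := by
      intro t
      by_cases h : t ∈ T
      · simp only [hw2, if_pos h]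
        rw [Finset.sum_eq_single 0] <;> simp +contextual
      · simp only [hw2, if_neg h]
        exact loc t _
    simp only [this]
    rw [← Complex.ofReal_prod, prod_split, Finset.prod_const_one, one_mul]
  have e3 : ∀ n : ℤ, ∏ t ∈ Tᶜ, (u t * q t * (if (n : ZMod (q t)) = 0 then 1 else 0) + v t) =
      ∑ s ∈ Tᶜ.powerset, (∏ t ∈ s, u t) * (∏ t ∈ Tᶜ \ s, v t) * ((∏ t ∈ s, q t : ℕ) *
        (if ((∏ t ∈ s, q t : ℕ) : ℤ) ∣ n then 1 else 0)) := by
    intro n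
    rw [Finset.prod_add]
    refine Finset.sum_congr rfl fun s _ => ?_
    rw [Finset.prod_mul_distrib, Finset.prod_mul_distrib, prod_ind q hinj]
    push_cast
    ring
  have e4 : ∑ i ∈ Finset.range L, ∑ j ∈ Finset.range L,
        (P * (if ((P : ℕ) : ℤ) ∣ ((i : ℤ) - j) then 1 else 0)) *
        ∏ t ∈ Tᶜ, (u t * q t * (if (((i : ℤ) - j : ℤ) : ZMod (q t)) = 0 then 1 else 0) + v t)
      = ∑ s ∈ Tᶜ.powerset, (∏ t ∈ s, u t) * (∏ t ∈ Tᶜ \ s, v t) *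
        (((P * ∏ t ∈ s, q t : ℕ) : ℝ) * zc L (P * ∏ t ∈ s, q t)) := by
    simp only [e3, zc_eq, Finset.mul_sum]
    simp_rw [Finset.sum_comm (s := Finset.range L) (t := Tᶜ.powerset)]
    refine Finset.sum_congr rfl fun s hs => Finset.sum_congr rfl fun i _ =>
      Finset.sum_congr rfl fun j _ => ?_
    have hdis : Disjoint T s := by
      rw [Finset.mem_powerset] at hs
      exact (disjoint_compl_right (a := T)).mono_right hs
    have hind := prod_ind q hinj (T ∪ s) ((i : ℤ) - j)
    rw [Finset.prod_union hdis, Finset.prod_union hdis, prod_ind q hinj, prod_ind q hinj] at hind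
    rw [← hP] at hind
    rw [← hind]
    push_cast
    ring
  have e5 : ∑ i ∈ Finset.range L, ∑ j ∈ Finset.range L,
        ∏ t ∈ Tᶜ, (u t * q t * (if (((i : ℤ) - j : ℤ) : ZMod (q t)) = 0 then 1 else 0) + v t)
      = ∑ s ∈ Tᶜ.powerset, (∏ t ∈ s, u t) * (∏ t ∈ Tᶜ \ s, v t) *
        (((∏ t ∈ s, q t : ℕ) : ℝ) * zc L (∏ t ∈ s, q t)) := by
    simp only [e3, zc_eq, Finset.mul_sum]
    simp_rw [Finset.sum_comm (s := Finset.range L) (t := Tᶜ.powerset)]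
  calc ∑ a : (∀ t, ZMod (q t)), (∏ t, (if t ∈ T then (if a t = 0 then 0 else 1)
      else u t + v t * (if a t = 0 then 1 else 0))) * fej q L a
      ≤ ∑ a : (∀ t, ZMod (q t)), ((∏ t, w1 t (a t)) * fej q L a - (∏ t, w2 t (a t)) * fej q L a) := by
        refine Finset.sum_le_sum fun a _ => ?_
        rw [← sub_mul]
        exact mul_le_mul_of_nonneg_right (h1 a) (fej_nonneg q _ _)
    _ = ∑ s ∈ Tᶜ.powerset, (∏ t ∈ s, u t) * (∏ t ∈ Tᶜ \ s, v t) *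
        (((P * ∏ t ∈ s, q t : ℕ) : ℝ) * zc L (P * ∏ t ∈ s, q t) -
          ((∏ t ∈ s, q t : ℕ) : ℝ) * zc L (∏ t ∈ s, q t)) := by
        rw [Finset.sum_sub_distrib, e1, e2, e4, e5, ← Finset.sum_sub_distrib]
        refine Finset.sum_congr rfl fun s _ => ?_
        ring
    _ ≤ ∑ s ∈ Tᶜ.powerset, (∏ t ∈ s, u t) * (∏ t ∈ Tᶜ \ s, v t) *
        (L * (P + 1) * (∏ t ∈ s, q t : ℕ)) := by
        refine Finset.sum_le_sum fun s _ => ?_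
        refine mul_le_mul_of_nonneg_left ?_ (mul_nonneg (Finset.prod_nonneg fun t _ => hu t)
          (Finset.prod_nonneg fun t _ => hv t))
        have hs : 0 < ∏ t ∈ s, q t := Finset.prod_pos fun t _ => (Fact.out : (q t).Prime).pos
        have b1 := (zc_bounds L _ (Nat.mul_pos hPpos hs)).2
        have b2 := (zc_bounds L _ hs).1
        push_cast at b1 b2 ⊢
        nlinarith
    _ = L * (P + 1) * ∏ t ∈ Tᶜ, (u t * q t + v t) := by
        rw [Finset.prod_add, Finset.mul_sum]
        refine Finset.sum_congr rfl fun s _ => ?_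
        rw [Finset.prod_mul_distrib]
        push_cast
        ring

theorem E2_bound (hinj : Function.Injective q) (L₁ L₂ : ℕ) (T : Finset ι) (hTne : T.Nonempty)
    (κ u v : ι → ℝ) (hκ : ∀ t, 0 ≤ κ t) (hu : ∀ t, 0 ≤ u t) (hv : ∀ t, 0 ≤ v t)
    (c : ∀ t, ZMod (q t) → ZMod (q t) → ℂ)
    (hcT : ∀ t ∈ T, ∀ a b, ‖c t a b‖ ≤ κ t * (if a = 0 then 0 else 1))
    (hcN : ∀ t ∉ T, ∀ a, ∑ b, ‖c t a b‖ ≤ u t + v t * (if a = 0 then 1 else 0)) :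
    ‖WW L₁ L₂ (fun x y => ∏ t, tf q c t x y)‖ ≤
      (∏ t ∈ T, κ t) * (L₂ * (L₂ + (∏ t ∈ T, q t : ℕ))) *
        (L₁ * ((∏ t ∈ T, q t : ℕ) + 1) * ∏ t ∈ Tᶜ, (u t * q t + v t)) := by
  refine (norm_WW_prod_le q L₁ L₂ c).trans ?_
  have h1 : ∀ a : (∀ t, ZMod (q t)), ∑ b : (∀ t, ZMod (q t)),
      (∏ t, ‖c t (a t) (b t)‖) * fej q L₁ a * fej q L₂ b ≤
      (∏ t ∈ T, κ t) * (L₂ * (L₂ + (∏ t ∈ T, q t : ℕ))) *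
      ((∏ t, (if t ∈ T then (if a t = 0 then 0 else 1)
      else u t + v t * (if a t = 0 then 1 else 0))) * fej q L₁ a) := by
    intro a
    have := E2_step1 q hinj L₂ T (fun t b => ‖c t (a t) b‖) (fun t b => norm_nonneg _)
      (fun t => κ t * (if a t = 0 then 0 else 1)) (fun t => u t + v t * (if a t = 0 then 1 else 0))
      (fun t => mul_nonneg (hκ t) (by split_ifs <;> norm_num))
      (fun t ht b => hcT t ht _ _) (fun t ht => hcN t ht _)
    have h2 := mul_le_mul_of_nonneg_right this (fej_nonneg q L₁ a)
    rw [Finset.sum_mul] at h2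
    refine le_trans (le_of_eq ?_) (h2.trans (le_of_eq ?_))
    · exact Finset.sum_congr rfl fun b _ => by ring
    · rw [prod_split, Finset.prod_mul_distrib]; ring
  refine (Finset.sum_le_sum fun a _ => h1 a).trans ?_
  rw [← Finset.mul_sum]
  refine mul_le_mul_of_nonneg_left (E2_step2 q hinj L₁ T hTne u v hu hv) ?_
  exact mul_nonneg (Finset.prod_nonneg fun t _ => hκ t) (by positivity)

lemma ech_natCast (a : ∀ t, ZMod (q t)) (n : ℕ) : ech q a (n : ℤ) = ech q a 1 ^ n := by
  induction n with
  | zero => simp [ech_zero]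
  | succ n ih => rw [pow_succ, ← ih, ← ech_add]; push_cast; rfl

lemma ech_period (a : ∀ t, ZMod (q t)) : ech q a 1 ^ (∏ t, q t) = 1 := by
  rw [← ech_natCast]
  unfold ech
  refine Finset.prod_eq_one fun t _ => ?_
  have : (((∏ t, q t : ℕ) : ℤ) : ZMod (q t)) = 0 := by
    rw [ZMod.intCast_zmod_eq_zero_iff_dvd]
    exact_mod_cast Finset.dvd_prod_of_mem _ (Finset.mem_univ t)
  rw [this, mul_zero, AddChar.map_zero_eq_one]

lemma ech_one_ne (hinj : Function.Injective q) (a : ∀ t, ZMod (q t)) (ha : a ≠ 0) :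
    ech q a 1 ≠ 1 := by
  intro h
  apply ha
  funext t
  have h1 : ech q a ((∏ s ∈ Finset.univ.erase t, q s : ℕ) : ℤ) = 1 := by
    rw [ech_natCast, h, one_pow]
  unfold ech at h1
  have h0 : ∏ x ∈ Finset.univ.erase t, ZMod.stdAddChar (a x *
      (((∏ s ∈ Finset.univ.erase t, q s : ℕ) : ℤ) : ZMod (q x))) = 1 := by
    refine Finset.prod_eq_one ?_
    intro s hs
    have : (((∏ t ∈ Finset.univ.erase t, q t : ℕ) : ℤ) : ZMod (q s)) = 0 := by
      rw [ZMod.intCast_zmod_eq_zero_iff_dvd]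
      exact_mod_cast Finset.dvd_prod_of_mem _ hs
    rw [this, mul_zero, AddChar.map_zero_eq_one]
  rw [← Finset.mul_prod_erase _ _ (Finset.mem_univ t), h0, mul_one] at h1
  have h2 : a t * (((∏ s ∈ Finset.univ.erase t, q s : ℕ) : ℤ) : ZMod (q t)) = 0 := by
    apply ZMod.injective_stdAddChar
    rw [h1, AddChar.map_zero_eq_one]
  rcases mul_eq_zero.1 h2 with h3 | h3
  · exact h3
  · exfalso
    rw [ZMod.intCast_zmod_eq_zero_iff_dvd] at h3
    have h4 : q t ∣ ∏ s ∈ Finset.univ.erase t, q s := by exact_mod_cast h3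
    obtain ⟨s, hs, hd⟩ := ((Fact.out : (q t).Prime).prime.dvd_finset_prod_iff _).1 h4
    have := (Nat.prime_dvd_prime_iff_eq (Fact.out : (q t).Prime) (Fact.out : (q s).Prime)).1 hd
    exact (Finset.ne_of_mem_erase hs) (hinj this.symm)

lemma fej_le_of_ne (hinj : Function.Injective q) (L : ℕ) (a : ∀ t, ZMod (q t)) (ha : a ≠ 0) :
    fej q L a ≤ ((∏ t, q t : ℕ) : ℝ) ^ 2 := by
  set k := ∏ t, q t with hk
  have hkpos : 0 < k := Finset.prod_pos fun t _ => (Fact.out : (q t).Prime).pos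
  set z := ech q a 1 with hz
  have hz1 : z ≠ 1 := ech_one_ne q hinj a ha
  have h1 : ∑ i ∈ Finset.range L, ech q a (i : ℤ) = ∑ i ∈ Finset.range (L % k), z ^ i := by
    simp only [ech_natCast]
    rw [geom_sum_eq hz1, geom_sum_eq hz1]
    congr 2
    conv_lhs => rw [← Nat.div_add_mod L k, pow_add, pow_mul, ech_period, one_pow, one_mul]
  unfold fej
  rw [h1]
  gcongr
  refine (norm_sum_le _ _).trans ?_
  have : ∀ i, ‖z ^ i‖ = 1 := fun i => by rw [norm_pow, hz, norm_ech, one_pow]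
  simp only [this]
  simp only [Finset.sum_const, Finset.card_range, nsmul_eq_mul, mul_one]
  exact_mod_cast (Nat.mod_lt L hkpos).le

theorem E1_bound (hinj : Function.Injective q) (L₁ L₂ : ℕ)
    (c : ∀ t, ZMod (q t) → ZMod (q t) → ℂ) (hc : ∀ t a b, ‖c t a b‖ ≤ 1) :
    ‖WW L₁ L₂ (fun x y => ∏ t, tf q c t x y)‖ ≤
      (∏ t, ‖c t 0 0‖) * (L₁ ^ 2 * L₂ ^ 2) +
        ((∏ t, q t : ℕ) : ℝ) ^ 4 * ((L₁ : ℝ) ^ 2 + L₂ ^ 2) := by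
  set k := ∏ t, q t with hk
  refine (norm_WW_prod_le q L₁ L₂ c).trans ?_
  have h1 : ∀ a b : (∀ t, ZMod (q t)),
      (∏ t, ‖c t (a t) (b t)‖) * fej q L₁ a * fej q L₂ b ≤
      (if a = 0 then (if b = 0 then (∏ t, ‖c t 0 0‖) * ((L₁ : ℝ) ^ 2 * L₂ ^ 2) else 0) else 0) +
        (k : ℝ) ^ 2 * ((L₁ : ℝ) ^ 2 + L₂ ^ 2) := by
    intro a b
    have p0 : 0 ≤ ∏ t, ‖c t (a t) (b t)‖ := Finset.prod_nonneg fun t _ => norm_nonneg _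
    have p1 : ∏ t, ‖c t (a t) (b t)‖ ≤ 1 :=
      Finset.prod_le_one (fun t _ => norm_nonneg _) fun t _ => hc t _ _
    have f1 := fej_le q L₁ a
    have f2 := fej_le q L₂ b
    have g1 := fej_nonneg q L₁ a
    have g2 := fej_nonneg q L₂ b
    have hk0 : (0 : ℝ) ≤ (k : ℝ) ^ 2 * (L₁ : ℝ) ^ 2 := by positivity
    have hk1 : (0 : ℝ) ≤ (k : ℝ) ^ 2 * (L₂ : ℝ) ^ 2 := by positivity
    by_cases ha : a = 0
    · by_cases hb : b = 0
      · subst ha; subst hb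
        simp only [if_true]
        have : fej q L₁ 0 * fej q L₂ 0 ≤ (L₁ : ℝ) ^ 2 * L₂ ^ 2 := mul_le_mul f1 f2 g2 (by positivity)
        have := mul_le_mul_of_nonneg_left this p0
        simp only [Pi.zero_apply] at this ⊢
        nlinarith
      · have h := fej_le_of_ne q hinj L₂ b hb
        simp only [if_neg hb, ite_self, zero_add]
        have h2 : fej q L₁ a * fej q L₂ b ≤ (L₁ : ℝ) ^ 2 * (k : ℝ) ^ 2 := mul_le_mul f1 h g2 (by positivity)
        have h3 := mul_le_of_le_one_left (mul_nonneg g1 g2) p1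
        nlinarith
    · have h := fej_le_of_ne q hinj L₁ a ha
      simp only [if_neg ha, zero_add]
      have h2 : fej q L₁ a * fej q L₂ b ≤ (k : ℝ) ^ 2 * (L₂ : ℝ) ^ 2 := mul_le_mul h f2 g2 (by positivity)
      have h3 := mul_le_of_le_one_left (mul_nonneg g1 g2) p1
      nlinarith
  refine (Finset.sum_le_sum fun a _ => Finset.sum_le_sum fun b _ => h1 a b).trans (le_of_eq ?_)
  have hcard : (Fintype.card (∀ t, ZMod (q t)) : ℝ) = k := by
    rw [Fintype.card_pi]; simp [hk, ZMod.card]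
  simp only [Finset.sum_add_distrib, Finset.sum_const, Finset.card_univ, nsmul_eq_mul, hcard]
  rw [Finset.sum_eq_single 0 (by intro b _ hb; simp [hb]) (by simp)]
  simp only [if_true]
  rw [Finset.sum_eq_single 0 (by intro b _ hb; simp [hb]) (by simp)]
  simp only [if_true]
  ring

end Global
end SqSieve

namespace SqSieve
open scoped Polynomial

/-! Part G: the arithmetic functions on integers -/

set_option linter.unusedSectionVars false

section Arith

/-- the `±1`-valued function -/
noncomputable def fv (f : ℤ[X]) (D q : ℕ) (x y : ℤ) : ℝ :=
  if (q : ℤ) ∣ hev f D x y then 1 else (jacobiSym (hev f D x y) q : ℝ)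

/-- the average over `x` -/
noncomputable def ep (f : ℤ[X]) (D p : ℕ) (y : ℤ) : ℝ :=
  (∑ x ∈ Finset.range p, (jacobiSym (hev f D (x : ℤ) y) p : ℝ)) / p

/-- the centred character -/
noncomputable def psi (f : ℤ[X]) (D p : ℕ) (x y : ℤ) : ℝ :=
  (jacobiSym (hev f D x y) p : ℝ) - ep f D p y

/-- good primes -/
def Good (f : ℤ[X]) (D q : ℕ) : Prop :=
  ∃ hp : q.Prime, q ≠ 2 ∧ @GoodRed q ⟨hp⟩ (f.map (Int.castRingHom (ZMod q))) D

variable {q : ℕ} [Fact q.Prime] (f : ℤ[X]) (D : ℕ)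

lemma jac_eq (x y : ℤ) : ((jacobiSym (hev f D x y) q : ℝ) : ℂ) =
    chiF (f.map (Int.castRingHom (ZMod q))) D (x : ZMod q) (y : ZMod q) := by
  have h := hev_map (Int.castRingHom (ZMod q)) f D x y
  simp only [eq_intCast] at h
  unfold chiF
  rw [h, ← jacobiSym.legendreSym.to_jacobiSym, qc_apply]
  simp [legendreSym]

lemma fv_eq (x y : ℤ) : (fv f D q x y : ℂ) =
    fF (f.map (Int.castRingHom (ZMod q))) D (x : ZMod q) (y : ZMod q) := by
  have h := hev_map (Int.castRingHom (ZMod q)) f D x y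
  simp only [eq_intCast] at h
  unfold fF fv zF
  rw [← jac_eq, h]
  simp only [ZMod.intCast_zmod_eq_zero_iff_dvd]
  split_ifs with hd
  · have : jacobiSym (hev f D x y) q = 0 := by
      rw [← jacobiSym.legendreSym.to_jacobiSym, legendreSym.eq_zero_iff]
      rwa [ZMod.intCast_zmod_eq_zero_iff_dvd]
    simp [this]
  · simp

lemma sum_range_zmod (g : ZMod q → ℂ) : ∑ x ∈ Finset.range q, g ((x : ℕ) : ZMod q) = ∑ x, g x := by
  refine Finset.sum_bij' (fun x _ => (x : ZMod q)) (fun x _ => x.val) ?_ ?_ ?_ ?_ ?_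
  · simp
  · intro a _; simpa using ZMod.val_lt a
  · intro a ha; simp only [Finset.mem_range] at ha; exact ZMod.val_cast_of_lt ha
  · intro a _; simp
  · simp

lemma ep_eq (y : ℤ) : (ep f D q y : ℂ) =
    (∑ x, chiF (f.map (Int.castRingHom (ZMod q))) D x (y : ZMod q)) / q := by
  unfold ep
  rw [← sum_range_zmod]
  push_cast
  congr 1
  refine Finset.sum_congr rfl fun x _ => ?_
  have := jac_eq (q := q) f D x y
  push_cast at this
  exact this

/-- centred local function -/
noncomputable def psiF (g : (ZMod q)[X]) (D : ℕ) (x y : ZMod q) : ℂ :=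
  chiF g D x y + (- (∑ x', chiF g D x' y) / q)

lemma psi_eq (x y : ℤ) : (psi f D q x y : ℂ) =
    psiF (f.map (Int.castRingHom (ZMod q))) D (x : ZMod q) (y : ZMod q) := by
  unfold psi psiF
  push_cast
  have := jac_eq (q := q) f D x y
  push_cast at this
  rw [ep_eq, this]
  ring

lemma ft_psiF (g : (ZMod q)[X]) (a b : ZMod q) :
    ft (psiF g D) a b = if a = 0 then 0 else ft (chiF g D) a b := by
  have hq0 : (q : ℂ) ≠ 0 := by exact_mod_cast (Fact.out : q.Prime).ne_zero
  have h1 : ft (psiF g D) a b = ft (chiF g D) a b +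
      ft (fun _ y => (- (∑ x', chiF g D x' y) / q)) a b := ft_add _ _ a b
  have h2 : ft (fun _ y => (- (∑ x', chiF g D x' y) / q)) a b =
      (∑ x : ZMod q, ZMod.stdAddChar (x * (-a))) *
        ∑ y, (- (∑ x', chiF g D x' y) / q) * ZMod.stdAddChar (-(b * y)) := by
    unfold ft
    rw [Finset.sum_mul_sum]
    refine Finset.sum_congr rfl fun x _ => Finset.sum_congr rfl fun y _ => ?_
    have : -(a * x + b * y) = x * (-a) + (-(b * y)) := by ring
    rw [this, AddChar.map_add_eq_mul]
    ring
  rw [h1, h2, sum_std]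
  split_ifs with h h' h'
  · subst h'
    unfold ft
    rw [Finset.sum_comm, Finset.mul_sum, ← Finset.sum_add_distrib]
    refine Finset.sum_eq_zero fun y _ => ?_
    simp only [zero_mul, zero_add]
    rw [← Finset.sum_mul]
    field_simp
    ring
  · exact absurd (neg_eq_zero.1 h) h'
  · exact absurd (neg_eq_zero.2 h') h
  · simp

lemma fv_cases (x y : ℤ) : fv f D q x y = 1 ∨ fv f D q x y = -1 := by
  rcases fF_cases (f.map (Int.castRingHom (ZMod q))) D (x : ZMod q) (y : ZMod q) with h | h
  · left; rw [← fv_eq] at h; exact_mod_cast h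
  · right; rw [← fv_eq] at h; exact_mod_cast h

lemma fv_of_sq (x y n : ℤ) (h : hev f D x y = n ^ 2) : fv f D q x y = 1 := by
  unfold fv
  split_ifs with hd
  · rfl
  · rw [h, ← jacobiSym.legendreSym.to_jacobiSym, legendreSym.sq_one']
    · simp
    · intro h0
      apply hd
      rw [h, ← ZMod.intCast_zmod_eq_zero_iff_dvd]
      push_cast
      rw [h0]; simp

end Arith

section Spec

variable {f : ℤ[X]} {D : ℕ}

lemma abs_jac_le (p : ℕ) (n : ℤ) : |(jacobiSym n p : ℝ)| ≤ 1 := by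
  rcases jacobiSym.trichotomy n p with h | h | h <;> simp [h]

lemma abs_ep_le_one (p : ℕ) (y : ℤ) : |ep f D p y| ≤ 1 := by
  unfold ep
  rw [abs_div, Nat.abs_cast]
  refine div_le_one_of_le₀ ?_ (by positivity)
  refine (Finset.abs_sum_le_sum_abs _ _).trans ?_
  refine (Finset.sum_le_sum fun x _ => abs_jac_le p _).trans ?_
  simp

lemma psi_sq_le (p : ℕ) (x y : ℤ) : psi f D p x y ^ 2 ≤ 4 := by
  have h1 := abs_le.1 (abs_ep_le_one (f := f) (D := D) p y)
  have h2 := abs_le.1 (abs_jac_le p (hev f D x y))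
  unfold psi
  nlinarith

lemma abs_ep_le (hD : Odd D) (hD3 : 3 ≤ D) {p : ℕ} (hp : Good f D p) (y : ℤ) :
    |ep f D p y| ≤ (24 * D + 100) / Real.sqrt p := by
  obtain ⟨hpp, h2, hg⟩ := hp
  have : Fact p.Prime := ⟨hpp⟩
  have h := norm_chiF_sum_x h2 hD hD3 hg (y : ZMod p)
  have hp0 : (0 : ℝ) < p := by exact_mod_cast hpp.pos
  have h3 : |ep f D p y| = ‖(ep f D p y : ℂ)‖ := by rw [Complex.norm_real]; rfl
  rw [h3, ep_eq, norm_div, Complex.norm_natCast, div_le_div_iff₀ hp0 (Real.sqrt_pos.2 hp0)]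
  calc _ ≤ (24 * D + 100) * Real.sqrt p * Real.sqrt p := by gcongr
    _ = _ := by rw [mul_assoc, Real.mul_self_sqrt hp0.le]

lemma psi_of_sq (hD : Odd D) (hD3 : 3 ≤ D) {p : ℕ} (hp : Good f D p) (x y n : ℤ)
    (h : hev f D x y = n ^ 2) :
    1 - (24 * D + 100) / Real.sqrt p - (if (p : ℤ) ∣ n then 1 else 0) ≤ psi f D p x y := by
  have h1 := (abs_le.1 (abs_ep_le hD hD3 hp y)).2
  obtain ⟨hpp, h2, hg⟩ := hp
  have : Fact p.Prime := ⟨hpp⟩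
  have h3 : 1 - (if (p : ℤ) ∣ n then (1 : ℝ) else 0) ≤ (jacobiSym (hev f D x y) p : ℝ) := by
    split_ifs with hd
    · rw [h, jacobiSym.pow_left]
      push_cast
      nlinarith [sq_nonneg ((jacobiSym n p : ℤ) : ℝ)]
    · rw [h, ← jacobiSym.legendreSym.to_jacobiSym, legendreSym.sq_one']
      · simp
      · rwa [ne_eq, ZMod.intCast_zmod_eq_zero_iff_dvd]
  unfold psi
  linarith

/-- real weighted sum -/
noncomputable def WR (L₁ L₂ : ℕ) (g : ℤ → ℤ → ℝ) : ℝ :=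
  ∑ i ∈ Finset.range L₁, ∑ j ∈ Finset.range L₁, ∑ i' ∈ Finset.range L₂, ∑ j' ∈ Finset.range L₂,
    g ((i : ℤ) - j) ((i' : ℤ) - j')

lemma abs_WR (L₁ L₂ : ℕ) (g : ℤ → ℤ → ℝ) : |WR L₁ L₂ g| = ‖WW L₁ L₂ (fun x y => (g x y : ℂ))‖ := by
  have : WW L₁ L₂ (fun x y => (g x y : ℂ)) = (WR L₁ L₂ g : ℂ) := by
    unfold WW WR; push_cast; rfl
  rw [this, Complex.norm_real]; rfl

/-- bound for a set of good primes, main term and error term -/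
lemma E1_spec (hD : Odd D) (L₁ L₂ : ℕ) (S : Finset ℕ) (hS : ∀ l ∈ S, Good f D l) :
    |WR L₁ L₂ (fun x y => ∏ l ∈ S, fv f D l x y)| ≤
      (∏ l ∈ S, ((D + 1) / l : ℝ)) * (L₁ ^ 2 * L₂ ^ 2) +
        ((∏ l ∈ S, l : ℕ) : ℝ) ^ 4 * ((L₁ : ℝ) ^ 2 + L₂ ^ 2) := by
  classical
  rw [abs_WR]
  have : ∀ t : S, Fact (t : ℕ).Prime := fun t => ⟨(hS t t.2).1⟩
  set c : ∀ t : S, ZMod (t : ℕ) → ZMod (t : ℕ) → ℂ := fun t a b =>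
    ft (fF (f.map (Int.castRingHom (ZMod (t : ℕ)))) D) a b / ((t : ℕ) : ℂ) ^ 2 with hc
  have hfun : (fun x y => ((∏ l ∈ S, fv f D l x y : ℝ) : ℂ)) =
      fun x y => ∏ t : S, tf (fun t : S => (t : ℕ)) c t x y := by
    funext x y
    push_cast
    rw [← Finset.prod_coe_sort]
    refine Finset.prod_congr rfl fun t _ => ?_
    have hq0 : ((t : ℕ) : ℂ) ≠ 0 := by exact_mod_cast (hS t t.2).1.ne_zero
    rw [fv_eq]
    unfold tf
    simp only [hc, div_mul_eq_mul_div, ← Finset.sum_div]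
    rw [ft_inversion]
    field_simp
  rw [hfun]
  have hc1 : ∀ t a b, ‖c t a b‖ ≤ 1 := by
    intro t a b
    have hq0 : (0 : ℝ) < ((t : ℕ) : ℝ) := by exact_mod_cast (hS t t.2).1.pos
    simp only [hc]
    rw [norm_div, norm_pow, Complex.norm_natCast]
    refine div_le_one_of_le₀ ?_ (by positivity)
    unfold ft
    have h1 : ∀ x y : ZMod (t : ℕ), ‖fF (f.map (Int.castRingHom (ZMod (t : ℕ)))) D x y *
        ZMod.stdAddChar (-(a * x + b * y))‖ ≤ 1 := by
      intro x y
      rw [norm_mul, AddChar.norm_apply, mul_one]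
      rcases fF_cases (f.map (Int.castRingHom (ZMod (t : ℕ)))) D x y with h | h <;> simp [h]
    refine (norm_sum_le _ _).trans ((Finset.sum_le_sum fun x _ =>
      (norm_sum_le _ _).trans (Finset.sum_le_sum fun y _ => h1 x y)).trans ?_)
    simp [ZMod.card, sq]
  refine (E1_bound _ Subtype.val_injective L₁ L₂ c hc1).trans ?_
  rw [Finset.prod_coe_sort S (fun l => l)]
  gcongr
  rw [← Finset.prod_coe_sort S (fun l => ((D + 1) / l : ℝ))]
  refine Finset.prod_le_prod (fun t _ => norm_nonneg _) fun t _ => ?_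
  have hq0 : (0 : ℝ) < ((t : ℕ) : ℝ) := by exact_mod_cast (hS t t.2).1.pos
  obtain ⟨hpp, h2, hg⟩ := hS t t.2
  have := norm_ft_fF_zero_zero h2 hD hg
  simp only [hc]
  rw [norm_div, norm_pow, Complex.norm_natCast, div_le_div_iff₀ (by positivity) hq0]
  nlinarith

lemma E2_spec (hD : Odd D) (hD3 : 3 ≤ D) (L₁ L₂ : ℕ) (S : Finset ℕ) (hS : ∀ l ∈ S, Good f D l)
    (p p' : ℕ) (hp : Good f D p) (hp' : Good f D p') (hpp : p ≠ p') (hpS : p ∉ S) (hpS' : p' ∉ S) :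
    |WR L₁ L₂ (fun x y => psi f D p x y * psi f D p' x y * ∏ l ∈ S, fv f D l x y)| ≤
      ((24 * D + 100) / p * ((24 * D + 100) / p')) * (L₂ * (L₂ + p * p')) *
      (L₁ * (p * p' + 1) * ∏ l ∈ S, ((1 + locC D / Real.sqrt l) * l + 2 * locC D)) := by
  classical
  rw [abs_WR]
  set S' : Finset ℕ := insert p (insert p' S) with hS'
  have hp1 : p ∉ insert p' S := by simp [hpp, hpS]
  have hG : ∀ l ∈ S', Good f D l := by
    intro l hl
    simp only [hS', Finset.mem_insert] at hl
    rcases hl with rfl | rfl | h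
    · exact hp
    · exact hp'
    · exact hS l h
  have : ∀ t : S', Fact (t : ℕ).Prime := fun t => ⟨(hG t t.2).1⟩
  set c : ∀ t : S', ZMod (t : ℕ) → ZMod (t : ℕ) → ℂ := fun t a b =>
    (if (t : ℕ) ∈ S then ft (fF (f.map (Int.castRingHom (ZMod (t : ℕ)))) D) a b else
      ft (psiF (f.map (Int.castRingHom (ZMod (t : ℕ)))) D) a b) / ((t : ℕ) : ℂ) ^ 2 with hc
  have hfun : (fun x y => ((psi f D p x y * psi f D p' x y * ∏ l ∈ S, fv f D l x y : ℝ) : ℂ)) =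
      fun x y => ∏ t : S', tf (fun t : S' => (t : ℕ)) c t x y := by
    funext x y
    have h1 : psi f D p x y * psi f D p' x y * ∏ l ∈ S, fv f D l x y =
        ∏ l ∈ S', (if l ∈ S then fv f D l x y else psi f D l x y) := by
      rw [hS', Finset.prod_insert hp1, Finset.prod_insert hpS', if_neg hpS, if_neg hpS', mul_assoc]
      congr 2
      exact Finset.prod_congr rfl fun l hl => (if_pos hl).symm
    rw [h1]
    push_cast
    rw [← Finset.prod_coe_sort]
    refine Finset.prod_congr rfl fun t _ => ?_
    have hq0 : ((t : ℕ) : ℂ) ≠ 0 := by exact_mod_cast (hG t t.2).1.ne_zero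
    unfold tf
    simp only [hc, div_mul_eq_mul_div, ← Finset.sum_div]
    split_ifs with h
    · rw [fv_eq, ft_inversion]
      field_simp
    · rw [psi_eq, ft_inversion]
      field_simp
  rw [hfun]
  set T : Finset S' := Finset.univ.filter (fun t => (t : ℕ) ∉ S) with hT
  have prodT : ∀ g : ℕ → ℝ, ∏ t ∈ T, g (t : ℕ) = g p * g p' := by
    intro g
    rw [hT, Finset.prod_filter, Finset.prod_coe_sort S' (fun l => if l ∉ S then g l else 1), hS',
      Finset.prod_insert hp1, Finset.prod_insert hpS', if_pos hpS, if_pos hpS']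
    rw [Finset.prod_eq_one, mul_one]
    intro l hl; simp [hl]
  have prodTc : ∀ g : ℕ → ℝ, ∏ t ∈ Tᶜ, g (t : ℕ) = ∏ l ∈ S, g l := by
    intro g
    have : Tᶜ = Finset.univ.filter (fun t : S' => (t : ℕ) ∈ S) := by
      ext t; simp [hT]
    rw [this, Finset.prod_filter, Finset.prod_coe_sort S' (fun l => if l ∈ S then g l else 1), hS',
      Finset.prod_insert hp1, Finset.prod_insert hpS', if_neg hpS, if_neg hpS', one_mul, one_mul]
    exact Finset.prod_congr rfl fun l hl => if_pos hl
  have hTne : T.Nonempty := ⟨⟨p, by simp [hS']⟩, by simp [hT, hpS]⟩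
  have hloc : 0 ≤ locC D := by unfold locC; positivity
  have main := E2_bound (fun t : S' => (t : ℕ)) Subtype.val_injective L₁ L₂ T hTne
    (fun t => (24 * D + 100) / ((t : ℕ) : ℝ)) (fun t => 1 + locC D / Real.sqrt (t : ℕ))
    (fun _ => 2 * locC D) (fun t => by positivity) (fun t => by positivity) (fun t => by positivity)
    c ?_ ?_
  · have e := prodT (fun l => (l : ℝ))
    have e' : ((∏ t ∈ T, (t : ℕ) : ℕ) : ℝ) = p * p' := by push_cast; exact e
    rw [e', prodT (fun l => (24 * D + 100) / (l : ℝ)),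
      prodTc (fun l => (1 + locC D / Real.sqrt l) * l + 2 * locC D)] at main
    exact main
  · intro t ht a b
    have htS : (t : ℕ) ∉ S := by simpa [hT] using ht
    have hq0 : (0 : ℝ) < ((t : ℕ) : ℝ) := by exact_mod_cast (hG t t.2).1.pos
    obtain ⟨hpr, h2, hg⟩ := hG t t.2
    simp only [hc, if_neg htS, ft_psiF]
    split_ifs with ha
    · simp
    · have := norm_ft_chiF h2 hD hD3 hg a b ha
      rw [norm_div, norm_pow, Complex.norm_natCast, mul_one, div_le_div_iff₀ (by positivity) hq0]
      nlinarith
  · intro t ht a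
    have htS : (t : ℕ) ∈ S := by simpa [hT] using ht
    have hq0 : (0 : ℝ) < ((t : ℕ) : ℝ) := by exact_mod_cast (hG t t.2).1.pos
    obtain ⟨hpr, h2, hg⟩ := hG t t.2
    simp only [hc, if_pos htS, norm_div, norm_pow, Complex.norm_natCast, ← Finset.sum_div]
    rw [div_le_iff₀ (by positivity)]
    split_ifs with ha
    · subst ha
      have := sum_ft_fF_zero h2 hD hD3 hg
      have h3 : 0 ≤ 1 + locC D / Real.sqrt (t : ℕ) := by positivity
      nlinarith [mul_nonneg h3 (sq_nonneg ((t : ℕ) : ℝ))]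
    · have := sum_ft_fF_ne h2 hD hg a ha
      linarith

end Spec
end SqSieve

namespace SqSieve
open scoped Polynomial

/-! Part S: the sieve inequality -/

section Sieve

lemma WR_mono (L₁ L₂ : ℕ) {g h : ℤ → ℤ → ℝ} (hgh : ∀ x y, g x y ≤ h x y) :
    WR L₁ L₂ g ≤ WR L₁ L₂ h := by
  unfold WR
  exact Finset.sum_le_sum fun _ _ => Finset.sum_le_sum fun _ _ => Finset.sum_le_sum fun _ _ =>
    Finset.sum_le_sum fun _ _ => hgh _ _

lemma WR_add (L₁ L₂ : ℕ) (g h : ℤ → ℤ → ℝ) :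
    WR L₁ L₂ (fun x y => g x y + h x y) = WR L₁ L₂ g + WR L₁ L₂ h := by
  unfold WR
  simp only [Finset.sum_add_distrib]

lemma WR_const_mul (L₁ L₂ : ℕ) (c : ℝ) (g : ℤ → ℤ → ℝ) :
    WR L₁ L₂ (fun x y => c * g x y) = c * WR L₁ L₂ g := by
  unfold WR
  simp only [Finset.mul_sum]

lemma WR_sum {α : Type*} (L₁ L₂ : ℕ) (s : Finset α) (g : α → ℤ → ℤ → ℝ) :
    WR L₁ L₂ (fun x y => ∑ m ∈ s, g m x y) = ∑ m ∈ s, WR L₁ L₂ (g m) := by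
  classical
  induction s using Finset.induction_on with
  | empty => simp [WR]
  | insert a s ha ih =>
    simp only [Finset.sum_insert ha]
    rw [WR_add, ih]

lemma fiber_card (L : ℕ) (x : ℤ) :
    (L : ℝ) - |(x : ℝ)| ≤ ((Finset.range L ×ˢ Finset.range L).filter
      fun ij => ((ij.1 : ℤ) - ij.2) = x).card := by
  have h : L - x.natAbs ≤ ((Finset.range L ×ˢ Finset.range L).filter
      fun ij => ((ij.1 : ℤ) - ij.2) = x).card := by
    rw [← Finset.card_range (L - x.natAbs)]
    refine Finset.card_le_card_of_injOn (fun j => (j + x.toNat, j + (-x).toNat)) ?_ ?_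
    · intro j hj
      simp only [Finset.coe_range, Set.mem_Iio] at hj
      simp only [Finset.coe_filter, Finset.mem_product, Finset.mem_range, Set.mem_ofPred_eq]
      omega
    · intro a _ b _ hab
      simp only [Prod.mk.injEq] at hab
      omega
  have h2 : (L : ℤ) - |x| ≤ ((L - x.natAbs : ℕ) : ℤ) := by rw [Int.abs_eq_natAbs]; omega
  have h3 : (L : ℝ) - |(x : ℝ)| ≤ ((L - x.natAbs : ℕ) : ℝ) := by exact_mod_cast h2
  exact h3.trans (by exact_mod_cast h)

lemma lower_WR (L₁ L₂ : ℕ) (g : ℤ → ℤ → ℝ) (hg : ∀ x y, 0 ≤ g x y) (Pts : Finset (ℤ × ℤ)) (τ : ℝ)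
    (hτ : 0 ≤ τ)
    (h1 : ∀ P ∈ Pts, 2 * |(P.1 : ℝ)| ≤ L₁) (h2 : ∀ P ∈ Pts, 2 * |(P.2 : ℝ)| ≤ L₂)
    (h3 : ∀ P ∈ Pts, τ ≤ g P.1 P.2) :
    Pts.card * ((L₁ : ℝ) / 2 * (L₂ / 2)) * τ ≤ WR L₁ L₂ g := by
  classical
  set A := (Finset.range L₁ ×ˢ Finset.range L₁) with hA
  set B := (Finset.range L₂ ×ˢ Finset.range L₂) with hB
  have e1 : WR L₁ L₂ g = ∑ z ∈ A ×ˢ B, g ((z.1.1 : ℤ) - z.1.2) ((z.2.1 : ℤ) - z.2.2) := by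
    unfold WR
    rw [Finset.sum_product, hA, hB, Finset.sum_product]
    simp only [Finset.sum_product]
  rw [e1]
  set φ : (ℕ × ℕ) × (ℕ × ℕ) → ℤ × ℤ := fun z => ((z.1.1 : ℤ) - z.1.2, (z.2.1 : ℤ) - z.2.2) with hφ
  have e2 : ∑ P ∈ Pts, ∑ z ∈ (A ×ˢ B).filter (fun z => φ z = P), g (φ z).1 (φ z).2 ≤
      ∑ z ∈ A ×ˢ B, g (φ z).1 (φ z).2 := by
    exact Finset.sum_fiberwise_le_sum_of_sum_fiber_nonneg
      (fun P _ => Finset.sum_nonneg fun z _ => hg _ _)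
  refine le_trans ?_ e2
  have e3 : ∀ P ∈ Pts, ((L₁ : ℝ) / 2 * (L₂ / 2)) * τ ≤
      ∑ z ∈ (A ×ˢ B).filter (fun z => φ z = P), g (φ z).1 (φ z).2 := by
    intro P hP
    have e4 : ∑ z ∈ (A ×ˢ B).filter (fun z => φ z = P), g (φ z).1 (φ z).2 =
        ((A ×ˢ B).filter (fun z => φ z = P)).card * g P.1 P.2 := by
      rw [Finset.sum_congr rfl (g := fun _ => g P.1 P.2), Finset.sum_const, nsmul_eq_mul]
      intro z hz
      rw [(Finset.mem_filter.1 hz).2]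
    have e5 : (A ×ˢ B).filter (fun z => φ z = P) =
        (A.filter fun ij => ((ij.1 : ℤ) - ij.2) = P.1) ×ˢ
        (B.filter fun ij => ((ij.1 : ℤ) - ij.2) = P.2) := by
      ext z
      simp only [Finset.mem_filter, Finset.mem_product, hφ, Prod.ext_iff]
      tauto
    rw [e4, e5, Finset.card_product]
    push_cast
    have a1 := fiber_card L₁ P.1
    have a2 := fiber_card L₂ P.2
    have b1 := h1 P hP
    have b2 := h2 P hP
    have a1' : (L₁ : ℝ) / 2 ≤ (A.filter fun ij => ((ij.1 : ℤ) - ij.2) = P.1).card := by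
      refine le_trans ?_ a1; linarith
    have a2' : (L₂ : ℝ) / 2 ≤ (B.filter fun ij => ((ij.1 : ℤ) - ij.2) = P.2).card := by
      refine le_trans ?_ a2; linarith
    exact mul_le_mul (mul_le_mul a1' a2' (by positivity) (by positivity)) (h3 P hP) hτ (by positivity)
  calc _ = ∑ P ∈ Pts, ((L₁ : ℝ) / 2 * (L₂ / 2)) * τ := by
        rw [Finset.sum_const, nsmul_eq_mul]; ring
    _ ≤ _ := Finset.sum_le_sum e3

variable (f : ℤ[X]) (D : ℕ)

/-- product over the primes of `r` -/
noncomputable def fr (r : ℕ) (x y : ℤ) : ℝ := ∏ l ∈ r.primeFactors, fv f D l x y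

/-- the sieve polynomial -/
noncomputable def TT (M : Finset (ℕ × ℕ)) (x y : ℤ) : ℝ :=
  ∑ m ∈ M, psi f D m.1 x y * fr f D m.2 x y

lemma fr_mul (r r' : ℕ) (x y : ℤ) : fr f D r x y * fr f D r' x y =
    ∏ l ∈ symmDiff r.primeFactors r'.primeFactors, fv f D l x y := by
  unfold fr
  set s := r.primeFactors with hs
  set s' := r'.primeFactors with hs'
  have h1 : (∏ l ∈ s ∩ s', fv f D l x y) * (∏ l ∈ s ∩ s', fv f D l x y) = 1 := by
    rw [← Finset.prod_mul_distrib]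
    refine Finset.prod_eq_one fun l hl => ?_
    have : Fact l.Prime := ⟨Nat.prime_of_mem_primeFactors (Finset.mem_inter.1 hl).1⟩
    rcases fv_cases (q := l) f D x y with h | h <;> rw [h] <;> norm_num
  have h2 : ∏ l ∈ s, fv f D l x y = (∏ l ∈ s \ s', fv f D l x y) * ∏ l ∈ s ∩ s', fv f D l x y := by
    rw [mul_comm, Finset.prod_inter_mul_prod_sdiff]
  have h3 : ∏ l ∈ s', fv f D l x y = (∏ l ∈ s' \ s, fv f D l x y) * ∏ l ∈ s ∩ s', fv f D l x y := by
    rw [mul_comm, Finset.inter_comm, Finset.prod_inter_mul_prod_sdiff]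
  have h4 : ∏ l ∈ symmDiff s s', fv f D l x y = (∏ l ∈ s \ s', fv f D l x y) * ∏ l ∈ s' \ s, fv f D l x y := by
    rw [symmDiff_def, Finset.sup_eq_union, Finset.prod_union]
    exact disjoint_sdiff_sdiff
  rw [h2, h3, h4]
  linear_combination (∏ l ∈ s \ s', fv f D l x y) * (∏ l ∈ s' \ s, fv f D l x y) * h1

lemma sum_diag {M : Finset (ℕ × ℕ)} (g : ℕ × ℕ → ℝ) :
    ∑ m ∈ M, ∑ m' ∈ M, (if m.1 = m'.1 then g m * g m' else 0) =
      ∑ p ∈ M.image Prod.fst, (∑ m ∈ M.filter (fun m => m.1 = p), g m) ^ 2 := by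
  rw [← Finset.sum_fiberwise_of_maps_to (s := M) (t := M.image Prod.fst) (g := Prod.fst)
    (fun m hm => Finset.mem_image_of_mem _ hm)]
  refine Finset.sum_congr rfl fun p _ => ?_
  rw [sq, Finset.sum_mul_sum]
  refine Finset.sum_congr rfl fun m hm => ?_
  rw [← Finset.sum_filter]
  refine Finset.sum_congr ?_ fun _ _ => rfl
  have := (Finset.mem_filter.1 hm).2
  ext m'
  simp only [Finset.mem_filter, this, eq_comm]

lemma TT_sq_le (M : Finset (ℕ × ℕ)) (x y : ℤ) :
    TT f D M x y ^ 2 ≤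
      ∑ m ∈ M, ∑ m' ∈ M, ((if m.1 = m'.1 then 4 else 0) *
        (∏ l ∈ symmDiff m.2.primeFactors m'.2.primeFactors, fv f D l x y) +
      (if m.1 = m'.1 then 0 else 1) * (psi f D m.1 x y * psi f D m'.1 x y *
        ∏ l ∈ symmDiff m.2.primeFactors m'.2.primeFactors, fv f D l x y)) := by
  have h1 : TT f D M x y ^ 2 =
      ∑ m ∈ M, ∑ m' ∈ M, (if m.1 = m'.1 then (psi f D m.1 x y * fr f D m.2 x y) *
        (psi f D m'.1 x y * fr f D m'.2 x y) else 0) +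
      ∑ m ∈ M, ∑ m' ∈ M, (if m.1 = m'.1 then 0 else 1) * (psi f D m.1 x y * psi f D m'.1 x y *
        ∏ l ∈ symmDiff m.2.primeFactors m'.2.primeFactors, fv f D l x y) := by
    unfold TT
    rw [sq, Finset.sum_mul_sum, ← Finset.sum_add_distrib]
    refine Finset.sum_congr rfl fun m _ => ?_
    rw [← Finset.sum_add_distrib]
    refine Finset.sum_congr rfl fun m' _ => ?_
    rw [← fr_mul]
    split_ifs <;> ring
  have h2 : ∑ m ∈ M, ∑ m' ∈ M, (if m.1 = m'.1 then (psi f D m.1 x y * fr f D m.2 x y) *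
        (psi f D m'.1 x y * fr f D m'.2 x y) else 0) ≤
      ∑ m ∈ M, ∑ m' ∈ M, (if m.1 = m'.1 then 4 else 0) *
        (∏ l ∈ symmDiff m.2.primeFactors m'.2.primeFactors, fv f D l x y) := by
    have h3 : ∑ m ∈ M, ∑ m' ∈ M, (if m.1 = m'.1 then 4 else 0) *
        (∏ l ∈ symmDiff m.2.primeFactors m'.2.primeFactors, fv f D l x y) =
        4 * ∑ m ∈ M, ∑ m' ∈ M, (if m.1 = m'.1 then fr f D m.2 x y * fr f D m'.2 x y else 0) := by
      rw [Finset.mul_sum]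
      refine Finset.sum_congr rfl fun m _ => ?_
      rw [Finset.mul_sum]
      refine Finset.sum_congr rfl fun m' _ => ?_
      rw [← fr_mul]
      split_ifs <;> ring
    rw [h3, sum_diag (fun m => psi f D m.1 x y * fr f D m.2 x y), sum_diag (fun m => fr f D m.2 x y),
      Finset.mul_sum]
    refine Finset.sum_le_sum fun p _ => ?_
    have h4 : ∑ m ∈ M.filter (fun m => m.1 = p), psi f D m.1 x y * fr f D m.2 x y =
        psi f D p x y * ∑ m ∈ M.filter (fun m => m.1 = p), fr f D m.2 x y := by
      rw [Finset.mul_sum]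
      refine Finset.sum_congr rfl fun m hm => ?_
      rw [(Finset.mem_filter.1 hm).2]
    rw [h4, mul_pow]
    exact mul_le_mul_of_nonneg_right (psi_sq_le p x y) (sq_nonneg _)
  rw [h1]
  simp only [Finset.sum_add_distrib]
  linarith

lemma WR_TT_le (L₁ L₂ : ℕ) (M : Finset (ℕ × ℕ)) :
    WR L₁ L₂ (fun x y => TT f D M x y ^ 2) ≤
      ∑ m ∈ M, ∑ m' ∈ M, ((if m.1 = m'.1 then 4 else 0) *
        |WR L₁ L₂ (fun x y => ∏ l ∈ symmDiff m.2.primeFactors m'.2.primeFactors, fv f D l x y)| +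
      (if m.1 = m'.1 then 0 else 1) * |WR L₁ L₂ (fun x y => psi f D m.1 x y * psi f D m'.1 x y *
        ∏ l ∈ symmDiff m.2.primeFactors m'.2.primeFactors, fv f D l x y)|) := by
  refine (WR_mono L₁ L₂ fun x y => TT_sq_le f D M x y).trans ?_
  rw [WR_sum]
  refine Finset.sum_le_sum fun m _ => ?_
  rw [WR_sum]
  refine Finset.sum_le_sum fun m' _ => ?_
  rw [WR_add, WR_const_mul, WR_const_mul]
  gcongr
  · exact le_abs_self _
  · exact le_abs_self _

end Sieve
end SqSieve

namespace SqSieve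
open scoped Polynomial

section Sieve2

/-- multiplicative weight -/
noncomputable def lam (r : ℕ) : ℝ := ∏ l ∈ r.primeFactors, (1 + (l : ℝ) ^ (-(1/4) : ℝ))

/-- gcd weight -/
noncomputable def wt (r r' : ℕ) : ℝ := (((Nat.gcd r r' : ℝ)) ^ 2 / (r * r')) ^ ((3/4) : ℝ)

lemma one_le_lam (r : ℕ) : 1 ≤ lam r := by
  unfold lam
  refine Finset.prod_induction _ (fun x => 1 ≤ x) (fun a b ha hb => one_le_mul_of_one_le_of_one_le ha hb)
    le_rfl fun l _ => ?_
  have : 0 ≤ (l : ℝ) ^ (-(1/4) : ℝ) := by positivity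
  linarith

lemma loc_E2 (D l : ℕ) (h : (3 * locC D) ^ 4 ≤ (l : ℝ)) :
    (1 + locC D / Real.sqrt l) * l + 2 * locC D ≤ l * (1 + (l : ℝ) ^ (-(1/4) : ℝ)) := by
  have hloc : 200 ≤ locC D := by unfold locC; nlinarith [(Nat.cast_nonneg D : (0 : ℝ) ≤ D)]
  set s : ℝ := (l : ℝ) ^ ((1/4) : ℝ) with hs
  have hl0 : (0 : ℝ) ≤ l := by positivity
  have hs0 : 0 ≤ s := by positivity
  have hs4 : s ^ 4 = l := by
    rw [hs, ← Real.rpow_natCast, ← Real.rpow_mul hl0]; norm_num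
  have hs3 : 3 * locC D ≤ s := by
    rw [← hs4] at h
    exact le_of_pow_le_pow_left₀ (by norm_num) hs0 h
  have hspos : 0 < s := by linarith
  have hneg : (l : ℝ) ^ (-(1/4) : ℝ) = 1 / s := by
    rw [Real.rpow_neg hl0, ← hs]; exact (one_div _).symm
  have hsq : Real.sqrt l = s ^ 2 := by
    rw [← hs4, show s ^ 4 = (s ^ 2) ^ 2 by ring, Real.sqrt_sq (by positivity)]
  rw [hneg, hsq, ← hs4]
  have e1 : (1 + locC D / s ^ 2) * s ^ 4 = s ^ 4 + locC D * s ^ 2 := by field_simp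
  have e2 : s ^ 4 * (1 + 1 / s) = s ^ 4 + s ^ 3 := by field_simp
  rw [e1, e2]
  nlinarith [mul_le_mul_of_nonneg_right hs3 (sq_nonneg s)]

lemma loc_E1 (D l : ℕ) (h : (3 * locC D) ^ 4 ≤ (l : ℝ)) :
    ((D + 1) / l : ℝ) ≤ (l : ℝ) ^ (-(3/4) : ℝ) := by
  have hloc : (D : ℝ) + 1 ≤ 3 * locC D := by unfold locC; nlinarith [(Nat.cast_nonneg D : (0 : ℝ) ≤ D)]
  have hD0 : (0 : ℝ) ≤ D := by positivity
  set s : ℝ := (l : ℝ) ^ ((1/4) : ℝ) with hs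
  have hl0 : (0 : ℝ) ≤ l := by positivity
  have hs0 : 0 ≤ s := by positivity
  have hs4 : s ^ 4 = l := by
    rw [hs, ← Real.rpow_natCast, ← Real.rpow_mul hl0]; norm_num
  have hs3 : 3 * locC D ≤ s := by
    rw [← hs4] at h
    exact le_of_pow_le_pow_left₀ (by norm_num) hs0 h
  have hspos : 0 < s := by linarith
  have hneg : (l : ℝ) ^ (-(3/4) : ℝ) = 1 / s ^ 3 := by
    rw [Real.rpow_neg hl0, hs, ← Real.rpow_natCast, ← Real.rpow_mul hl0, one_div]; norm_num
  rw [hneg, ← hs4, div_le_div_iff₀ (by positivity) (by positivity)]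
  nlinarith [pow_pos hspos 3]

lemma prod_symm_le {s s' : Finset ℕ} (g : ℕ → ℝ) (hg : ∀ l ∈ s ∪ s', 1 ≤ g l) :
    ∏ l ∈ symmDiff s s', g l ≤ (∏ l ∈ s, g l) * ∏ l ∈ s', g l := by
  have key : ∀ t ⊆ s ∪ s', 1 ≤ ∏ l ∈ t, g l := fun t ht =>
    Finset.prod_induction _ (fun x => 1 ≤ x) (fun a b ha hb => one_le_mul_of_one_le_of_one_le ha hb)
    le_rfl fun l hl => hg l (ht hl)
  have h4 : ∏ l ∈ symmDiff s s', g l = (∏ l ∈ s \ s', g l) * ∏ l ∈ s' \ s, g l := by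
    rw [symmDiff_def, Finset.sup_eq_union, Finset.prod_union]
    exact disjoint_sdiff_sdiff
  rw [h4, ← Finset.prod_inter_mul_prod_sdiff s s', ← Finset.prod_inter_mul_prod_sdiff s' s]
  have a1 := key (s ∩ s') (fun l hl => Finset.mem_union_left _ (Finset.mem_inter.1 hl).1)
  have a2 := key (s' ∩ s) (fun l hl => Finset.mem_union_left _ (Finset.mem_inter.1 hl).2)
  have b1 := key (s \ s') (fun l hl => Finset.mem_union_left _ (Finset.mem_sdiff.1 hl).1)
  have b2 := key (s' \ s) (fun l hl => Finset.mem_union_right _ (Finset.mem_sdiff.1 hl).1)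
  refine mul_le_mul ?_ ?_ (by linarith) (by positivity)
  · exact le_mul_of_one_le_left (by linarith) a1
  · exact le_mul_of_one_le_left (by linarith) a2

lemma prod_symm_gcd {r r' : ℕ} (hr : Squarefree r) (hr' : Squarefree r') :
    (∏ l ∈ symmDiff r.primeFactors r'.primeFactors, l) * (Nat.gcd r r') ^ 2 = r * r' := by
  have hr0 := hr.ne_zero
  have hr0' := hr'.ne_zero
  have hg : Squarefree (Nat.gcd r r') := hr.squarefree_of_dvd (Nat.gcd_dvd_left _ _)
  have e1 := Nat.prod_primeFactors_of_squarefree hr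
  have e2 := Nat.prod_primeFactors_of_squarefree hr'
  have e3 := Nat.prod_primeFactors_of_squarefree hg
  rw [Nat.primeFactors_gcd hr0 hr0'] at e3
  set s := r.primeFactors
  set s' := r'.primeFactors
  have h4 : ∏ l ∈ symmDiff s s', l = (∏ l ∈ s \ s', l) * ∏ l ∈ s' \ s, l := by
    rw [symmDiff_def, Finset.sup_eq_union, Finset.prod_union]
    exact disjoint_sdiff_sdiff
  rw [h4, ← e3]
  conv_rhs => rw [← e1, ← e2, ← Finset.prod_inter_mul_prod_sdiff s s',
    ← Finset.prod_inter_mul_prod_sdiff s' s, Finset.inter_comm s' s]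
  ring

variable {f : ℤ[X]} {D : ℕ}

/-- the primes used for the small moduli -/
def SmallOK (f : ℤ[X]) (D r : ℕ) : Prop :=
  Squarefree r ∧ ∀ l ∈ r.primeFactors, Good f D l ∧ (3 * locC D) ^ 4 ≤ (l : ℝ)

lemma E1_pair (hD : Odd D) (L₁ L₂ : ℕ) {r r' : ℕ} (hr : SmallOK f D r) (hr' : SmallOK f D r') :
    |WR L₁ L₂ (fun x y => ∏ l ∈ symmDiff r.primeFactors r'.primeFactors, fv f D l x y)| ≤
      wt r r' * (L₁ ^ 2 * L₂ ^ 2) + ((r : ℝ) * r') ^ 4 * ((L₁ : ℝ) ^ 2 + L₂ ^ 2) := by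
  set S := symmDiff r.primeFactors r'.primeFactors with hS
  have hSm : ∀ l ∈ S, Good f D l ∧ (3 * locC D) ^ 4 ≤ (l : ℝ) := by
    intro l hl
    rw [hS, Finset.mem_symmDiff] at hl
    rcases hl with h | h
    · exact hr.2 l h.1
    · exact hr'.2 l h.1
  have key := prod_symm_gcd hr.1 hr'.1
  rw [← hS] at key
  have hr0 : 0 < r := Nat.pos_of_ne_zero hr.1.ne_zero
  have hr0' : 0 < r' := Nat.pos_of_ne_zero hr'.1.ne_zero
  have hg0 : 0 < Nat.gcd r r' := Nat.gcd_pos_of_pos_left _ hr0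
  have hprod : ∏ l ∈ S, l ≤ r * r' := by
    rw [← key]; exact Nat.le_mul_of_pos_right _ (by positivity)
  have keyR : ((∏ l ∈ S, l : ℕ) : ℝ) * (Nat.gcd r r' : ℝ) ^ 2 = r * r' := by exact_mod_cast key
  refine (E1_spec hD L₁ L₂ S fun l hl => (hSm l hl).1).trans ?_
  have hP0 : (0 : ℝ) < ((∏ l ∈ S, l : ℕ) : ℝ) := by
    have : 0 < ∏ l ∈ S, l := Finset.prod_pos fun l hl => (hSm l hl).1.1.pos
    exact_mod_cast this
  gcongr
  · calc ∏ l ∈ S, ((D + 1) / l : ℝ) ≤ ∏ l ∈ S, (l : ℝ) ^ (-(3/4) : ℝ) :=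
          Finset.prod_le_prod (fun l _ => by positivity) fun l hl => loc_E1 D l (hSm l hl).2
      _ = ((∏ l ∈ S, l : ℕ) : ℝ) ^ (-(3/4) : ℝ) := by
          rw [Real.finsetProd_rpow _ _ (fun l _ => by positivity)]; push_cast; rfl
      _ = wt r r' := by
          unfold wt
          rw [Real.rpow_neg hP0.le, ← Real.inv_rpow hP0.le, ← keyR]
          congr 1
          have : (Nat.gcd r r' : ℝ) ≠ 0 := by positivity
          field_simp
  · exact_mod_cast hprod

lemma E2_pair (hD : Odd D) (hD3 : 3 ≤ D) (L₁ L₂ : ℕ) {r r' : ℕ} (hr : SmallOK f D r)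
    (hr' : SmallOK f D r') (p p' : ℕ) (hp : Good f D p) (hp' : Good f D p') (hpp : p ≠ p')
    (h1 : r < p) (h2 : r' < p) (h3 : r < p') (h4 : r' < p') (hL : L₂ ≤ p * p') :
    |WR L₁ L₂ (fun x y => psi f D p x y * psi f D p' x y *
        ∏ l ∈ symmDiff r.primeFactors r'.primeFactors, fv f D l x y)| ≤
      4 * (24 * D + 100) ^ 2 * (L₁ * L₂) * ((p * r * lam r) * (p' * r' * lam r')) := by
  set S := symmDiff r.primeFactors r'.primeFactors with hS
  have hSm : ∀ l ∈ r.primeFactors ∪ r'.primeFactors, Good f D l ∧ (3 * locC D) ^ 4 ≤ (l : ℝ) := by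
    intro l hl
    rcases Finset.mem_union.1 hl with h | h
    · exact hr.2 l h
    · exact hr'.2 l h
  have hSU : S ⊆ r.primeFactors ∪ r'.primeFactors := by
    intro l hl
    rw [hS, Finset.mem_symmDiff] at hl
    rw [Finset.mem_union]; tauto
  have hlt : ∀ l ∈ S, l < p ∧ l < p' := by
    intro l hl
    rcases Finset.mem_union.1 (hSU hl) with h | h
    · have := Nat.le_of_mem_primeFactors h; omega
    · have := Nat.le_of_mem_primeFactors h; omega
  have hpS : p ∉ S := fun h => by have := hlt p h; omega
  have hpS' : p' ∉ S := fun h => by have := hlt p' h; omega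
  refine (E2_spec hD hD3 L₁ L₂ S (fun l hl => (hSm l (hSU hl)).1) p p' hp hp' hpp hpS hpS').trans ?_
  have hloc : 0 ≤ locC D := by unfold locC; positivity
  have e1 : ∏ l ∈ S, ((1 + locC D / Real.sqrt l) * l + 2 * locC D) ≤ (r * lam r) * (r' * lam r') := by
    calc _ ≤ ∏ l ∈ S, (l * (1 + (l : ℝ) ^ (-(1/4) : ℝ))) :=
          Finset.prod_le_prod (fun l _ => by positivity) fun l hl => loc_E2 D l (hSm l (hSU hl)).2
      _ ≤ (∏ l ∈ r.primeFactors, (l * (1 + (l : ℝ) ^ (-(1/4) : ℝ)))) *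
          (∏ l ∈ r'.primeFactors, (l * (1 + (l : ℝ) ^ (-(1/4) : ℝ)))) := by
          refine prod_symm_le _ fun l hl => ?_
          have : (1 : ℝ) ≤ l := by exact_mod_cast (hSm l hl).1.1.pos
          have h0 : 0 ≤ (l : ℝ) ^ (-(1/4) : ℝ) := by positivity
          nlinarith
      _ = _ := by
          rw [Finset.prod_mul_distrib, Finset.prod_mul_distrib]
          unfold lam
          congr 2
          · rw [← Nat.cast_prod, Nat.prod_primeFactors_of_squarefree hr.1]
          · rw [← Nat.cast_prod, Nat.prod_primeFactors_of_squarefree hr'.1]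
  have hp0 : (1 : ℝ) ≤ p := by exact_mod_cast hp.1.pos
  have hp0' : (1 : ℝ) ≤ p' := by exact_mod_cast hp'.1.pos
  have hLR : (L₂ : ℝ) ≤ p * p' := by exact_mod_cast hL
  have hpp1 : (1 : ℝ) ≤ p * p' := by nlinarith
  set A : ℝ := 24 * D + 100 with hA
  have hA0 : 0 ≤ A := by positivity
  have hlr : 0 ≤ (r * lam r) * (r' * lam r') := by
    have := one_le_lam r; have := one_le_lam r'; positivity
  calc A / p * (A / p') * (L₂ * (L₂ + p * p')) * (L₁ * (p * p' + 1) *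
        ∏ l ∈ S, ((1 + locC D / Real.sqrt l) * l + 2 * locC D))
      ≤ A / p * (A / p') * (L₂ * (p * p' + p * p')) * (L₁ * (p * p' + p * p') *
        ((r * lam r) * (r' * lam r'))) := by
        gcongr
    _ = _ := by field_simp; ring

theorem sieve_upper (hD : Odd D) (hD3 : 3 ≤ D) (L₁ L₂ R : ℕ) (M : Finset (ℕ × ℕ)) (X : ℝ)
    (hG : ∀ m ∈ M, Good f D m.1) (hS : ∀ m ∈ M, SmallOK f D m.2) (hR : ∀ m ∈ M, m.2 ≤ R)
    (hX : ∀ m ∈ M, (m.1 * m.2 : ℝ) ≤ X) (hlt : ∀ m ∈ M, ∀ m' ∈ M, m'.2 < m.1)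
    (hL : ∀ m ∈ M, ∀ m' ∈ M, L₂ ≤ m.1 * m'.1) :
    WR L₁ L₂ (fun x y => TT f D M x y ^ 2) ≤
      4 * (L₁ ^ 2 * L₂ ^ 2) * (∑ m ∈ M, ∑ m' ∈ M, (if m.1 = m'.1 then wt m.2 m'.2 else 0)) +
      4 * R ^ 9 * ((L₁ : ℝ) ^ 2 + L₂ ^ 2) * M.card +
      4 * (24 * D + 100) ^ 2 * (L₁ * L₂) * X ^ 2 * (∑ m ∈ M, lam m.2) ^ 2 := by
  refine (WR_TT_le f D L₁ L₂ M).trans ?_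
  have step : ∀ m ∈ M, ∀ m' ∈ M, ((if m.1 = m'.1 then 4 else 0) *
        |WR L₁ L₂ (fun x y => ∏ l ∈ symmDiff m.2.primeFactors m'.2.primeFactors, fv f D l x y)| +
      (if m.1 = m'.1 then 0 else 1) * |WR L₁ L₂ (fun x y => psi f D m.1 x y * psi f D m'.1 x y *
        ∏ l ∈ symmDiff m.2.primeFactors m'.2.primeFactors, fv f D l x y)|) ≤
      4 * (L₁ ^ 2 * L₂ ^ 2) * (if m.1 = m'.1 then wt m.2 m'.2 else 0) +
      4 * R ^ 8 * ((L₁ : ℝ) ^ 2 + L₂ ^ 2) * (if m.1 = m'.1 then 1 else 0) +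
      4 * (24 * D + 100) ^ 2 * (L₁ * L₂) * X ^ 2 * (lam m.2 * lam m'.2) := by
    intro m hm m' hm'
    have l1 := one_le_lam m.2
    have l2 := one_le_lam m'.2
    have hT : 0 ≤ 4 * (24 * (D : ℝ) + 100) ^ 2 * (L₁ * L₂) * X ^ 2 * (lam m.2 * lam m'.2) := by positivity
    by_cases h : m.1 = m'.1
    · simp only [if_pos h]
      have := E1_pair hD L₁ L₂ (hS m hm) (hS m' hm')
      have r1 : (m.2 : ℝ) ≤ R := by exact_mod_cast hR m hm
      have r2 : (m'.2 : ℝ) ≤ R := by exact_mod_cast hR m' hm'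
      have r3 : ((m.2 : ℝ) * m'.2) ^ 4 ≤ R ^ 8 := by
        calc ((m.2 : ℝ) * m'.2) ^ 4 ≤ ((R : ℝ) * R) ^ 4 := by gcongr
          _ = _ := by ring
      have r4 := mul_le_mul_of_nonneg_right r3 (by positivity : (0 : ℝ) ≤ (L₁ : ℝ) ^ 2 + L₂ ^ 2)
      nlinarith
    · simp only [if_neg h]
      have := E2_pair hD hD3 L₁ L₂ (hS m hm) (hS m' hm') m.1 m'.1 (hG m hm) (hG m' hm') h
        (hlt m hm m hm) (hlt m hm m' hm') (hlt m' hm' m hm) (hlt m' hm' m' hm') (hL m hm m' hm')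
      have x1 := hX m hm
      have x2 := hX m' hm'
      have x3 : (m.1 * m.2 * lam m.2) * (m'.1 * m'.2 * lam m'.2) ≤ X ^ 2 * (lam m.2 * lam m'.2) := by
        calc (m.1 * m.2 * lam m.2) * (m'.1 * m'.2 * lam m'.2)
            ≤ (X * lam m.2) * (X * lam m'.2) := by
              have : (0 : ℝ) ≤ m.1 * m.2 := by positivity
              have hX0 : 0 ≤ X := this.trans x1
              have hX1 : 0 ≤ X * lam m.2 := by positivity
              gcongr
          _ = _ := by ring
      have x4 := mul_le_mul_of_nonneg_left x3 (by positivity : 0 ≤ 4 * (24 * (D : ℝ) + 100) ^ 2 * (L₁ * L₂))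
      simp only [zero_mul, zero_add, one_mul, mul_zero]
      refine this.trans (x4.trans (le_of_eq (by ring)))
  refine (Finset.sum_le_sum fun m hm => Finset.sum_le_sum fun m' hm' => step m hm m' hm').trans ?_
  simp only [Finset.sum_add_distrib]
  have c1 : ∑ m ∈ M, ∑ m' ∈ M, 4 * (R : ℝ) ^ 8 * ((L₁ : ℝ) ^ 2 + L₂ ^ 2) * (if m.1 = m'.1 then 1 else 0)
      ≤ 4 * R ^ 9 * ((L₁ : ℝ) ^ 2 + L₂ ^ 2) * M.card := by
    have : ∀ m ∈ M, ∑ m' ∈ M, 4 * (R : ℝ) ^ 8 * ((L₁ : ℝ) ^ 2 + L₂ ^ 2) * (if m.1 = m'.1 then 1 else 0) ≤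
        4 * R ^ 9 * ((L₁ : ℝ) ^ 2 + L₂ ^ 2) := by
      intro m hm
      rw [← Finset.mul_sum]
      have h1 : ∑ m' ∈ M, (if m.1 = m'.1 then (1 : ℝ) else 0) ≤ R := by
        rw [Finset.sum_boole]
        have : (M.filter fun m' => m.1 = m'.1).card ≤ (Finset.Icc 1 R).card := by
          refine Finset.card_le_card_of_injOn Prod.snd ?_ ?_
          · intro m' hm'
            have := (Finset.mem_filter.1 hm').1
            simp only [Finset.coe_Icc, Set.mem_Icc]
            exact ⟨Nat.pos_of_ne_zero (hS m' this).1.ne_zero, hR m' this⟩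
          · intro a ha b hb hab
            have h1 := (Finset.mem_filter.1 ha).2
            have h2 := (Finset.mem_filter.1 hb).2
            exact Prod.ext (h1.symm.trans h2) hab
        rw [Nat.card_Icc] at this
        exact_mod_cast this
      calc 4 * (R : ℝ) ^ 8 * ((L₁ : ℝ) ^ 2 + L₂ ^ 2) * ∑ m' ∈ M, (if m.1 = m'.1 then (1 : ℝ) else 0)
          ≤ 4 * (R : ℝ) ^ 8 * ((L₁ : ℝ) ^ 2 + L₂ ^ 2) * R := by gcongr
        _ = _ := by ring
    refine (Finset.sum_le_sum this).trans ?_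
    rw [Finset.sum_const, nsmul_eq_mul, mul_comm]
  have c2 : ∑ m ∈ M, ∑ m' ∈ M, 4 * (24 * (D : ℝ) + 100) ^ 2 * (L₁ * L₂) * X ^ 2 * (lam m.2 * lam m'.2) =
      4 * (24 * (D : ℝ) + 100) ^ 2 * (L₁ * L₂) * X ^ 2 * (∑ m ∈ M, lam m.2) ^ 2 := by
    simp only [← Finset.mul_sum]
    rw [sq (∑ m ∈ M, lam m.2), Finset.sum_mul]
  simp only [← Finset.mul_sum] at c1 c2 ⊢
  linarith

end Sieve2
end SqSieve

namespace SqSieve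
open scoped Polynomial

section Numeric

lemma pi_upper (z : ℝ) (hz : 1 < z) : (Nat.primeCounting ⌊z⌋₊ : ℝ) ≤ 6 * z / Real.log z := by
  have h := Chebyshev.pi_le_log4_mul_div hz
  have hlog : Real.log √z = Real.log z / 2 := Real.log_sqrt (by linarith)
  have hl : 0 < Real.log z := Real.log_pos hz
  have h4 : Real.log 4 ≤ 2 * 0.7 := by
    have : Real.log 4 = 2 * Real.log 2 := by
      rw [show (4 : ℝ) = 2 ^ 2 by norm_num, Real.log_pow]; norm_num
    rw [this]; have := Real.log_two_lt_d9; linarith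
  have hs : √z ≤ 2 * z / Real.log z := by
    rw [le_div_iff₀ hl]
    have h1 : Real.log √z ≤ √z := Real.log_le_self (Real.sqrt_nonneg _)
    have h2 : √z * √z = z := Real.mul_self_sqrt (by linarith)
    nlinarith [Real.sqrt_nonneg z]
  have h3 : Real.log 4 * z / Real.log √z ≤ 4 * z / Real.log z := by
    rw [hlog, div_le_div_iff₀ (by positivity) hl]
    have : Real.log 4 * z * Real.log z ≤ 1.4 * z * Real.log z := by
      have : 0 ≤ z * Real.log z := by positivity
      nlinarith
    have : 0 ≤ z * Real.log z := by positivity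
    nlinarith
  have : 4 * z / Real.log z + 2 * z / Real.log z = 6 * z / Real.log z := by ring
  linarith

lemma pi_diff (z : ℝ) (hz : 64 ≤ z) :
    z / Real.log z ≤ (Nat.primeCounting ⌊64 * z⌋₊ : ℝ) - Nat.primeCounting ⌊z⌋₊ := by
  have h1 := pi_upper z (by linarith)
  have hl : 0 < Real.log z := Real.log_pos (by linarith)
  set n := ⌊64 * z⌋₊ with hn
  have h2 := Chebyshev.pi_ge n
  have hn1 : (n : ℝ) ≤ 64 * z := Nat.floor_le (by linarith)
  have hn2 : 63 * z ≤ n := by have := Nat.lt_floor_add_one (64 * z); rw [← hn] at this; linarith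
  have hln : Real.log n ≤ 2 * Real.log z := by
    calc Real.log n ≤ Real.log (z * z) := Real.log_le_log (by linarith) (by nlinarith)
      _ = _ := by rw [Real.log_mul (by linarith) (by linarith)]; ring
  have hln0 : 0 < Real.log n := Real.log_pos (by linarith)
  have hl2 := Real.log_two_gt_d9
  have hlog1 : Real.log (n + 1) ≤ z := by
    have a1 : Real.log (n + 1) ≤ Real.log (z ^ 3) := Real.log_le_log (by positivity) (by
      have : 64 * 64 * z ≤ z ^ 3 := by
        calc 64 * 64 * z ≤ z * z * z := by gcongr
          _ = z ^ 3 := by ring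
      linarith)
    rw [Real.log_pow] at a1
    have a2 : Real.log √z ≤ √z := Real.log_le_self (Real.sqrt_nonneg _)
    rw [Real.log_sqrt (by linarith)] at a2
    have a3 : 8 ≤ √z := by rw [show (8 : ℝ) = √64 by rw [show (64 : ℝ) = 8 ^ 2 by norm_num]; simp]; exact Real.sqrt_le_sqrt hz
    have a4 : √z * √z = z := Real.mul_self_sqrt (by linarith)
    push_cast at a1
    nlinarith
  have h3 : 7 * z / Real.log z ≤ (n * Real.log 2 - Real.log (n + 1)) / Real.log n := by
    rw [div_le_div_iff₀ hl hln0]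
    have : 14 * z ≤ n * Real.log 2 - Real.log (n + 1) := by nlinarith
    calc 7 * z * Real.log n ≤ 7 * z * (2 * Real.log z) := by gcongr
      _ = 14 * z * Real.log z := by ring
      _ ≤ _ := by gcongr
  have : 7 * z / Real.log z = z / Real.log z + 6 * z / Real.log z := by ring
  linarith

/-- admissible small modulus -/
def okr (B : Finset ℕ) (r : ℕ) : Prop := Squarefree r ∧ ∀ l ∈ r.primeFactors, l ∉ B

open Classical in
/-- the set of admissible moduli -/
noncomputable def RRs (B : Finset ℕ) (R : ℕ) : Finset ℕ := (Finset.Icc 1 R).filter (okr B)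

open Classical in
/-- admissible primes for a given modulus -/
noncomputable def PPs (B : Finset ℕ) (Q : ℝ) (r : ℕ) : Finset ℕ :=
  (Finset.Icc 1 ⌊64 * Q⌋₊).filter fun p => p.Prime ∧ p ∉ B ∧ Q < p * r ∧ (p * r : ℝ) ≤ 64 * Q

open Classical in
/-- admissible pairs -/
noncomputable def MMs (B : Finset ℕ) (Q : ℝ) (R : ℕ) : Finset (ℕ × ℕ) :=
  ((Finset.Icc 1 ⌊64 * Q⌋₊) ×ˢ (Finset.Icc 1 R)).filter fun m =>
    okr B m.2 ∧ m.1.Prime ∧ m.1 ∉ B ∧ Q < m.1 * m.2 ∧ (m.1 * m.2 : ℝ) ≤ 64 * Q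

lemma mem_MMs (B : Finset ℕ) (Q : ℝ) (R : ℕ) (m : ℕ × ℕ) :
    m ∈ MMs B Q R ↔ m.2 ∈ RRs B R ∧ m.1 ∈ PPs B Q m.2 := by
  unfold MMs RRs PPs
  simp only [Finset.mem_filter, Finset.mem_product]
  tauto

lemma sum_MMs (B : Finset ℕ) (Q : ℝ) (R : ℕ) (g : ℕ × ℕ → ℝ) :
    ∑ m ∈ MMs B Q R, g m = ∑ r ∈ RRs B R, ∑ p ∈ PPs B Q r, g (p, r) :=
  Finset.sum_finset_product_right _ _ _ (mem_MMs B Q R)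

lemma card_PPs_le (B : Finset ℕ) (Q : ℝ) (r R : ℕ) (hr : 1 ≤ r) (hrR : r ≤ R) (hQ : 64 ≤ Q)
    (hRQ : (R : ℝ) ^ 2 ≤ Q) : ((PPs B Q r).card : ℝ) ≤ 768 * Q / (r * Real.log Q) := by
  have hr1 : (1 : ℝ) ≤ r := by exact_mod_cast hr
  have hr2 : (r : ℝ) ≤ R := by exact_mod_cast hrR
  have hle : (PPs B Q r).card ≤ Nat.primeCounting ⌊64 * Q / r⌋₊ := by
    rw [← Nat.primesLE_card_eq_primeCounting]
    refine Finset.card_le_card fun p hp => ?_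
    unfold PPs at hp
    rw [Finset.mem_filter] at hp
    rw [Nat.mem_primesLE]
    refine ⟨Nat.le_floor ?_, hp.2.1⟩
    rw [le_div_iff₀ (by linarith)]
    exact hp.2.2.2.2
  have hsq : √Q ≤ 64 * Q / r := by
    rw [le_div_iff₀ (by linarith)]
    have h1 : √Q * √Q = Q := Real.mul_self_sqrt (by linarith)
    have h2 : (r : ℝ) ≤ √Q := Real.le_sqrt_of_sq_le (by nlinarith)
    nlinarith [Real.sqrt_nonneg Q]
  have hsq8 : 8 ≤ √Q := Real.le_sqrt_of_sq_le (by linarith)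
  have hu := pi_upper (64 * Q / r) (by linarith)
  have hlq : 0 < Real.log Q := Real.log_pos (by linarith)
  have hlog : Real.log Q / 2 ≤ Real.log (64 * Q / r) := by
    rw [← Real.log_sqrt (by linarith)]; exact Real.log_le_log (by linarith) hsq
  calc ((PPs B Q r).card : ℝ) ≤ _ := by exact_mod_cast hle
    _ ≤ 6 * (64 * Q / r) / Real.log (64 * Q / r) := hu
    _ ≤ 6 * (64 * Q / r) / (Real.log Q / 2) := by gcongr
    _ = _ := by field_simp; ring

lemma card_PPs_ge (B : Finset ℕ) (Q : ℝ) (r R : ℕ) (hr : 1 ≤ r) (hrR : r ≤ R) (hQ : 64 ≤ Q / R)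
    (hB : 2 * B.card * Real.log Q ≤ Q / R) : Q / (2 * (r * Real.log Q)) ≤ ((PPs B Q r).card : ℝ) := by
  have hr1 : (1 : ℝ) ≤ r := by exact_mod_cast hr
  have hr2 : (r : ℝ) ≤ R := by exact_mod_cast hrR
  have hR1 : (1 : ℝ) ≤ R := hr1.trans hr2
  have hQ64 : 64 ≤ Q := by
    rw [le_div_iff₀ (by linarith)] at hQ; nlinarith
  have hz : Q / R ≤ Q / r := by gcongr
  have hz1 : Q / r ≤ Q := by rw [div_le_iff₀ (by linarith)]; nlinarith
  have hd := pi_diff (Q / r) (by linarith)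
  have hlq : 0 < Real.log Q := Real.log_pos (by linarith)
  have hlz : 0 < Real.log (Q / r) := Real.log_pos (by linarith)
  have hlz1 : Real.log (Q / r) ≤ Real.log Q := Real.log_le_log (by linarith) hz1
  have hsub : Nat.primesLE ⌊64 * (Q / r)⌋₊ ⊆ PPs B Q r ∪ (Nat.primesLE ⌊Q / r⌋₊ ∪ B) := by
    intro p hp
    rw [Nat.mem_primesLE] at hp
    have hp1 : (p : ℝ) ≤ 64 * (Q / r) := (Nat.le_floor_iff (by linarith)).1 hp.1
    by_cases h1 : p ∈ B
    · simp [h1]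
    by_cases h2 : p ≤ ⌊Q / r⌋₊
    · simp [h2, hp.2, Nat.mem_primesLE]
    rw [Finset.mem_union]; left
    have h3 : Q / r < p := (Nat.floor_lt (by linarith)).1 (by omega)
    unfold PPs
    rw [Finset.mem_filter]
    have h4 : (p : ℝ) * r ≤ 64 * Q := by
      rw [← mul_div_assoc, le_div_iff₀ (by linarith)] at hp1; exact hp1
    have h5 : Q < p * r := by rwa [div_lt_iff₀ (by linarith)] at h3
    refine ⟨Finset.mem_Icc.2 ⟨hp.2.pos, Nat.le_floor ?_⟩, hp.2, h1, h5, h4⟩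
    nlinarith [(Nat.cast_nonneg p : (0 : ℝ) ≤ p)]
  have hc : Nat.primeCounting ⌊64 * (Q / r)⌋₊ ≤ (PPs B Q r).card + (Nat.primeCounting ⌊Q / r⌋₊ + B.card) := by
    rw [← Nat.primesLE_card_eq_primeCounting, ← Nat.primesLE_card_eq_primeCounting]
    refine (Finset.card_le_card hsub).trans ((Finset.card_union_le _ _).trans ?_)
    have := Finset.card_union_le (Nat.primesLE ⌊Q / r⌋₊) B
    omega
  have hc' : (Nat.primeCounting ⌊64 * (Q / r)⌋₊ : ℝ) ≤ (PPs B Q r).card + (Nat.primeCounting ⌊Q / r⌋₊ + B.card) := by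
    exact_mod_cast hc
  have h6 : Q / r / Real.log Q ≤ Q / r / Real.log (Q / r) := by gcongr
  have h7 : (B.card : ℝ) ≤ Q / r / Real.log Q / 2 := by
    rw [le_div_iff₀ (by norm_num), le_div_iff₀ hlq]; linarith
  have h8 : Q / (2 * (r * Real.log Q)) = Q / r / Real.log Q / 2 := by field_simp
  rw [h8]; linarith

lemma prod_one_add_inv_le (S : Finset ℕ) (hS : ∀ p ∈ S, 1 ≤ p) :
    ∏ p ∈ S, (1 + 1 / (p : ℝ)) ≤ S.card + 1 := by
  induction S using Finset.induction_on_max with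
  | empty => simp
  | insert a s ha ih =>
    have hna : a ∉ s := fun h => lt_irrefl _ (ha a h)
    rw [Finset.prod_insert hna, Finset.card_insert_of_notMem hna]
    have h1 := ih fun p hp => hS p (Finset.mem_insert_of_mem hp)
    have hcard : s.card + 1 ≤ a := by
      have : s ⊆ Finset.Ico 1 a := fun p hp => Finset.mem_Ico.2 ⟨hS p (Finset.mem_insert_of_mem hp), ha p hp⟩
      have := Finset.card_le_card this
      have h1 := hS a (Finset.mem_insert_self _ _)
      simp at this; omega
    have hc : (s.card : ℝ) + 1 ≤ a := by exact_mod_cast hcard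
    have ha0 : (0 : ℝ) < a := by have : (0 : ℝ) ≤ s.card := by positivity
                                 linarith
    calc (1 + 1 / (a : ℝ)) * ∏ p ∈ s, (1 + 1 / (p : ℝ)) ≤ (1 + 1 / (a : ℝ)) * (s.card + 1) := by gcongr
      _ = (s.card + 1) + (s.card + 1) / a := by ring
      _ ≤ (s.card + 1) + 1 := by gcongr; rw [div_le_one ha0]; exact hc
      _ = _ := by push_cast; ring

lemma sum_inv_sq_le (N : ℕ) : ∑ m ∈ Finset.Icc 1 N, 1 / (m : ℝ) ^ 2 ≤ 2 := by
  have := sum_Ioo_inv_sq_le (α := ℝ) 0 (N + 1)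
  have e : Finset.Ioo 0 (N + 1) = Finset.Icc 1 N := by ext; simp; omega
  rw [e] at this
  simpa using this

/-- Lower bound for the reciprocal sum of admissible moduli. -/
lemma sum_RRs_ge (B : Finset ℕ) (R : ℕ) :
    Real.log (R + 1) ≤ 2 * (B.card + 1) * ∑ r ∈ RRs B R, 1 / (r : ℝ) := by
  classical
  set B' := B.filter (fun p => 1 ≤ p) with hB'
  have hex : ∀ n : ℕ, ∃ t : ℕ × Finset ℕ × ℕ, n ∈ Finset.Icc 1 R →
      (t.1 ∈ RRs B R ∧ t.2.1 ∈ B'.powerset ∧ t.2.2 ∈ Finset.Icc 1 R) ∧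
      n = t.1 * (∏ p ∈ t.2.1, p) * t.2.2 ^ 2 := by
    intro n
    by_cases hn : n ∈ Finset.Icc 1 R
    swap
    · exact ⟨⟨0, ∅, 0⟩, fun h => absurd h hn⟩
    rw [Finset.mem_Icc] at hn
    obtain ⟨a, b, ha, hb, hab, hsq⟩ := Nat.sq_mul_squarefree_of_pos (show 0 < n by omega)
    set T := a.primeFactors.filter (fun p => p ∈ B') with hT
    set T' := a.primeFactors.filter (fun p => ¬ p ∈ B') with hT'
    have hprod : (∏ p ∈ T', p) * (∏ p ∈ T, p) = a := by
      rw [mul_comm, hT, hT', Finset.prod_filter_mul_prod_filter_not, Nat.prod_primeFactors_of_squarefree hsq]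
    have hdvd : (∏ p ∈ T', p) ∣ a := ⟨_, hprod.symm⟩
    have hle : a ≤ n := Nat.le_of_dvd (by omega) ⟨b ^ 2, by rw [← hab, mul_comm]⟩
    have hble : b ≤ n := Nat.le_of_dvd (by omega) ⟨b * a, by rw [← hab]; ring⟩
    have hle' := Nat.le_of_dvd ha hdvd
    have hpf : (∏ p ∈ T', p).primeFactors = T' :=
      Nat.primeFactors_prod fun p hp => Nat.prime_of_mem_primeFactors (Finset.mem_filter.1 hp).1
    refine ⟨⟨∏ p ∈ T', p, T, b⟩, fun _ => ⟨⟨?_, ?_, ?_⟩, ?_⟩⟩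
    · unfold RRs
      rw [Finset.mem_filter, Finset.mem_Icc]
      refine ⟨⟨Nat.pos_of_dvd_of_pos hdvd ha, hle'.trans (hle.trans hn.2)⟩, hsq.squarefree_of_dvd hdvd, ?_⟩
      rw [hpf]
      intro l hl hlB
      have h1 := (Finset.mem_filter.1 hl)
      exact h1.2 (Finset.mem_filter.2 ⟨hlB, (Nat.prime_of_mem_primeFactors h1.1).pos⟩)
    · rw [Finset.mem_powerset]
      exact fun p hp => (Finset.mem_filter.1 hp).2
    · exact Finset.mem_Icc.2 ⟨hb, hble.trans hn.2⟩
    · simp only [hprod]; rw [← hab, mul_comm]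
  choose φ hφ using hex
  have hinj : Set.InjOn φ (Finset.Icc 1 R : Finset ℕ) := by
    intro n hn m hm h
    rw [(hφ n hn).2, (hφ m hm).2, h]
  set G : ℕ × Finset ℕ × ℕ → ℝ := fun t => (1 / (t.1 : ℝ)) * ((∏ p ∈ t.2.1, 1 / (p : ℝ)) * (1 / (t.2.2 : ℝ) ^ 2)) with hG
  have hG0 : ∀ t, 0 ≤ G t := fun t => by rw [hG]; positivity
  have h1 : Real.log (R + 1) ≤ ∑ n ∈ Finset.Icc 1 R, 1 / (n : ℝ) := by
    have := log_add_one_le_harmonic R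
    rw [harmonic_eq_sum_Icc] at this
    push_cast at this
    simpa using this
  have h2 : ∑ n ∈ Finset.Icc 1 R, 1 / (n : ℝ) = ∑ n ∈ Finset.Icc 1 R, G (φ n) := by
    refine Finset.sum_congr rfl fun n hn => ?_
    have := (hφ n hn).2
    conv_lhs => rw [this]
    rw [hG]
    push_cast
    simp only [one_div, mul_inv, Finset.prod_inv_distrib]
    ring
  have h3 : ∑ n ∈ Finset.Icc 1 R, G (φ n) ≤ ∑ t ∈ RRs B R ×ˢ (B'.powerset ×ˢ Finset.Icc 1 R), G t := by
    rw [← Finset.sum_image (s := Finset.Icc 1 R) (g := φ) (f := G) hinj]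
    refine Finset.sum_le_sum_of_subset_of_nonneg ?_ fun t _ _ => hG0 t
    intro t ht
    obtain ⟨n, hn, rfl⟩ := Finset.mem_image.1 ht
    simp only [Finset.mem_product]
    exact (hφ n hn).1
  have h4 : ∑ t ∈ RRs B R ×ˢ (B'.powerset ×ˢ Finset.Icc 1 R), G t =
      (∑ r ∈ RRs B R, 1 / (r : ℝ)) * ((∏ p ∈ B', (1 + 1 / (p : ℝ))) * ∑ m ∈ Finset.Icc 1 R, 1 / (m : ℝ) ^ 2) := by
    rw [Finset.prod_one_add, Finset.sum_mul_sum, Finset.sum_mul_sum, Finset.sum_product]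
    refine Finset.sum_congr rfl fun r _ => ?_
    rw [Finset.sum_product]
    simp only [hG, Finset.mul_sum]
  have h5 := prod_one_add_inv_le B' fun p hp => (Finset.mem_filter.1 hp).2
  have h6 : (B'.card : ℝ) ≤ B.card := by exact_mod_cast Finset.card_filter_le _ _
  have h7 := sum_inv_sq_le R
  have h8 : 0 ≤ ∑ r ∈ RRs B R, 1 / (r : ℝ) := Finset.sum_nonneg fun r _ => by positivity
  calc Real.log (R + 1) ≤ _ := h1
    _ = _ := h2
    _ ≤ _ := h3
    _ = _ := h4
    _ ≤ (∑ r ∈ RRs B R, 1 / (r : ℝ)) * ((B.card + 1) * 2) := by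
        gcongr
        linarith
    _ = _ := by ring

/-- the multiplicative function n^{-1/4} -/
noncomputable def qf : ArithmeticFunction ℝ := ⟨fun n => (n : ℝ) ^ (-(1/4) : ℝ), by simp⟩

lemma qf_apply (n : ℕ) : qf n = (n : ℝ) ^ (-(1/4) : ℝ) := rfl

lemma lam_eq (r : ℕ) (hr : Squarefree r) : lam r = ∑ d ∈ r.divisors, (d : ℝ) ^ (-(1/4) : ℝ) := by
  have hm : qf.IsMultiplicative := by
    refine ⟨by simp [qf_apply], fun {m n} _ => ?_⟩
    rw [qf_apply, qf_apply, qf_apply]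
    push_cast
    exact Real.mul_rpow (by positivity) (by positivity)
  exact hm.prodPrimeFactors_one_add_of_squarefree hr

/-- Upper bound for the weighted reciprocal sum. -/
lemma sum_lam_le : ∃ C : ℝ, 0 < C ∧ ∀ (B : Finset ℕ) (R : ℕ), 1 ≤ R →
    ∑ r ∈ RRs B R, lam r / r ≤ C * (1 + Real.log R) := by
  classical
  have hs : Summable fun n : ℕ => (n : ℝ) ^ (-(5/4) : ℝ) := Real.summable_nat_rpow.2 (by norm_num)
  refine ⟨∑' n : ℕ, (n : ℝ) ^ (-(5/4) : ℝ) + 1, ?_, fun B R hR => ?_⟩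
  · have : 0 ≤ ∑' n : ℕ, (n : ℝ) ^ (-(5/4) : ℝ) := tsum_nonneg fun n => by positivity
    linarith
  have hT0 : 0 ≤ ∑' n : ℕ, (n : ℝ) ^ (-(5/4) : ℝ) := tsum_nonneg fun n => by positivity
  have hlR : 0 ≤ Real.log R := Real.log_natCast_nonneg R
  have h1 : ∀ r ∈ RRs B R, lam r / r ≤ ∑ d ∈ Finset.Icc 1 R, ∑ k ∈ Finset.Icc 1 R,
      if d * k = r then (d : ℝ) ^ (-(5/4) : ℝ) * (1 / k) else 0 := by
    intro r hr
    unfold RRs at hr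
    rw [Finset.mem_filter, Finset.mem_Icc] at hr
    rw [lam_eq r hr.2.1, Finset.sum_div]
    have hsub : r.divisors ⊆ Finset.Icc 1 R := fun d hd => by
      rw [Finset.mem_Icc]
      exact ⟨Nat.pos_of_mem_divisors hd, (Nat.divisor_le hd).trans hr.1.2⟩
    refine le_trans ?_ (Finset.sum_le_sum_of_subset_of_nonneg hsub fun d _ _ =>
      Finset.sum_nonneg fun k _ => by split_ifs <;> positivity)
    refine Finset.sum_le_sum fun d hd => ?_
    obtain ⟨k, hk⟩ := Nat.dvd_of_mem_divisors hd
    have hd1 : 0 < d := Nat.pos_of_mem_divisors hd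
    have hk1 : 0 < k := Nat.pos_of_ne_zero fun h => by subst h; omega
    have hkR : k ≤ r := Nat.le_of_dvd (by omega) ⟨d, by rw [hk, mul_comm]⟩
    have hmem : k ∈ Finset.Icc 1 R := Finset.mem_Icc.2 ⟨hk1, by omega⟩
    refine le_trans (le_of_eq ?_) (Finset.single_le_sum (f := fun k => if d * k = r then (d : ℝ) ^ (-(5/4) : ℝ) * (1 / (k : ℝ)) else 0) (fun k _ => by split_ifs <;> positivity) hmem)
    simp only [hk, if_true]
    have hd0 : (0 : ℝ) < d := by exact_mod_cast hd1
    rw [show (-(5/4) : ℝ) = -(1/4) - 1 by norm_num, Real.rpow_sub_one hd0.ne']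
    push_cast
    field_simp
  calc ∑ r ∈ RRs B R, lam r / r ≤ ∑ r ∈ RRs B R, ∑ d ∈ Finset.Icc 1 R, ∑ k ∈ Finset.Icc 1 R,
      (if d * k = r then (d : ℝ) ^ (-(5/4) : ℝ) * (1 / k) else 0) := Finset.sum_le_sum h1
    _ = ∑ d ∈ Finset.Icc 1 R, ∑ k ∈ Finset.Icc 1 R, ∑ r ∈ RRs B R,
      (if d * k = r then (d : ℝ) ^ (-(5/4) : ℝ) * (1 / k) else 0) := by
        rw [Finset.sum_comm]
        exact Finset.sum_congr rfl fun d _ => Finset.sum_comm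
    _ ≤ ∑ d ∈ Finset.Icc 1 R, ∑ k ∈ Finset.Icc 1 R, (d : ℝ) ^ (-(5/4) : ℝ) * (1 / k) := by
        refine Finset.sum_le_sum fun d _ => Finset.sum_le_sum fun k _ => ?_
        rw [Finset.sum_ite_eq]
        split_ifs
        · exact le_rfl
        · positivity
    _ = (∑ d ∈ Finset.Icc 1 R, (d : ℝ) ^ (-(5/4) : ℝ)) * ∑ k ∈ Finset.Icc 1 R, 1 / (k : ℝ) := by
        rw [Finset.sum_mul_sum]
    _ ≤ (∑' n : ℕ, (n : ℝ) ^ (-(5/4) : ℝ) + 1) * (1 + Real.log R) := by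
        have e1 : ∑ d ∈ Finset.Icc 1 R, (d : ℝ) ^ (-(5/4) : ℝ) ≤ ∑' n : ℕ, (n : ℝ) ^ (-(5/4) : ℝ) :=
          hs.sum_le_tsum _ fun n _ => by positivity
        have e2 : ∑ k ∈ Finset.Icc 1 R, 1 / (k : ℝ) ≤ 1 + Real.log R := by
          have := harmonic_le_one_add_log R
          rw [harmonic_eq_sum_Icc] at this
          push_cast at this
          simpa using this
        have e3 : 0 ≤ ∑ k ∈ Finset.Icc 1 R, 1 / (k : ℝ) := Finset.sum_nonneg fun k _ => by positivity
        gcongr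
        linarith

/-- gcd sum -/
lemma sum_wt_le (r : ℕ) (hr : Squarefree r) (S : Finset ℕ)
    (hS : ∀ r' ∈ S, 1 ≤ r' ∧ r' ≤ 64 * r ∧ r ≤ 64 * r') : ∑ r' ∈ S, wt r r' ≤ 4096 * lam r := by
  have hr0 : 0 < r := Nat.pos_of_ne_zero hr.ne_zero
  have hrR : (0 : ℝ) < r := by exact_mod_cast hr0
  have h1 : ∀ r' ∈ S, wt r r' ≤ ∑ g ∈ r.divisors, if g ∣ r' then 64 * ((g : ℝ) / r) ^ ((3/2) : ℝ) else 0 := by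
    intro r' hr'
    have hmem : r.gcd r' ∈ r.divisors := Nat.mem_divisors.2 ⟨Nat.gcd_dvd_left _ _, hr.ne_zero⟩
    refine le_trans ?_ (Finset.single_le_sum (f := fun g => if g ∣ r' then 64 * ((g : ℝ) / r) ^ ((3/2) : ℝ) else 0)
      (fun g _ => by split_ifs <;> positivity) hmem)
    simp only [Nat.gcd_dvd_right, if_true]
    obtain ⟨a1, a2, a3⟩ := hS r' hr'
    have a1' : (0 : ℝ) < r' := by exact_mod_cast a1
    have a3' : (r : ℝ) ≤ 64 * r' := by exact_mod_cast a3
    unfold wt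
    set g : ℝ := (r.gcd r' : ℝ) with hg
    have hg0 : 0 ≤ g := by positivity
    have e1 : g ^ 2 / (r * r') ≤ 64 * (g / r) ^ 2 := by
      rw [div_pow, ← mul_div_assoc, div_le_div_iff₀ (by positivity) (by positivity)]
      have : r * r ≤ (64 * r') * (r : ℝ) := by gcongr
      nlinarith [sq_nonneg g]
    calc (g ^ 2 / (r * r')) ^ ((3/4) : ℝ) ≤ (64 * (g / r) ^ 2) ^ ((3/4) : ℝ) := by gcongr
      _ = 64 ^ ((3/4) : ℝ) * (g / r) ^ ((3/2) : ℝ) := by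
          rw [Real.mul_rpow (by norm_num) (by positivity), ← Real.rpow_natCast, ← Real.rpow_mul (by positivity)]
          norm_num
      _ ≤ 64 * (g / r) ^ ((3/2) : ℝ) := by
          gcongr
          calc (64 : ℝ) ^ ((3/4) : ℝ) ≤ 64 ^ (1 : ℝ) := Real.rpow_le_rpow_of_exponent_le (by norm_num) (by norm_num)
            _ = 64 := Real.rpow_one _
  refine (Finset.sum_le_sum h1).trans ?_
  rw [Finset.sum_comm, lam_eq r hr, Finset.mul_sum, ← Nat.sum_div_divisors r (fun d => 4096 * (d : ℝ) ^ (-(1/4) : ℝ))]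
  refine Finset.sum_le_sum fun g hg => ?_
  rw [← Finset.sum_filter, Finset.sum_const, nsmul_eq_mul]
  have hgd := Nat.dvd_of_mem_divisors hg
  have hg1 : 0 < g := Nat.pos_of_mem_divisors hg
  obtain ⟨k, hk⟩ := hgd
  have hk1 : 0 < k := Nat.pos_of_ne_zero fun h => by subst h; omega
  have hc : (S.filter fun a => g ∣ a).card ≤ 64 * k := by
    have : (S.filter fun a => g ∣ a).card ≤ (Finset.Icc 1 (64 * k)).card := by
      refine Finset.card_le_card_of_injOn (fun a => a / g) ?_ ?_
      · intro a ha
        have ha := Finset.mem_filter.1 ha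
        obtain ⟨b1, b2, b3⟩ := hS a ha.1
        obtain ⟨c, hc⟩ := ha.2
        rw [Finset.mem_coe, Finset.mem_Icc]
        show 1 ≤ a / g ∧ a / g ≤ 64 * k
        rw [hc, Nat.mul_div_cancel_left _ hg1]
        refine ⟨Nat.pos_of_ne_zero fun h => by subst h; omega, ?_⟩
        rw [hc, hk] at b2
        exact Nat.le_of_mul_le_mul_left (by linarith) hg1
      · intro a ha b hb h
        have ha := (Finset.mem_filter.1 ha).2
        have hb := (Finset.mem_filter.1 hb).2
        exact Nat.div_left_inj ha hb |>.1 h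
    simpa using this
  have hc' : ((S.filter fun a => g ∣ a).card : ℝ) ≤ 64 * k := by exact_mod_cast hc
  have hgk : r / g = k := by rw [hk, Nat.mul_div_cancel_left _ hg1]
  have hk0 : (1 : ℝ) ≤ k := by exact_mod_cast hk1
  have hg0 : (0 : ℝ) < g := by exact_mod_cast hg1
  have e : (g : ℝ) / r = (k : ℝ)⁻¹ := by rw [hk]; push_cast; field_simp
  rw [hgk, e]
  calc ((S.filter fun a => g ∣ a).card : ℝ) * (64 * ((k : ℝ)⁻¹) ^ ((3/2) : ℝ))
      ≤ (64 * k) * (64 * ((k : ℝ)⁻¹) ^ ((3/2) : ℝ)) := by gcongr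
    _ = 4096 * ((k : ℝ) ^ (1 : ℝ) * (k : ℝ) ^ (-(3/2) : ℝ)) := by
        rw [Real.inv_rpow (by positivity), Real.rpow_neg (by positivity), Real.rpow_one]; ring
    _ = 4096 * (k : ℝ) ^ (-(1/2) : ℝ) := by
        rw [← Real.rpow_add (by positivity)]; norm_num
    _ ≤ 4096 * (k : ℝ) ^ (-(1/4) : ℝ) := by
        gcongr 4096 * ?_
        exact Real.rpow_le_rpow_of_exponent_le hk0 (by norm_num)

end Numeric
end SqSieve

namespace SqSieve
open scoped Polynomial

section Core

lemma Lambda_le : ∃ C : ℝ, 0 < C ∧ ∀ (B : Finset ℕ) (Q : ℝ) (R : ℕ), 1 ≤ R → 64 ≤ Q → (R : ℝ) ^ 2 ≤ Q →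
    ∑ m ∈ MMs B Q R, lam m.2 ≤ C * Q := by
  obtain ⟨C, hC, h⟩ := sum_lam_le
  refine ⟨768 * C * 2, by positivity, fun B Q R hR hQ hRQ => ?_⟩
  classical
  rw [sum_MMs]
  have hlq : 1 ≤ Real.log Q := by
    rw [Real.le_log_iff_exp_le (by linarith)]
    have := Real.exp_one_lt_d9; linarith
  have hR1 : (1 : ℝ) ≤ R := by exact_mod_cast hR
  have hlR : Real.log R ≤ Real.log Q := Real.log_le_log (by linarith) (by nlinarith)
  calc ∑ r ∈ RRs B R, ∑ p ∈ PPs B Q r, lam r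
      ≤ ∑ r ∈ RRs B R, (768 * Q / Real.log Q) * (lam r / r) := by
        refine Finset.sum_le_sum fun r hr => ?_
        unfold RRs at hr
        rw [Finset.mem_filter, Finset.mem_Icc] at hr
        have hr0 : (0 : ℝ) < r := by exact_mod_cast hr.1.1
        rw [Finset.sum_const, nsmul_eq_mul]
        have := card_PPs_le B Q r R hr.1.1 hr.1.2 hQ hRQ
        have hl := one_le_lam r
        calc _ ≤ 768 * Q / (r * Real.log Q) * lam r := by gcongr
          _ = _ := by field_simp
    _ = (768 * Q / Real.log Q) * ∑ r ∈ RRs B R, lam r / r := by rw [Finset.mul_sum]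
    _ ≤ (768 * Q / Real.log Q) * (C * (1 + Real.log R)) := by gcongr; exact h B R hR
    _ ≤ (768 * Q / Real.log Q) * (C * (2 * Real.log Q)) := by gcongr; linarith
    _ = _ := by field_simp

lemma Delta_le (B : Finset ℕ) (Q : ℝ) (R : ℕ) :
    ∑ m ∈ MMs B Q R, ∑ m' ∈ MMs B Q R, (if m.1 = m'.1 then wt m.2 m'.2 else 0) ≤
      4096 * ∑ m ∈ MMs B Q R, lam m.2 := by
  classical
  rw [Finset.mul_sum]
  refine Finset.sum_le_sum fun m hm => ?_
  have hm' := hm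
  unfold MMs at hm'
  rw [Finset.mem_filter] at hm'
  rw [← Finset.sum_filter]
  have hinj : Set.InjOn (fun m' : ℕ × ℕ => m'.2) ((MMs B Q R).filter fun a => m.1 = a.1 : Finset (ℕ × ℕ)) := by
    intro a ha b hb h
    have ha := (Finset.mem_filter.1 ha).2
    have hb := (Finset.mem_filter.1 hb).2
    exact Prod.ext (ha.symm.trans hb) h
  rw [← Finset.sum_image (s := (MMs B Q R).filter fun a => m.1 = a.1) (g := fun m' : ℕ × ℕ => m'.2) (f := fun r' => wt m.2 r') hinj]
  refine sum_wt_le m.2 hm'.2.1.1 _ fun r' hr' => ?_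
  obtain ⟨m', hmm, rfl⟩ := Finset.mem_image.1 hr'
  rw [Finset.mem_filter] at hmm
  have h2 := hmm.1
  unfold MMs at h2
  rw [Finset.mem_filter, Finset.mem_product, Finset.mem_Icc, Finset.mem_Icc] at h2
  have a1 := hm'.2.2.2.2
  have a2 := h2.2.2.2.2
  rw [← hmm.2] at a2
  have hp : (0 : ℝ) < m.1 := by exact_mod_cast hm'.2.2.1.pos
  refine ⟨h2.1.2.1, ?_, ?_⟩
  · have : (m'.2 : ℝ) ≤ 64 * m.2 := by
      by_contra hc
      push Not at hc
      have := mul_lt_mul_of_pos_left hc hp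
      linarith
    exact_mod_cast this
  · have : (m.2 : ℝ) ≤ 64 * m'.2 := by
      by_contra hc
      push Not at hc
      have := mul_lt_mul_of_pos_left hc hp
      linarith
    exact_mod_cast this

variable {f : ℤ[X]} {D : ℕ}

lemma TT_lower (hD : Odd D) (hD3 : 3 ≤ D) (B : Finset ℕ) (Q : ℝ) (R : ℕ) (ν : ℝ)
    (hB : ∀ q : ℕ, q.Prime → q ∉ B → Good f D q ∧ (3 * locC D) ^ 4 ≤ (q : ℝ))
    (hQ : 64 ≤ Q / R) (hbn : 8 * (B.card + ν) * Real.log Q ≤ Q / R) (hν : 0 ≤ ν)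
    (x y n : ℤ) (hn : n ≠ 0) (hxy : hev f D x y = n ^ 2) (hnν : (n.natAbs.primeFactors.card : ℝ) ≤ ν) :
    ((MMs B Q R).card : ℝ) / 2 ≤ TT f D (MMs B Q R) x y := by
  classical
  have step : ∀ m ∈ MMs B Q R, 3 / 4 - (if (m.1 : ℤ) ∣ n then (1 : ℝ) else 0) ≤
      psi f D m.1 x y * fr f D m.2 x y := by
    intro m hm
    unfold MMs at hm
    rw [Finset.mem_filter] at hm
    have hfr : fr f D m.2 x y = 1 := by
      unfold fr
      refine Finset.prod_eq_one fun l hl => ?_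
      have : Fact l.Prime := ⟨Nat.prime_of_mem_primeFactors hl⟩
      exact fv_of_sq f D x y n hxy
    obtain ⟨g1, g2⟩ := hB m.1 hm.2.2.1 hm.2.2.2.1
    have h1 := psi_of_sq hD hD3 g1 x y n hxy
    have hsq : (24 * D + 100) / Real.sqrt m.1 ≤ 1 / 4 := by
      have hloc : locC D = 24 * D + 200 := rfl
      have hD0 : (0 : ℝ) ≤ D := by positivity
      have h2 : (3 * locC D) ^ 2 ≤ Real.sqrt m.1 := Real.le_sqrt_of_sq_le (by
        calc ((3 * locC D) ^ 2) ^ 2 = (3 * locC D) ^ 4 := by ring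
          _ ≤ _ := g2)
      have h3 : 4 * (24 * D + 100) ≤ (3 * locC D) ^ 2 := by rw [hloc]; nlinarith
      rw [div_le_iff₀ (by nlinarith)]
      linarith
    rw [hfr, mul_one]
    linarith
  have hsum := Finset.sum_le_sum step
  rw [← TT, Finset.sum_sub_distrib, Finset.sum_const, nsmul_eq_mul] at hsum
  have hcard : ((MMs B Q R).card : ℝ) = ∑ r ∈ RRs B R, ((PPs B Q r).card : ℝ) := by
    have := sum_MMs B Q R (fun _ => 1)
    simpa using this
  have hdiv : ∑ m ∈ MMs B Q R, (if (m.1 : ℤ) ∣ n then (1 : ℝ) else 0) ≤ ∑ r ∈ RRs B R, ((PPs B Q r).card : ℝ) / 4 := by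
    rw [sum_MMs]
    refine Finset.sum_le_sum fun r hr => ?_
    unfold RRs at hr
    rw [Finset.mem_filter, Finset.mem_Icc] at hr
    have hr0 : (0 : ℝ) < r := by exact_mod_cast hr.1.1
    have hrR : (r : ℝ) ≤ R := by exact_mod_cast hr.1.2
    have hQ64 : 64 ≤ Q := by
      have hR1 : (1 : ℝ) ≤ R := by exact_mod_cast hr.1.1.trans hr.1.2
      rw [le_div_iff₀ (by linarith)] at hQ; nlinarith
    have hlq : 0 < Real.log Q := Real.log_pos (by linarith)
    have hge := card_PPs_ge B Q r R hr.1.1 hr.1.2 hQ (by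
      have : 0 ≤ (B.card : ℝ) * Real.log Q := by positivity
      have : 0 ≤ ν * Real.log Q := by positivity
      linarith)
    have h4 : 4 * ν ≤ Q / (2 * (r * Real.log Q)) := by
      rw [le_div_iff₀ (by positivity)]
      rw [le_div_iff₀ (by linarith)] at hbn
      have : 0 ≤ (B.card : ℝ) * Real.log Q * R := by positivity
      have : ν * Real.log Q * r ≤ ν * Real.log Q * R := by gcongr
      nlinarith
    have h5 : ∑ p ∈ PPs B Q r, (if ((p, r).1 : ℤ) ∣ n then (1 : ℝ) else 0) ≤ n.natAbs.primeFactors.card := by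
      rw [Finset.sum_boole]
      have : ((PPs B Q r).filter fun p : ℕ => (p : ℤ) ∣ n) ⊆ n.natAbs.primeFactors := by
        intro p hp
        rw [Finset.mem_filter] at hp
        unfold PPs at hp
        rw [Finset.mem_filter] at hp
        exact Nat.mem_primeFactors.2 ⟨hp.1.2.1, Int.natCast_dvd.1 hp.2, by simpa using hn⟩
      exact_mod_cast Finset.card_le_card this
    linarith
  rw [← Finset.sum_div, ← hcard] at hdiv
  linarith

set_option maxHeartbeats 1000000 in
/-- The core sieve inequality. -/
theorem core (hD : Odd D) (hD3 : 3 ≤ D) : ∃ C : ℝ, 0 < C ∧ ∀ (f : ℤ[X]) (B : Finset ℕ) (Q : ℝ) (R L₁ L₂ : ℕ)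
    (ν κ h : ℝ) (Pts : Finset (ℤ × ℤ)),
    (∀ q : ℕ, q.Prime → q ∉ B → Good f D q ∧ (3 * locC D) ^ 4 ≤ (q : ℝ)) →
    1 ≤ R → (R : ℝ) ^ 2 ≤ Q → 64 ≤ Q / R → 0 ≤ ν → 8 * (B.card + ν) * Real.log Q ≤ Q / R →
    0 < κ → 0 < h → Real.log Q ≤ κ * h * ∑ r ∈ RRs B R, 1 / (r : ℝ) →
    1 ≤ L₁ → 1 ≤ L₂ → (L₂ : ℝ) ≤ (Q / R) ^ 2 →
    (R : ℝ) ^ 9 * ((L₁ : ℝ) ^ 2 + L₂ ^ 2) ≤ 2 * (L₁ ^ 2 * L₂ ^ 2) → (L₁ * L₂ : ℝ) ≤ 16 * Q ^ 3 →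
    (∀ P ∈ Pts, 2 * |(P.1 : ℝ)| ≤ L₁) → (∀ P ∈ Pts, 2 * |(P.2 : ℝ)| ≤ L₂) →
    (∀ P ∈ Pts, ∃ n : ℤ, n ≠ 0 ∧ hev f D P.1 P.2 = n ^ 2 ∧ (n.natAbs.primeFactors.card : ℝ) ≤ ν) →
    (Pts.card : ℝ) ≤ C * κ ^ 2 * h ^ 2 * Q ^ 2 := by
  classical
  obtain ⟨C₂, hC₂, hLam⟩ := Lambda_le
  refine ⟨64 * ((4 * 4096 + 8) * 16 * C₂ + 4 * (24 * D + 100) ^ 2 * 64 ^ 2 * C₂ ^ 2), by positivity, ?_⟩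
  intro f B Q R L₁ L₂ ν κ h Pts hB hR hRQ hQ hν hbn hκ hh hS hL₁ hL₂ hLQ hR9 hLL hP1 hP2 hP3
  have hR1 : (1 : ℝ) ≤ R := by exact_mod_cast hR
  have hQ64 : 64 ≤ Q := by
    rw [le_div_iff₀ (by linarith)] at hQ; nlinarith
  have hlq : 0 < Real.log Q := Real.log_pos (by linarith)
  set M := MMs B Q R with hM
  set Λ := ∑ m ∈ M, lam m.2 with hΛ
  have hΛ1 : Λ ≤ C₂ * Q := hLam B Q R hR hQ64 hRQ
  have hMΛ : (M.card : ℝ) ≤ Λ := by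
    have : ∑ m ∈ M, (1 : ℝ) ≤ Λ := Finset.sum_le_sum fun m _ => one_le_lam m.2
    simpa using this
  have hmem : ∀ m ∈ M, 1 ≤ m.2 ∧ m.2 ≤ R ∧ okr B m.2 ∧ m.1.Prime ∧ m.1 ∉ B ∧ Q < m.1 * m.2 ∧ (m.1 * m.2 : ℝ) ≤ 64 * Q := by
    intro m hm
    rw [hM] at hm
    unfold MMs at hm
    rw [Finset.mem_filter, Finset.mem_product, Finset.mem_Icc, Finset.mem_Icc] at hm
    exact ⟨hm.1.2.1, hm.1.2.2, hm.2⟩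
  have hbig : ∀ m ∈ M, Q / R ≤ m.1 := by
    intro m hm
    obtain ⟨a1, a2, a3, a4, a5, a6, a7⟩ := hmem m hm
    rw [div_le_iff₀ (by linarith)]
    have : (m.2 : ℝ) ≤ R := by exact_mod_cast a2
    nlinarith [(Nat.cast_nonneg m.1 : (0 : ℝ) ≤ m.1)]
  have hbig' : ∀ m ∈ M, Q / R < m.1 := by
    intro m hm
    obtain ⟨a1, a2, a3, a4, a5, a6, a7⟩ := hmem m hm
    rw [div_lt_iff₀ (by linarith)]
    have : (m.2 : ℝ) ≤ R := by exact_mod_cast a2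
    nlinarith [(Nat.cast_nonneg m.1 : (0 : ℝ) ≤ m.1)]
  have hup := sieve_upper (f := f) hD hD3 L₁ L₂ R M (64 * Q)
    (fun m hm => (hB _ (hmem m hm).2.2.2.1 (hmem m hm).2.2.2.2.1).1)
    (fun m hm => ⟨(hmem m hm).2.2.1.1, fun l hl =>
      hB l (Nat.prime_of_mem_primeFactors hl) ((hmem m hm).2.2.1.2 l hl)⟩)
    (fun m hm => (hmem m hm).2.1)
    (fun m hm => (hmem m hm).2.2.2.2.2.2)
    (fun m hm m' hm' => by
      have h1 := hbig' m hm
      have h2 : (m'.2 : ℝ) ≤ R := by exact_mod_cast (hmem m' hm').2.1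
      have h3 : (R : ℝ) ≤ Q / R := by rw [le_div_iff₀ (by linarith)]; nlinarith
      exact_mod_cast (h2.trans h3).trans_lt h1)
    (fun m hm m' hm' => by
      have h1 := hbig m hm
      have h2 := hbig m' hm'
      have : (L₂ : ℝ) ≤ m.1 * m'.1 := by
        calc (L₂ : ℝ) ≤ (Q / R) * (Q / R) := by rw [← sq]; exact hLQ
          _ ≤ _ := by gcongr
      exact_mod_cast this)
  have hτ : ∀ P ∈ Pts, (M.card / 2 : ℝ) ^ 2 ≤ TT f D M P.1 P.2 ^ 2 := by
    intro P hP
    obtain ⟨n, hn0, hn, hnν⟩ := hP3 P hP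
    have := TT_lower (f := f) hD hD3 B Q R ν hB hQ hbn hν P.1 P.2 n hn0 hn hnν
    gcongr
  have hlow := lower_WR L₁ L₂ (fun x y => TT f D M x y ^ 2) (fun x y => sq_nonneg _) Pts
    ((M.card / 2 : ℝ) ^ 2) (sq_nonneg _) hP1 hP2 hτ
  have hΔ := Delta_le B Q R
  rw [← hM, ← hΛ] at hΔ
  have hMge : Q / (2 * κ * h) ≤ M.card := by
    have hcard : (M.card : ℝ) = ∑ r ∈ RRs B R, ((PPs B Q r).card : ℝ) := by
      have := sum_MMs B Q R (fun _ => 1)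
      simpa using this
    have h1 : ∑ r ∈ RRs B R, Q / (2 * Real.log Q) * (1 / r) ≤ M.card := by
      rw [hcard]
      refine Finset.sum_le_sum fun r hr => ?_
      unfold RRs at hr
      rw [Finset.mem_filter, Finset.mem_Icc] at hr
      have hr0 : (0 : ℝ) < r := by exact_mod_cast hr.1.1
      have hge := card_PPs_ge B Q r R hr.1.1 hr.1.2 hQ (by
        have : 0 ≤ (B.card : ℝ) * Real.log Q := by positivity
        have : 0 ≤ ν * Real.log Q := by positivity
        linarith)
      refine le_trans (le_of_eq ?_) hge
      field_simp
    rw [← Finset.mul_sum] at h1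
    refine le_trans ?_ h1
    rw [div_mul_eq_mul_div, div_le_div_iff₀ (by positivity) (by positivity)]
    have := mul_le_mul_of_nonneg_left hS (by linarith : 0 ≤ 2 * Q)
    nlinarith
  have hL1 : (1 : ℝ) ≤ L₁ := by exact_mod_cast hL₁
  have hL2 : (1 : ℝ) ≤ L₂ := by exact_mod_cast hL₂
  set Lp : ℝ := L₁ * L₂ with hLp
  have hLp0 : 0 < Lp := by positivity
  set A : ℝ := 24 * D + 100 with hA
  have hmain : (Pts.card : ℝ) * (M.card : ℝ) ^ 2 ≤ 16 * ((4 * 4096 + 8) * 16 * C₂ + 4 * A ^ 2 * 64 ^ 2 * C₂ ^ 2) * Q ^ 4 := by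
    have hΛ0 : 0 ≤ Λ := le_trans (by positivity) hMΛ
    have hc0 : (0 : ℝ) ≤ M.card := by positivity
    have e1 : Lp * ((Pts.card : ℝ) * (M.card : ℝ) ^ 2 / 16) ≤
        Lp * ((4 * 4096 + 8) * Lp * Λ + 4 * A ^ 2 * (64 * Q) ^ 2 * Λ ^ 2) := by
      calc Lp * ((Pts.card : ℝ) * (M.card : ℝ) ^ 2 / 16)
          = Pts.card * ((L₁ : ℝ) / 2 * (L₂ / 2)) * ((M.card / 2 : ℝ) ^ 2) := by rw [hLp]; ring
        _ ≤ _ := hlow.trans hup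
        _ ≤ 4 * (L₁ ^ 2 * L₂ ^ 2) * (4096 * Λ) + 4 * (2 * (L₁ ^ 2 * L₂ ^ 2)) * Λ +
            4 * A ^ 2 * (L₁ * L₂) * (64 * Q) ^ 2 * Λ ^ 2 := by
            have t1 := mul_le_mul_of_nonneg_left hΔ (by positivity : (0 : ℝ) ≤ 4 * (L₁ ^ 2 * L₂ ^ 2))
            have t2 : 4 * (R : ℝ) ^ 9 * ((L₁ : ℝ) ^ 2 + L₂ ^ 2) * M.card ≤ 4 * (2 * (L₁ ^ 2 * L₂ ^ 2)) * Λ := by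
              calc 4 * (R : ℝ) ^ 9 * ((L₁ : ℝ) ^ 2 + L₂ ^ 2) * M.card = 4 * ((R : ℝ) ^ 9 * ((L₁ : ℝ) ^ 2 + L₂ ^ 2)) * M.card := by ring
                _ ≤ _ := by gcongr
            linarith
        _ = _ := by rw [hLp]; ring
    have e2 := le_of_mul_le_mul_left e1 hLp0
    have e3 : (4 * 4096 + 8) * Lp * Λ + 4 * A ^ 2 * (64 * Q) ^ 2 * Λ ^ 2 ≤
        (4 * 4096 + 8) * (16 * Q ^ 3) * (C₂ * Q) + 4 * A ^ 2 * (64 * Q) ^ 2 * (C₂ * Q) ^ 2 := by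
      have t1 : Λ ^ 2 ≤ (C₂ * Q) ^ 2 := pow_le_pow_left₀ hΛ0 hΛ1 2
      have t2 : Lp * Λ ≤ (16 * Q ^ 3) * (C₂ * Q) := mul_le_mul hLL hΛ1 hΛ0 (by positivity)
      have t3 := mul_le_mul_of_nonneg_left t1 (by positivity : 0 ≤ 4 * A ^ 2 * (64 * Q) ^ 2)
      linarith
    have e4 : (4 * 4096 + 8) * (16 * Q ^ 3) * (C₂ * Q) + 4 * A ^ 2 * (64 * Q) ^ 2 * (C₂ * Q) ^ 2 =
      ((4 * 4096 + 8) * 16 * C₂ + 4 * A ^ 2 * 64 ^ 2 * C₂ ^ 2) * Q ^ 4 := by ring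
    linarith
  have hq : (Q / (2 * κ * h)) ^ 2 ≤ (M.card : ℝ) ^ 2 := by gcongr
  have h9 : (Pts.card : ℝ) * (Q / (2 * κ * h)) ^ 2 ≤ 16 * ((4 * 4096 + 8) * 16 * C₂ + 4 * A ^ 2 * 64 ^ 2 * C₂ ^ 2) * Q ^ 4 :=
    (mul_le_mul_of_nonneg_left hq (by positivity)).trans hmain
  rw [div_pow, ← mul_div_assoc, div_le_iff₀ (by positivity)] at h9
  have hQ2 : 0 < Q ^ 2 := by positivity
  refine le_of_mul_le_mul_right ?_ hQ2
  refine h9.trans (le_of_eq ?_)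
  ring

end Core
end SqSieve

namespace SqSieve
open scoped Polynomial

section Reduction

lemma coeff_le_polyNorm (F : MvPolynomial (Fin 2) ℤ) (d : Fin 2 →₀ ℕ) :
    (F.coeff d).natAbs ≤ polyNorm F := by
  by_cases h : d ∈ F.support
  · exact Finset.le_sup (f := fun d => (F.coeff d).natAbs) h
  · rw [MvPolynomial.notMem_support_iff] at h
    simp [h]

lemma polyNorm_pos (F : MvPolynomial (Fin 2) ℤ) (hF : F ≠ 0) : 1 ≤ polyNorm F := by
  obtain ⟨d, hd⟩ := MvPolynomial.ne_zero_iff.1 hF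
  have := coeff_le_polyNorm F d
  have : 0 < (F.coeff d).natAbs := Int.natAbs_pos.2 hd
  omega

/-- dehomogenization -/
noncomputable def deh (F : MvPolynomial (Fin 2) ℤ) (D : ℕ) : ℤ[X] :=
  ∑ i ∈ Finset.range (D + 1), Polynomial.monomial i (F.coeff (fun₀ | 0 => i | 1 => D - i))

lemma deh_coeff (F : MvPolynomial (Fin 2) ℤ) (D i : ℕ) :
    (deh F D).coeff i = if i ≤ D then F.coeff (fun₀ | 0 => i | 1 => D - i) else 0 := by
  unfold deh
  rw [Polynomial.finsetSum_coeff]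
  simp only [Polynomial.coeff_monomial]
  rw [Finset.sum_ite_eq']
  simp

lemma deh_natDegree (F : MvPolynomial (Fin 2) ℤ) (D : ℕ) : (deh F D).natDegree ≤ D := by
  rw [Polynomial.natDegree_le_iff_coeff_eq_zero]
  intro i hi
  rw [deh_coeff, if_neg (by omega)]

lemma deh_hom (F : MvPolynomial (Fin 2) ℤ) (D : ℕ) (hF : F.IsHomogeneous D) :
    (deh F D).homogenize D = F := by
  ext m
  rw [Polynomial.coeff_homogenize]
  split_ifs with h
  · rw [deh_coeff, if_pos (by omega)]
    congr 1
    ext i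
    fin_cases i
    · simp
    · simp; omega
  · symm
    apply hF.coeff_eq_zero
    rw [Finsupp.degree_eq_sum]
    simpa using h

lemma eval_eq_hev (F : MvPolynomial (Fin 2) ℤ) (D : ℕ) (hF : F.IsHomogeneous D) (x y : ℤ) :
    MvPolynomial.eval ![x, y] F = hev (deh F D) D x y := by
  conv_lhs => rw [← deh_hom F D hF]
  unfold Polynomial.homogenize hev
  rw [MvPolynomial.eval_sum, Finset.Nat.sum_antidiagonal_eq_sum_range_succ_mk]
  refine Finset.sum_congr rfl fun i _ => ?_
  rw [MvPolynomial.eval_monomial, Finsupp.prod_fintype _ _ (by simp)]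
  simp
  ring

lemma deh_coeff_le (F : MvPolynomial (Fin 2) ℤ) (D i : ℕ) : |(deh F D).coeff i| ≤ (polyNorm F : ℤ) := by
  rw [deh_coeff]
  split_ifs
  · rw [Int.abs_eq_natAbs]; exact_mod_cast coeff_le_polyNorm F _
  · simp

lemma deh_ne_zero (F : MvPolynomial (Fin 2) ℤ) (D : ℕ) (hF : F.IsHomogeneous D) (h0 : F ≠ 0) :
    deh F D ≠ 0 := by
  intro h
  have := deh_hom F D hF
  rw [h] at this
  simp at this
  exact h0 this.symm

lemma deh_squarefree (F : MvPolynomial (Fin 2) ℤ) (D : ℕ) (hF : F.IsHomogeneous D) (h0 : F ≠ 0)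
    (hsq : Squarefree (MvPolynomial.map (Int.castRingHom ℚ) F)) :
    Squarefree ((deh F D).map (Int.castRingHom ℚ)) ∧ D ≤ (deh F D).natDegree + 1 := by
  set g := (deh F D).map (Int.castRingHom ℚ) with hg
  have hinj : Function.Injective (Int.castRingHom ℚ) := Int.cast_injective
  have hgF : g.homogenize D = MvPolynomial.map (Int.castRingHom ℚ) F := by
    rw [hg, Polynomial.homogenize_map, deh_hom F D hF]
  have hgd : g.natDegree = (deh F D).natDegree := Polynomial.natDegree_map_eq_of_injective hinj _
  have hgD : g.natDegree ≤ D := by rw [hgd]; exact deh_natDegree F D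
  have hg0 : g ≠ 0 := by
    rw [hg, Ne, Polynomial.map_eq_zero_iff hinj]; exact deh_ne_zero F D hF h0
  rw [← hgF] at hsq
  constructor
  · rintro p ⟨r, hr⟩
    have hp0 : p ≠ 0 := by rintro rfl; simp at hr; exact hg0 hr
    have hr0 : r ≠ 0 := by rintro rfl; simp at hr; exact hg0 hr
    have hdeg : g.natDegree = p.natDegree + p.natDegree + r.natDegree := by
      rw [hr, Polynomial.natDegree_mul (mul_ne_zero hp0 hp0) hr0, Polynomial.natDegree_mul hp0 hp0]
    have hfac : g.homogenize D = p.homogenize p.natDegree * p.homogenize p.natDegree *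
        r.homogenize (D - (p.natDegree + p.natDegree)) := by
      rw [← Polynomial.homogenize_mul p p le_rfl le_rfl,
        ← Polynomial.homogenize_mul (p * p) r (by rw [Polynomial.natDegree_mul hp0 hp0]) (by omega), ← hr]
      congr 1; omega
    have hu := hsq _ ⟨_, hfac⟩
    have := hu.map (MvPolynomial.aeval (R := ℚ) ![(Polynomial.X : ℚ[X]), 1])
    rwa [Polynomial.aeval_homogenize_X_one p le_rfl] at this
  · by_contra hlt
    rw [← hgd] at hlt
    have hfac : g.homogenize D = (1 : ℚ[X]).homogenize 1 * (1 : ℚ[X]).homogenize 1 * g.homogenize (D - 2) := by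
      rw [← Polynomial.homogenize_mul (1 : ℚ[X]) 1 (by simp) (by simp),
        ← Polynomial.homogenize_mul (1 * 1 : ℚ[X]) g (by simp) (by omega)]
      simp only [one_mul]
      congr 1; omega
    have hu := hsq _ ⟨_, hfac⟩
    have := hu.map (MvPolynomial.eval (R := ℚ) ![(0 : ℚ), 0])
    simp at this

/-- the bad number -/
noncomputable def badN (f : ℤ[X]) : ℤ := f.leadingCoeff * f.resultant f.derivative

lemma badN_ne_zero (f : ℤ[X]) (hf : f ≠ 0) (hsq : Squarefree (f.map (Int.castRingHom ℚ))) : badN f ≠ 0 := by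
  have hinj : Function.Injective (Int.castRingHom ℚ) := Int.cast_injective
  refine mul_ne_zero (Polynomial.leadingCoeff_ne_zero.2 hf) fun h => ?_
  have hsep : (f.map (Int.castRingHom ℚ)).Separable := PerfectField.separable_iff_squarefree.2 hsq
  have h1 := Polynomial.resultant_ne_zero _ _ hsep
  rw [Polynomial.derivative_map, Polynomial.natDegree_map_eq_of_injective hinj,
    Polynomial.natDegree_map_eq_of_injective hinj, Polynomial.resultant_map_map, h] at h1
  simp at h1

lemma good_of_not_dvd (f : ℤ[X]) (D q : ℕ) (hD3 : 3 ≤ D) (hq : q.Prime) (hq2 : q ≠ 2) (hle : f.natDegree ≤ D)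
    (hge : D ≤ f.natDegree + 1) (hb : ¬ (q : ℤ) ∣ badN f) : Good f D q := by
  have : Fact q.Prime := ⟨hq⟩
  have h1 : ((f.leadingCoeff : ℤ) : ZMod q) ≠ 0 := fun h =>
    hb (((ZMod.intCast_zmod_eq_zero_iff_dvd _ q).1 h).mul_right _)
  have h2 : ((f.resultant f.derivative : ℤ) : ZMod q) ≠ 0 := fun h =>
    hb (((ZMod.intCast_zmod_eq_zero_iff_dvd _ q).1 h).mul_left _)
  have hd : (f.map (Int.castRingHom (ZMod q))).natDegree = f.natDegree :=
    Polynomial.natDegree_map_of_leadingCoeff_ne_zero _ h1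
  refine ⟨hq, hq2, ⟨?_, by omega, by omega⟩⟩
  obtain ⟨a, b, -, -, e⟩ := Polynomial.exists_mul_add_mul_eq_C_resultant f f.derivative le_rfl le_rfl
    (Or.inl (by omega))
  have e' := congrArg (Polynomial.map (Int.castRingHom (ZMod q))) e
  rw [Polynomial.map_add, Polynomial.map_mul, Polynomial.map_mul, ← Polynomial.derivative_map,
    Polynomial.map_C] at e'
  set c : ZMod q := Int.castRingHom (ZMod q) (f.resultant f.derivative) with hc
  have hc0 : c ≠ 0 := h2
  refine ⟨Polynomial.C c⁻¹ * a.map (Int.castRingHom (ZMod q)),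
    Polynomial.C c⁻¹ * b.map (Int.castRingHom (ZMod q)), ?_⟩
  calc _ = Polynomial.C c⁻¹ * (f.map (Int.castRingHom (ZMod q)) * a.map (Int.castRingHom (ZMod q)) +
        Polynomial.derivative (f.map (Int.castRingHom (ZMod q))) * b.map (Int.castRingHom (ZMod q))) := by ring
    _ = 1 := by rw [e', ← Polynomial.C_mul, inv_mul_cancel₀ hc0, Polynomial.C_1]

lemma card_primeFactors_le (n : ℕ) (hn : n ≠ 0) : (n.primeFactors.card : ℝ) ≤ 2 * Real.log n := by
  have h1 : 2 ^ n.primeFactors.card ≤ n := by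
    calc 2 ^ n.primeFactors.card = ∏ p ∈ n.primeFactors, 2 := by simp
      _ ≤ ∏ p ∈ n.primeFactors, p := Finset.prod_le_prod' fun p hp => (Nat.prime_of_mem_primeFactors hp).two_le
      _ ≤ n := Nat.le_of_dvd (Nat.pos_of_ne_zero hn) (Nat.prod_primeFactors_dvd n)
  have h2 : ((2 : ℝ) ^ n.primeFactors.card) ≤ n := by exact_mod_cast h1
  have h3 := Real.log_le_log (by positivity) h2
  rw [Real.log_pow] at h3
  have := Real.log_two_gt_d9
  nlinarith [(Nat.cast_nonneg n.primeFactors.card : (0 : ℝ) ≤ n.primeFactors.card)]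

lemma badN_le (f : ℤ[X]) (D : ℕ) (N : ℤ) (hN : 1 ≤ N) (hD : 1 ≤ D) (hdeg : f.natDegree ≤ D) (hf : ∀ i, |f.coeff i| ≤ N) :
    |badN f| ≤ N * ((2 * D).factorial * (D * N) ^ (2 * D)) := by
  unfold badN
  rw [abs_mul]
  have hDN : 1 ≤ (D : ℤ) * N := by
    have : (1 : ℤ) ≤ D := by exact_mod_cast hD
    nlinarith
  have hNDN : N ≤ (D : ℤ) * N := by
    have : (1 : ℤ) ≤ D := by exact_mod_cast hD
    nlinarith
  have hder : ∀ i, |f.derivative.coeff i| ≤ (D : ℤ) * N := by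
    intro i
    rw [Polynomial.coeff_derivative, abs_mul]
    by_cases h : i + 1 ≤ D
    · have h1 : |((i : ℤ) + 1)| ≤ D := by rw [abs_of_nonneg (by positivity)]; exact_mod_cast h
      rw [mul_comm]
      exact mul_le_mul h1 (hf _) (abs_nonneg _) (by positivity)
    · rw [Polynomial.coeff_eq_zero_of_natDegree_lt (by omega)]
      simp; positivity
  refine mul_le_mul (hf _) ?_ (abs_nonneg _) (by omega)
  have hent : ∀ i j, AbsoluteValue.abs (Polynomial.sylvester f f.derivative f.natDegree f.derivative.natDegree i j) ≤ (D : ℤ) * N := by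
    intro i j
    show |_| ≤ _
    unfold Polynomial.sylvester
    rw [Matrix.of_apply]
    refine Fin.addCases (fun j₁ => ?_) (fun j₁ => ?_) j
    · rw [Fin.addCases_left]
      split_ifs
      · exact hder _
      · simp; omega
    · rw [Fin.addCases_right]
      split_ifs
      · exact (hf _).trans hNDN
      · simp; omega
  have h := Matrix.det_le hent
  rw [Fintype.card_fin] at h
  have hcard : f.natDegree + f.derivative.natDegree ≤ 2 * D := by
    have := Polynomial.natDegree_derivative_le f
    omega
  refine (show |f.resultant f.derivative| ≤ _ from h).trans ?_
  rw [nsmul_eq_mul]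
  have h1 : ((f.natDegree + f.derivative.natDegree).factorial : ℤ) ≤ (2 * D).factorial := by
    exact_mod_cast Nat.factorial_le hcard
  have h2 : ((D : ℤ) * N) ^ (f.natDegree + f.derivative.natDegree) ≤ (D * N) ^ (2 * D) :=
    pow_le_pow_right₀ hDN hcard
  exact mul_le_mul h1 h2 (by positivity) (by positivity)

lemma log_two_mul_ge (N : ℕ) (hN : 1 ≤ N) : 1 ≤ 2 * Real.log (2 * N) ∧ Real.log N ≤ Real.log (2 * N) := by
  have hN1 : (1 : ℝ) ≤ N := by exact_mod_cast hN
  have h1 : Real.log 2 ≤ Real.log (2 * N) := Real.log_le_log (by norm_num) (by linarith)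
  have := Real.log_two_gt_d9
  exact ⟨by linarith, Real.log_le_log (by linarith) (by linarith)⟩

theorem reduction (D : ℕ) (hD3 : 3 ≤ D) : ∃ C : ℝ, 0 < C ∧ ∀ F : MvPolynomial (Fin 2) ℤ, F ≠ 0 →
    F.IsHomogeneous D → Squarefree (MvPolynomial.map (Int.castRingHom ℚ) F) →
    ∃ B : Finset ℕ, (∀ q : ℕ, q.Prime → q ∉ B → Good (deh F D) D q ∧ (3 * locC D) ^ 4 ≤ (q : ℝ)) ∧
      (B.card : ℝ) ≤ C * Real.log (2 * polyNorm F) := by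
  have hD0 : (3 : ℝ) ≤ D := by exact_mod_cast hD3
  have hlD : 0 ≤ Real.log D := Real.log_natCast_nonneg D
  set P0 : ℕ := ⌈(3 * locC D) ^ 4⌉₊ with hP0
  set c1 : ℝ := Real.log ((2 * D).factorial) + 2 * D * Real.log D with hc1
  have hc10 : 0 ≤ c1 := by
    have : 0 ≤ Real.log ((2 * D).factorial : ℕ) := Real.log_natCast_nonneg _
    positivity
  refine ⟨2 * (2 * c1 + P0 + 3) + 2 * (2 * D + 1), by positivity, fun F hF0 hF hsq => ?_⟩
  set f := deh F D with hf
  set N := polyNorm F with hN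
  have hN1 : 1 ≤ N := polyNorm_pos F hF0
  have hf0 := deh_ne_zero F D hF hF0
  obtain ⟨hs1, hs2⟩ := deh_squarefree F D hF hF0 hsq
  have hbad := badN_ne_zero f hf0 hs1
  refine ⟨(badN f).natAbs.primeFactors ∪ (Finset.range (P0 + 3)), ?_, ?_⟩
  · intro q hq hqB
    rw [Finset.mem_union, not_or, Finset.mem_range] at hqB
    refine ⟨good_of_not_dvd f D q hD3 hq (by omega) (deh_natDegree F D) hs2 fun h => ?_, ?_⟩
    · exact hqB.1 (Nat.mem_primeFactors.2 ⟨hq, Int.natCast_dvd.1 h, by simpa using hbad⟩)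
    · refine (Nat.le_ceil _).trans ?_
      rw [← hP0]
      exact_mod_cast (by omega : P0 ≤ q)
  · obtain ⟨g1, g2⟩ := log_two_mul_ge N hN1
    have hNr : (1 : ℝ) ≤ N := by exact_mod_cast hN1
    have hcard : (((badN f).natAbs.primeFactors ∪ (Finset.range (P0 + 3))).card : ℝ) ≤
        (badN f).natAbs.primeFactors.card + (P0 + 3 : ℝ) := by
      have := Finset.card_union_le (badN f).natAbs.primeFactors (Finset.range (P0 + 3))
      rw [Finset.card_range] at this
      exact_mod_cast this
    have h1 := card_primeFactors_le (badN f).natAbs (by simpa using hbad)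
    have h2 := badN_le f D N (by exact_mod_cast hN1) (by omega) (deh_natDegree F D) (deh_coeff_le F D)
    have h3 : (((badN f).natAbs : ℕ) : ℝ) ≤ N * ((2 * D).factorial * (D * N) ^ (2 * D)) := by
      rw [Int.abs_eq_natAbs] at h2; exact_mod_cast h2
    have h4 : Real.log (badN f).natAbs ≤ c1 + (2 * D + 1) * Real.log N := by
      refine (Real.log_le_log (by exact_mod_cast Int.natAbs_pos.2 hbad) h3).trans (le_of_eq ?_)
      have hfac : ((2 * D).factorial : ℝ) ≠ 0 := by exact_mod_cast (Nat.factorial_ne_zero _)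
      rw [Real.log_mul (by positivity) (by positivity), Real.log_mul hfac (by positivity), Real.log_pow,
        Real.log_mul (by positivity) (by positivity), hc1]
      push_cast
      ring
    have h5 : (2 * D + 1) * Real.log N ≤ (2 * D + 1) * Real.log (2 * N) := by gcongr
    have h6 : (2 * c1 + P0 + 3) * 1 ≤ (2 * c1 + P0 + 3) * (2 * Real.log (2 * N)) := by gcongr
    linarith

lemma nu_bound (D : ℕ) (hD3 : 3 ≤ D) : ∃ C : ℝ, 0 < C ∧ ∀ F : MvPolynomial (Fin 2) ℤ, F ≠ 0 →
    ∀ (U : ℝ), 1 ≤ U → ∀ x y n : ℤ, |(x : ℝ)| ≤ U → |(y : ℝ)| ≤ U → n ≠ 0 →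
    hev (deh F D) D x y = n ^ 2 →
    (n.natAbs.primeFactors.card : ℝ) ≤ C * (Real.log (2 * polyNorm F) + Real.log U) := by
  have hD0 : (3 : ℝ) ≤ D := by exact_mod_cast hD3
  have hl : 0 ≤ Real.log (D + 1) := Real.log_nonneg (by linarith)
  refine ⟨2 * Real.log (D + 1) + 1 + D, by positivity, fun F hF0 U hU x y n hx hy hn h => ?_⟩
  set N := polyNorm F with hN
  have hN1 : 1 ≤ N := polyNorm_pos F hF0
  have hNr : (1 : ℝ) ≤ N := by exact_mod_cast hN1
  obtain ⟨g1, g2⟩ := log_two_mul_ge N hN1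
  have hlU : 0 ≤ Real.log U := Real.log_nonneg hU
  have h1 : |((hev (deh F D) D x y : ℤ) : ℝ)| ≤ (D + 1) * (N * U ^ D) := by
    unfold hev
    push_cast
    refine (Finset.abs_sum_le_sum_abs _ _).trans ?_
    have : ∀ i ∈ Finset.range (D + 1), |(((deh F D).coeff i : ℤ) : ℝ) * (x : ℝ) ^ i * (y : ℝ) ^ (D - i)| ≤ N * U ^ D := by
      intro i hi
      rw [Finset.mem_range] at hi
      rw [abs_mul, abs_mul, abs_pow, abs_pow, mul_assoc]
      have a1 : |(((deh F D).coeff i : ℤ) : ℝ)| ≤ N := by exact_mod_cast deh_coeff_le F D i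
      have a2 : |(x : ℝ)| ^ i * |(y : ℝ)| ^ (D - i) ≤ U ^ D := by
        calc |(x : ℝ)| ^ i * |(y : ℝ)| ^ (D - i) ≤ U ^ i * U ^ (D - i) := by gcongr
          _ = U ^ D := by rw [← pow_add]; congr 1; omega
      gcongr
    refine (Finset.sum_le_sum this).trans ?_
    simp
  rw [h] at h1
  have hn2 : |((n ^ 2 : ℤ) : ℝ)| = (n.natAbs : ℝ) ^ 2 := by
    rw [← Int.cast_abs, abs_pow, Nat.cast_natAbs]; push_cast; ring
  rw [hn2] at h1
  have hn1 : (0 : ℝ) < n.natAbs := by exact_mod_cast Int.natAbs_pos.2 hn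
  have h2 := Real.log_le_log (by positivity) h1
  rw [Real.log_pow, Real.log_mul (by positivity) (by positivity), Real.log_mul (by positivity) (by positivity),
    Real.log_pow] at h2
  have h3 := card_primeFactors_le n.natAbs (by simpa using hn)
  push_cast at h2
  have h4 : Real.log (D + 1) * 1 ≤ Real.log (D + 1) * (2 * Real.log (2 * N)) := by gcongr
  have h5 : 0 ≤ (D : ℝ) * Real.log (2 * N) := by
    have : 0 ≤ Real.log (2 * N) := by linarith
    positivity
  have h6 : 0 ≤ Real.log (D + 1) * Real.log U := by positivity
  nlinarith

/-- swap of variables -/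
noncomputable def swp (F : MvPolynomial (Fin 2) ℤ) : MvPolynomial (Fin 2) ℤ :=
  MvPolynomial.rename (Equiv.swap (0 : Fin 2) 1) F

lemma swp_eval (F : MvPolynomial (Fin 2) ℤ) (x y : ℤ) :
    MvPolynomial.eval ![x, y] (swp F) = MvPolynomial.eval ![y, x] F := by
  unfold swp
  rw [MvPolynomial.eval_rename]
  congr 2
  ext i
  fin_cases i <;> simp

lemma swp_ne (F : MvPolynomial (Fin 2) ℤ) (h : F ≠ 0) : swp F ≠ 0 := by
  unfold swp
  intro h0
  exact h (MvPolynomial.rename_injective _ (Equiv.injective _) (by rw [h0, map_zero]))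

lemma swp_hom (F : MvPolynomial (Fin 2) ℤ) (D : ℕ) (h : F.IsHomogeneous D) : (swp F).IsHomogeneous D :=
  h.rename_isHomogeneous

lemma swp_sq (F : MvPolynomial (Fin 2) ℤ) (h : Squarefree (MvPolynomial.map (Int.castRingHom ℚ) F)) :
    Squarefree (MvPolynomial.map (Int.castRingHom ℚ) (swp F)) := by
  unfold swp
  rw [MvPolynomial.map_rename]
  set e := MvPolynomial.renameEquiv ℚ (Equiv.swap (0 : Fin 2) 1) with he
  change Squarefree (e (MvPolynomial.map (Int.castRingHom ℚ) F))
  intro x hx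
  have h1 : e.symm x * e.symm x ∣ MvPolynomial.map (Int.castRingHom ℚ) F := by
    have := map_dvd e.symm hx
    rwa [map_mul, AlgEquiv.symm_apply_apply] at this
  have h2 := (h _ h1).map e
  rwa [AlgEquiv.apply_symm_apply] at h2

lemma swp_norm (F : MvPolynomial (Fin 2) ℤ) : polyNorm (swp F) = polyNorm F := by
  have key : ∀ F : MvPolynomial (Fin 2) ℤ, polyNorm (swp F) ≤ polyNorm F := by
    intro F
    unfold polyNorm
    refine Finset.sup_le fun d hd => ?_
    unfold swp at hd ⊢
    obtain ⟨u, hu, hu2⟩ := MvPolynomial.coeff_rename_ne_zero _ _ _ (MvPolynomial.mem_support_iff.1 hd)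
    rw [← hu, MvPolynomial.coeff_rename_mapDomain _ (Equiv.injective _)]
    exact coeff_le_polyNorm F u
  refine le_antisymm (key F) ?_
  have h := key (swp F)
  have : swp (swp F) = F := by
    unfold swp
    rw [MvPolynomial.rename_rename]
    have : ((Equiv.swap (0 : Fin 2) 1) ∘ (Equiv.swap (0 : Fin 2) 1) : Fin 2 → Fin 2) = id := by
      ext i; simp
    rw [this]; simp
  rwa [this] at h

end Reduction
end SqSieve

namespace SqSieve
open scoped Polynomial
section

/-- the set of points counted -/
def PtSet (F : MvPolynomial (Fin 2) ℤ) (U V : ℝ) : Set (ℤ × ℤ) :=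
  {p : ℤ × ℤ | (|p.1| : ℝ) ≤ U ∧ (|p.2| : ℝ) ≤ V ∧ ∃ n : ℤ, n ≠ 0 ∧ MvPolynomial.eval ![p.1, p.2] F = n ^ 2}

lemma ptset_subset (F : MvPolynomial (Fin 2) ℤ) (U V : ℝ) :
    PtSet F U V ⊆ ((Finset.Icc (-⌊U⌋) ⌊U⌋ ×ˢ Finset.Icc (-⌊V⌋) ⌊V⌋ : Finset (ℤ × ℤ)) : Set (ℤ × ℤ)) := by
  rintro ⟨x, y⟩ ⟨h1, h2, -⟩
  have a1 := abs_le.1 (Int.le_floor.2 (by exact_mod_cast h1 : ((|x| : ℤ) : ℝ) ≤ U))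
  have a2 := abs_le.1 (Int.le_floor.2 (by exact_mod_cast h2 : ((|y| : ℤ) : ℝ) ≤ V))
  simp only [Finset.coe_product, Finset.coe_Icc, Set.mem_prod, Set.mem_Icc]
  exact ⟨a1, a2⟩

lemma ptset_finite (F : MvPolynomial (Fin 2) ℤ) (U V : ℝ) : (PtSet F U V).Finite :=
  (Finset.finite_toSet _).subset (ptset_subset F U V)

lemma ptset_triv (F : MvPolynomial (Fin 2) ℤ) (U V : ℝ) (hU : 1 ≤ U) (hV : 1 ≤ V) :
    ((PtSet F U V).ncard : ℝ) ≤ 9 * (U * V) := by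
  have h := Set.ncard_le_ncard (ptset_subset F U V) (Finset.finite_toSet _)
  rw [Set.ncard_coe_finset, Finset.card_product] at h
  have key : ∀ W : ℝ, 1 ≤ W → ((Finset.Icc (-⌊W⌋) ⌊W⌋).card : ℝ) ≤ 3 * W := by
    intro W hW
    have h0 : (0 : ℤ) ≤ ⌊W⌋ := Int.floor_nonneg.2 (by linarith)
    have h1 : ((Finset.Icc (-⌊W⌋) ⌊W⌋).card : ℤ) = 2 * ⌊W⌋ + 1 := by
      rw [Int.card_Icc]; omega
    have h2 : ((Finset.Icc (-⌊W⌋) ⌊W⌋).card : ℝ) = 2 * (⌊W⌋ : ℝ) + 1 := by exact_mod_cast h1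
    rw [h2]
    linarith [Int.floor_le W]
  have h' : ((PtSet F U V).ncard : ℝ) ≤ ((Finset.Icc (-⌊U⌋) ⌊U⌋).card : ℝ) * ((Finset.Icc (-⌊V⌋) ⌊V⌋).card : ℝ) := by
    exact_mod_cast h
  calc _ ≤ _ := h'
    _ ≤ (3 * U) * (3 * V) := mul_le_mul (key U hU) (key V hV) (by positivity) (by positivity)
    _ = _ := by ring

lemma ptset_mono (F : MvPolynomial (Fin 2) ℤ) (U V V' : ℝ) (h : V ≤ V') :
    ((PtSet F U V).ncard : ℝ) ≤ (PtSet F U V').ncard := by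
  have hs : PtSet F U V ⊆ PtSet F U V' := fun p hp => ⟨hp.1, hp.2.1.trans h, hp.2.2⟩
  exact_mod_cast Set.ncard_le_ncard hs (ptset_finite F U V')

lemma ptset_swp (F : MvPolynomial (Fin 2) ℤ) (U V : ℝ) :
    (PtSet F U V).ncard = (PtSet (swp F) V U).ncard := by
  rw [← Set.ncard_image_of_injective (PtSet F U V) Prod.swap_injective]
  congr 1
  ext ⟨x, y⟩
  constructor
  · rintro ⟨⟨a, b⟩, ⟨h1, h2, h3⟩, e⟩
    simp only [Prod.swap_prod_mk, Prod.mk.injEq] at e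
    obtain ⟨rfl, rfl⟩ := e
    exact ⟨h2, h1, by rw [swp_eval]; exact h3⟩
  · rintro ⟨h1, h2, h3⟩
    rw [swp_eval] at h3
    exact ⟨⟨y, x⟩, ⟨h2, h1, h3⟩, rfl⟩

lemma prep (D : ℕ) (hD3 : 3 ≤ D) (hodd : Odd D) : ∃ C K : ℝ, 0 < C ∧ 1 ≤ K ∧
    ∀ F : MvPolynomial (Fin 2) ℤ, F ≠ 0 → F.IsHomogeneous D →
    Squarefree (MvPolynomial.map (Int.castRingHom ℚ) F) → ∀ (U V Q κ : ℝ) (R : ℕ),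
    1 ≤ V → V ≤ U → 1 ≤ Q → Q ^ 3 = U * V → 1 ≤ R → (R : ℝ) ^ 2 ≤ Q → 64 ≤ Q / R →
    K * (Real.log (2 * polyNorm F) + Real.log U) * Real.log Q ≤ Q / R → 0 < κ →
    (∀ B : Finset ℕ, (B.card : ℝ) ≤ K * Real.log (2 * polyNorm F) →
      Real.log Q ≤ κ * Real.log (2 * polyNorm F) * ∑ r ∈ RRs B R, 1 / (r : ℝ)) →
    4 * V ≤ (Q / R) ^ 2 → (R : ℝ) ^ 9 ≤ V ^ 2 →
    ((PtSet F U V).ncard : ℝ) ≤ C * κ ^ 2 * Real.log (2 * polyNorm F) ^ 2 * Q ^ 2 := by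
  obtain ⟨C, hC, hcore⟩ := core hodd hD3
  obtain ⟨Cb, hCb, hred⟩ := reduction D hD3
  obtain ⟨Cn, hCn, hnu⟩ := nu_bound D hD3
  refine ⟨C, 8 * (Cb + Cn) + 1, hC, by linarith, ?_⟩
  intro F hF hhom hsq U V Q κ R hV hVU hQ hQ3 hR hR2 h64 hlog hκ hS h4V hR9
  obtain ⟨B, hB, hBc⟩ := hred F hF hhom hsq
  set H := Real.log (2 * polyNorm F) with hH
  have hH1 : 1 ≤ 2 * H := (log_two_mul_ge _ (polyNorm_pos F hF)).1
  have hU : 1 ≤ U := hV.trans hVU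
  have hlU : 0 ≤ Real.log U := Real.log_nonneg hU
  have hlQ : 0 ≤ Real.log Q := Real.log_nonneg hQ
  have hceil : ∀ W : ℝ, 1 ≤ W → 2 * W ≤ ((2 * ⌈W⌉₊ : ℕ) : ℝ) ∧ ((2 * ⌈W⌉₊ : ℕ) : ℝ) ≤ 4 * W ∧ 1 ≤ 2 * ⌈W⌉₊ := by
    intro W hW
    have h1 := Nat.le_ceil W
    have h2 := Nat.ceil_lt_add_one (by linarith : 0 ≤ W)
    refine ⟨by push_cast; linarith, by push_cast; linarith, ?_⟩
    have : 0 < ⌈W⌉₊ := Nat.ceil_pos.2 (by linarith)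
    omega
  obtain ⟨u1, u2, u3⟩ := hceil U hU
  obtain ⟨v1, v2, v3⟩ := hceil V hV
  have hfin := ptset_finite F U V
  rw [Set.ncard_eq_toFinset_card _ hfin]
  have hmem : ∀ P ∈ hfin.toFinset, P ∈ PtSet F U V := fun P hP => (Set.Finite.mem_toFinset hfin).1 hP
  refine hcore (deh F D) B Q R (2 * ⌈U⌉₊) (2 * ⌈V⌉₊) (Cn * (H + Real.log U)) κ H hfin.toFinset hB hR hR2 h64
    (by have : 0 ≤ H := by linarith
        positivity) ?_ hκ (by linarith) ?_ u3 v3 (v2.trans h4V) ?_ ?_ ?_ ?_ ?_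
  · refine le_trans ?_ hlog
    have : 8 * (B.card + Cn * (H + Real.log U)) ≤ (8 * (Cb + Cn) + 1) * (H + Real.log U) := by
      nlinarith [mul_nonneg hCb.le hlU]
    gcongr
  · apply hS B
    nlinarith
  · generalize ((2 * ⌈U⌉₊ : ℕ) : ℝ) = a at *
    generalize ((2 * ⌈V⌉₊ : ℕ) : ℝ) = b at *
    have hb : (R : ℝ) ^ 9 ≤ b ^ 2 := hR9.trans (by gcongr; linarith)
    have ha : (R : ℝ) ^ 9 ≤ a ^ 2 := hR9.trans (by gcongr; linarith)
    nlinarith [mul_le_mul_of_nonneg_right hb (sq_nonneg a), mul_le_mul_of_nonneg_right ha (sq_nonneg b)]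
  · rw [hQ3]
    calc _ ≤ (4 * U) * (4 * V) := mul_le_mul u2 v2 (by positivity) (by positivity)
      _ = _ := by ring
  · intro P hP
    have := (hmem P hP).1
    linarith
  · intro P hP
    have := (hmem P hP).2.1
    linarith
  · intro P hP
    obtain ⟨h1, h2, n, hn, e⟩ := hmem P hP
    rw [eval_eq_hev F D hhom] at e
    exact ⟨n, hn, e, hnu F hF U hU P.1 P.2 n h1 (h2.trans hVU) hn e⟩

lemma exists_thresh (A : ℝ) : ∃ q0 : ℝ, 2 ≤ q0 ∧ ∀ q : ℝ, q0 ≤ q → A * Real.log q ^ 2 ≤ q := by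
  have h := (Real.isLittleO_pow_log_id_atTop (n := 2)).bound (show (0 : ℝ) < 1 / (|A| + 1) by positivity)
  obtain ⟨q0, hq0⟩ := Filter.eventually_atTop.1 h
  refine ⟨max q0 2, le_max_right _ _, fun q hq => ?_⟩
  have h1 := hq0 q ((le_max_left _ _).trans hq)
  have h2 : 2 ≤ q := (le_max_right _ _).trans hq
  simp only [id, norm_pow, Real.norm_eq_abs, sq_abs] at h1
  rw [abs_of_nonneg (by linarith : 0 ≤ q), div_mul_eq_mul_div, le_div_iff₀ (by positivity)] at h1
  nlinarith [le_abs_self A, sq_nonneg (Real.log q)]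

lemma one_le_sum (B : Finset ℕ) : 1 ≤ ∑ r ∈ RRs B 1, 1 / (r : ℝ) := by
  classical
  have : RRs B 1 = {1} := by
    unfold RRs
    ext r
    simp only [Finset.mem_filter, Finset.mem_Icc, Finset.mem_singleton]
    constructor
    · rintro ⟨h, -⟩; omega
    · rintro rfl
      exact ⟨⟨le_rfl, le_rfl⟩, squarefree_one, by simp⟩
  rw [this]; simp

set_option maxHeartbeats 2000000 in
lemma bound_wlog (D : ℕ) (hD3 : 3 ≤ D) (hodd : Odd D) : ∃ C : ℝ, 0 < C ∧
    ∀ F : MvPolynomial (Fin 2) ℤ, F ≠ 0 → F.IsHomogeneous D →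
    Squarefree (MvPolynomial.map (Int.castRingHom ℚ) F) → ∀ (U V Q : ℝ),
    1 ≤ V → V ≤ U → 1 ≤ Q → Q ^ 3 = U * V →
    ((PtSet F U V).ncard : ℝ) ≤ C * (Q ^ 2 * Real.log (2 * polyNorm F) ^ 2 + U) := by
  obtain ⟨C, K, hC, hK, hprep⟩ := prep D hD3 hodd
  obtain ⟨q0, hq02, hq0⟩ := exists_thresh (3600 * (2 * K))
  set κ : ℝ := 40 * (K + 2) with hκ
  have hκ0 : 0 < κ := by positivity
  refine ⟨18 * K + 36 * 64 + 36 * q0 ^ 20 + C + C * κ ^ 2, by positivity, ?_⟩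
  intro F hF hhom hsq U V Q hV hVU hQ hQ3
  set H := Real.log (2 * polyNorm F) with hH
  have hH1 : 1 ≤ 2 * H := (log_two_mul_ge _ (polyNorm_pos F hF)).1
  have hU : 1 ≤ U := hV.trans hVU
  have hHsq : 1 ≤ 4 * H ^ 2 := by nlinarith
  have fin : ∀ c : ℝ, 0 ≤ c → c ≤ 18 * K + 36 * 64 + 36 * q0 ^ 20 + C + C * κ ^ 2 →
      ((PtSet F U V).ncard : ℝ) ≤ c * (Q ^ 2 * H ^ 2 + U) →
      ((PtSet F U V).ncard : ℝ) ≤ (18 * K + 36 * 64 + 36 * q0 ^ 20 + C + C * κ ^ 2) * (Q ^ 2 * H ^ 2 + U) :=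
    fun c _ hc h => h.trans (by gcongr)
  have hCκ : 0 < C * κ ^ 2 := by positivity
  have hq20 : 0 < q0 ^ 20 := by positivity
  have htriv := ptset_triv F U V hU hV
  rw [← hQ3] at htriv
  have hc : ∀ c : ℝ, 1 ≤ c → Q ≤ c → ((PtSet F U V).ncard : ℝ) ≤ 36 * c * (Q ^ 2 * H ^ 2 + U) := by
    intro c hc1 hc
    have h1 : Q ^ 3 ≤ c * Q ^ 2 := by nlinarith [sq_nonneg Q]
    have h2 : c * Q ^ 2 * 1 ≤ c * Q ^ 2 * (4 * H ^ 2) := by gcongr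
    have h3 : 0 ≤ c * U := by positivity
    nlinarith
  by_cases c64 : Q ≤ 64
  · exact fin (36 * 64) (by norm_num) (by linarith) (hc 64 (by norm_num) c64)
  push Not at c64
  by_cases cH : Q ≤ 2 * K * H ^ 2
  · refine fin (18 * K) (by positivity) (by linarith) ?_
    have h1 : Q ^ 3 ≤ 2 * K * H ^ 2 * Q ^ 2 := by nlinarith [sq_nonneg Q]
    have h3 : 0 ≤ K * U := by positivity
    nlinarith
  push Not at cH
  rcases le_or_gt (Real.log U) H with hUH | hUH
  · -- Case I
    refine fin C hC.le (by linarith) ?_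
    have hQU : Q ≤ U := by
      by_contra h
      push Not at h
      have : U * V ≤ U ^ 2 := by nlinarith
      have h3 : U ^ 3 < Q ^ 3 := by gcongr
      nlinarith
    have hlQ : Real.log Q ≤ H := (Real.log_le_log (by linarith) hQU).trans hUH
    have hlQ0 : 0 ≤ Real.log Q := Real.log_nonneg hQ
    have := hprep F hF hhom hsq U V Q 1 1 hV hVU hQ hQ3 le_rfl (by simpa using hQ) (by simpa using c64.le)
      (by
        rw [Nat.cast_one, div_one, ← hH]
        have : K * (H + Real.log U) * Real.log Q ≤ K * (H + H) * H := by
          have : 0 ≤ H := by linarith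
          gcongr
        nlinarith) one_pos
      (by
        intro B _
        have := one_le_sum B
        nlinarith)
      (by
        rw [Nat.cast_one, div_one]
        have h1 : V ^ 2 ≤ Q ^ 3 := by nlinarith
        have h2 : (4 * V) ^ 2 ≤ (Q ^ 2) ^ 2 := by
          have : Q ^ 3 * 16 ≤ Q ^ 3 * Q := by gcongr; linarith
          nlinarith
        exact (pow_le_pow_iff_left₀ (by linarith) (by positivity) (by norm_num)).1 h2)
      (by rw [Nat.cast_one, one_pow]; nlinarith)
    refine this.trans ?_
    have : 0 ≤ C * U := by positivity
    rw [← hH]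
    nlinarith
  -- Case II
  obtain ⟨w, hw4, hw1⟩ : ∃ w : ℝ, w ^ 4 = U ∧ 1 ≤ w := by
    refine ⟨U ^ ((1 : ℝ) / 4), ?_, Real.one_le_rpow hU (by norm_num)⟩
    rw [← Real.rpow_natCast, ← Real.rpow_mul (by linarith)]; norm_num
  set V' := max V w with hV'
  have hV1 : 1 ≤ V' := hV.trans (le_max_left _ _)
  have hwU : w ≤ U := by rw [← hw4]; exact le_self_pow₀ hw1 (by norm_num)
  have hVU' : V' ≤ U := max_le hVU hwU
  have hUV'1 : 1 ≤ U * V' := by nlinarith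
  obtain ⟨q, hq60, hq1⟩ : ∃ q : ℝ, q ^ 60 = U * V' ∧ 1 ≤ q := by
    refine ⟨(U * V') ^ ((1 : ℝ) / 60), ?_, Real.one_le_rpow hUV'1 (by norm_num)⟩
    rw [← Real.rpow_natCast, ← Real.rpow_mul (by linarith)]; norm_num
  have hqpos : 0 < q := by linarith
  rcases le_or_gt q q0 with hqq | hqq
  · refine fin (36 * q0 ^ 20) (by positivity) (by linarith) (hc (q0 ^ 20) (one_le_pow₀ (by linarith)) ?_)
    have h1 : Q ^ 3 ≤ (q0 ^ 20) ^ 3 := by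
      rw [hQ3]
      calc U * V ≤ U * V' := by gcongr; exact le_max_left _ _
        _ = q ^ 60 := hq60.symm
        _ ≤ q0 ^ 60 := by gcongr
        _ = _ := by ring
    exact (pow_le_pow_iff_left₀ (by linarith) (by positivity) (by norm_num)).1 h1
  have hth := hq0 q hqq.le
  have hq2 : 2 ≤ q := hq02.trans hqq.le
  have hlq : 0 ≤ Real.log q := Real.log_nonneg hq1
  have hlU : Real.log U ≤ 60 * Real.log q := by
    have : U ≤ q ^ 60 := by rw [hq60]; exact le_mul_of_one_le_right (by linarith) hV1
    have := Real.log_le_log (by linarith) this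
    rwa [Real.log_pow] at this
  have hlU0 : 0 ≤ Real.log U := Real.log_nonneg hU
  have hlogsq : Real.log U ^ 2 ≤ 3600 * Real.log q ^ 2 := by
    calc Real.log U ^ 2 ≤ (60 * Real.log q) ^ 2 := by gcongr
      _ = _ := by ring
  set R := ⌊q⌋₊ with hR
  have hRq : (R : ℝ) ≤ q := Nat.floor_le hqpos.le
  have hR1 : 1 ≤ R := Nat.le_floor (by simpa using hq1)
  have hR0 : (0 : ℝ) < R := by exact_mod_cast hR1
  have hqR : q ≤ R + 1 := (Nat.lt_floor_add_one q).le
  have hQR : q ^ 19 ≤ q ^ 20 / R := by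
    rw [le_div_iff₀ hR0]
    calc q ^ 19 * R ≤ q ^ 19 * q := by gcongr
      _ = _ := by ring
  have hq19 : q ≤ q ^ 19 := le_self_pow₀ hq1 (by norm_num)
  have hV30 : V' ≤ q ^ 30 := by
    have : V' ^ 2 ≤ (q ^ 30) ^ 2 := by
      rw [← pow_mul, hq60, sq]; gcongr
    exact (pow_le_pow_iff_left₀ (by linarith) (by positivity) (by norm_num)).1 this
  have hV12 : q ^ 12 ≤ V' := by
    have : (q ^ 12) ^ 5 ≤ V' ^ 5 := by
      rw [← pow_mul, hq60]
      have : U ≤ V' ^ 4 := by rw [← hw4]; gcongr; exact le_max_right _ _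
      calc U * V' ≤ V' ^ 4 * V' := by gcongr
        _ = _ := by ring
    exact (pow_le_pow_iff_left₀ (by positivity) (by linarith) (by norm_num)).1 this
  have key := hprep F hF hhom hsq U V' (q ^ 20) κ R hV1 hVU' (one_le_pow₀ hq1) (by rw [← hq60]; ring) hR1
    (by calc (R : ℝ) ^ 2 ≤ q ^ 2 := by gcongr
          _ ≤ q ^ 20 := pow_le_pow_right₀ hq1 (by norm_num))
    (by refine le_trans ?_ hQR
        calc (64 : ℝ) ≤ 2 ^ 19 := by norm_num
          _ ≤ q ^ 19 := by gcongr)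
    (by refine le_trans ?_ (hq19.trans hQR)
        refine le_trans ?_ hth
        rw [← hH, Real.log_pow]
        push_cast
        have h1 : K * (H + Real.log U) * (20 * Real.log q) ≤ K * (60 * Real.log q + 60 * Real.log q) * (20 * Real.log q) := by
          gcongr; linarith
        have h2 : 0 ≤ K * Real.log q ^ 2 := by positivity
        refine h1.trans ?_
        rw [show K * (60 * Real.log q + 60 * Real.log q) * (20 * Real.log q) = 2400 * (K * Real.log q ^ 2) by ring]
        linarith) hκ0
    (by intro B hB
        rw [← hH] at hB ⊢
        have h1 := sum_RRs_ge B R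
        have h2 : Real.log q ≤ Real.log (R + 1) := Real.log_le_log hqpos hqR
        have hS : 0 ≤ ∑ r ∈ RRs B R, 1 / (r : ℝ) := Finset.sum_nonneg fun _ _ => by positivity
        rw [Real.log_pow]
        push_cast
        generalize ∑ r ∈ RRs B R, 1 / (r : ℝ) = S at *
        have h3 : 2 * ((B.card : ℝ) + 1) * S ≤ 2 * (K * H + 2 * H) * S := by gcongr
        rw [hκ]
        have h4 : 40 * (K + 2) * H * S = 20 * (2 * (K * H + 2 * H) * S) := by ring
        rw [h4]
        linarith)
    (by calc 4 * V' ≤ 2 ^ 8 * q ^ 30 := by linarith [pow_pos hqpos 30]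
          _ ≤ q ^ 8 * q ^ 30 := by gcongr
          _ = (q ^ 19) ^ 2 := by ring
          _ ≤ _ := by gcongr)
    (by calc (R : ℝ) ^ 9 ≤ q ^ 9 := by gcongr
          _ ≤ q ^ 24 := pow_le_pow_right₀ hq1 (by norm_num)
          _ = (q ^ 12) ^ 2 := by ring
          _ ≤ _ := by gcongr)
  rw [← hH] at key
  refine fin (C * κ ^ 2) hCκ.le (by linarith) ?_
  refine (ptset_mono F U V V' (le_max_left _ _)).trans (key.trans ?_)
  rw [mul_assoc (C * κ ^ 2)]
  refine mul_le_mul_of_nonneg_left ?_ hCκ.le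
  rcases le_total w V with hwV | hwV
  · have e : V' = V := max_eq_left hwV
    have : q ^ 20 = Q := by
      have : (q ^ 20) ^ 3 = Q ^ 3 := by rw [hQ3, ← e, ← hq60]; ring
      exact (pow_left_inj₀ (by positivity) (by linarith) (by norm_num)).1 this
    rw [this]
    linarith
  · have e : V' = w := max_eq_right hwV
    have e1 : q ^ 12 = w := by
      have : (q ^ 12) ^ 5 = w ^ 5 := by
        rw [← pow_mul, hq60, e, ← hw4]; ring
      exact (pow_left_inj₀ (by positivity) (by linarith) (by norm_num)).1 this
    have e2 : U = q ^ 48 := by rw [← hw4, ← e1]; ring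
    have h1 : H ^ 2 ≤ q := by
      have a : H ^ 2 ≤ Real.log U ^ 2 := by
        have : 0 ≤ H := by linarith
        gcongr
      nlinarith [sq_nonneg (Real.log q)]
    have h2 : 0 ≤ Q ^ 2 * H ^ 2 := by positivity
    calc H ^ 2 * (q ^ 20) ^ 2 ≤ q * (q ^ 20) ^ 2 := by gcongr
      _ = q ^ 41 := by ring
      _ ≤ q ^ 48 := pow_le_pow_right₀ hq1 (by norm_num)
      _ = U := e2.symm
      _ ≤ _ := by linarith

end
end SqSieve

/-- Let `D ≥ 3` be odd. There is a constant `C(D)` such that for every nonzero binary form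
`F ∈ ℤ[X, Y]` of degree `D` with no repeated factor (i.e. squarefree over `ℚ`) and all real
`U, V ≥ 1`, the number of integer pairs `(x, y)` with `|x| ≤ U`, `|y| ≤ V` for which `F(x, y)`
is a nonzero square satisfies
`μ₀(U, V) ≤ C(D) ((UV)^{2/3} (log 2‖F‖)² + U + V)`. -/
theorem square_sieve_binary_form (D : ℕ) (hD : 3 ≤ D) (hodd : Odd D) :
    ∃ C : ℝ, 0 < C ∧ ∀ F : MvPolynomial (Fin 2) ℤ, F ≠ 0 → F.IsHomogeneous D →
      Squarefree (MvPolynomial.map (Int.castRingHom ℚ) F) →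
      ∀ U V : ℝ, 1 ≤ U → 1 ≤ V →
        (({p : ℤ × ℤ | (|p.1| : ℝ) ≤ U ∧ (|p.2| : ℝ) ≤ V ∧
            ∃ n : ℤ, n ≠ 0 ∧ MvPolynomial.eval ![p.1, p.2] F = n ^ 2}).ncard : ℝ) ≤
          C * ((U * V) ^ ((2 : ℝ) / 3) * Real.log (2 * polyNorm F) ^ 2 + U + V) := by
  obtain ⟨C, hC, h⟩ := SqSieve.bound_wlog D hD hodd
  refine ⟨C, hC, ?_⟩
  intro F hF hhom hsq U V hU hV
  change ((SqSieve.PtSet F U V).ncard : ℝ) ≤ _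
  have hUV : 1 ≤ U * V := by nlinarith
  have hQ1 : 1 ≤ (U * V) ^ ((1 : ℝ) / 3) := Real.one_le_rpow hUV (by norm_num)
  have hQ3 : ((U * V) ^ ((1 : ℝ) / 3)) ^ 3 = U * V := by
    rw [← Real.rpow_natCast, ← Real.rpow_mul (by linarith)]; norm_num
  have hQ2 : (U * V) ^ ((2 : ℝ) / 3) = ((U * V) ^ ((1 : ℝ) / 3)) ^ 2 := by
    rw [← Real.rpow_natCast, ← Real.rpow_mul (by linarith)]; norm_num
  rw [hQ2]
  rcases le_total V U with hVU | hVU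
  · refine (h F hF hhom hsq U V _ hV hVU hQ1 hQ3).trans ?_
    refine mul_le_mul_of_nonneg_left ?_ hC.le
    linarith
  · rw [SqSieve.ptset_swp]
    refine (h (SqSieve.swp F) (SqSieve.swp_ne F hF) (SqSieve.swp_hom F D hhom) (SqSieve.swp_sq F hsq) V U _ hU hVU hQ1
      (by rw [hQ3, mul_comm])).trans ?_
    rw [SqSieve.swp_norm]
    refine mul_le_mul_of_nonneg_left ?_ hC.le
    linarith
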